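/- Let n ≥ 1 and let a₀, …, a_{n−1} ∈ ℝ³ be nonzero, pairwise linearly independent vectors defining a complexified-real central arrangement in ℂ³ with Milnor fiber F and basepoint z₀ ∈ F. Suppose there exist j < n and a nonzero v₀ ∈ ℂ³ with ℓⱼ(v₀) = 0 such that: (i) every nonzero w ∈ ℂ³ with ℓⱼ(w) = 0, m_w > 2 and gcd(m_w, n) ≠ 1 is a complex scalar multiple of v₀ (the line ker ℓⱼ contains at most one multiple point whose multiplicity is greater than 2 and not coprime to n); and (ii) there is a nonzero u ∈ ℂ³ with ℓⱼ(u) = 0, m_u ≥ 2, and u not a complex scalar multiple of v₀ (the line ker ℓⱼ contains a multiple point besides v₀). Then Ab π₁(F, z₀) is isomorphic to the free abelian group ℤ^{n−1}. -/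

import Mathlib

open Set Topology

namespace MF

/-- continuous curve inside `U` -/
def Cv {X : Type*} [TopologicalSpace X] (U : Set X) (γ : ℝ → X) : Prop :=
  Continuous γ ∧ ∀ t, γ t ∈ U

/-- clamp to the unit interval -/
noncomputable def cl (t : ℝ) : ℝ := max 0 (min t 1)

lemma cl_mem (t : ℝ) : cl t ∈ Icc (0:ℝ) 1 :=
  ⟨le_max_left _ _, max_le zero_le_one (min_le_right _ _)⟩

lemma cl_of_mem {t : ℝ} (ht : t ∈ Icc (0:ℝ) 1) : cl t = t := by
  rw [cl, min_eq_left ht.2, max_eq_right ht.1]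

@[simp] lemma cl_zero : cl 0 = 0 := cl_of_mem ⟨le_rfl, zero_le_one⟩
@[simp] lemma cl_one : cl 1 = 1 := cl_of_mem ⟨zero_le_one, le_rfl⟩

@[fun_prop] lemma continuous_cl : Continuous cl := by unfold cl; fun_prop

/-- An additive, homotopy invariant functional on paths in `U` (a 1-cocycle). Paths are continuous
functions on the real line, evaluated between times 0 and 1. -/
structure Coc {X : Type*} [TopologicalSpace X] (U : Set X) (A : Type*) [AddCommGroup A] where
  ev : (ℝ → X) → A
  ax : ∀ F : ℝ × ℝ → X, Continuous F → (∀ p, F p ∈ U) → ∃ g : ℝ × ℝ → A,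
    ∀ γ : ℝ → ℝ × ℝ, Continuous γ → ev (fun t => F (γ t)) = g (γ 1) - g (γ 0)

variable {X Y : Type*} [TopologicalSpace X] [TopologicalSpace Y] {A : Type*} [AddCommGroup A]
  {U : Set X} {V : Set Y}

lemma Cv.comp {γ : ℝ → X} (h : Cv U γ) {φ : ℝ → ℝ} (hφ : Continuous φ) :
    Cv U (fun t => γ (φ t)) := ⟨h.1.comp hφ, fun t => h.2 _⟩

lemma Cv.mono {γ : ℝ → X} {S S' : Set X} (h : Cv S γ) (hS : S ⊆ S') : Cv S' γ :=
  ⟨h.1, fun t => hS (h.2 t)⟩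

lemma Cv.map {γ : ℝ → X} (h : Cv U γ) {f : X → Y} (hf : ContinuousOn f U) (hm : MapsTo f U V) :
    Cv V (fun t => f (γ t)) := ⟨hf.comp_continuous h.1 h.2, fun t => hm (h.2 t)⟩

/-- from a curve on the unit interval -/
lemma Cv.of_Icc {c : ℝ → X} (h : ContinuousOn c (Icc 0 1)) (hU : ∀ t ∈ Icc (0:ℝ) 1, c t ∈ U) :
    Cv U (fun t => c (cl t)) :=
  ⟨h.comp_continuous continuous_cl cl_mem, fun t => hU _ (cl_mem t)⟩

namespace Coc

/-- Pullback of a cocycle along a continuous map. -/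
def pull (D : Coc U A) (f : Y → X) (hf : ContinuousOn f V) (hm : MapsTo f V U) : Coc V A where
  ev γ := D.ev (fun t => f (γ t))
  ax F hF hV := D.ax (fun p => f (F p)) (hf.comp_continuous hF hV) fun p => hm (hV p)

/-- Difference of cocycles. -/
def sub (D D' : Coc U A) : Coc U A where
  ev γ := D.ev γ - D'.ev γ
  ax F hF hU := by
    obtain ⟨g, hg⟩ := D.ax F hF hU
    obtain ⟨g', hg'⟩ := D'.ax F hF hU
    refine ⟨fun p => g p - g' p, fun γ hγ => ?_⟩
    rw [hg γ hγ, hg' γ hγ]; beta_reduce; abel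

lemma ev_curve (D : Coc U A) {c : ℝ → X} (hc : Cv U c) :
    ∃ g : ℝ → A, ∀ φ : ℝ → ℝ, Continuous φ → D.ev (fun t => c (φ t)) = g (φ 1) - g (φ 0) := by
  obtain ⟨g, hg⟩ := D.ax (fun p => c p.1) (hc.1.comp continuous_fst) fun p => hc.2 _
  exact ⟨fun t => g (t, 0), fun φ hφ => hg (fun t => (φ t, 0)) (by fun_prop)⟩

lemma ev_cl (D : Coc U A) {c : ℝ → X} (hc : Cv U c) : D.ev (fun t => c (cl t)) = D.ev c := by
  obtain ⟨g, hg⟩ := D.ev_curve hc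
  rw [hg cl (by fun_prop)]
  have := hg (fun t => t) continuous_id
  rw [this, cl_zero, cl_one]

lemma ev_congr (D : Coc U A) {c c' : ℝ → X} (hc : Cv U c) (hc' : Cv U c')
    (h : ∀ t ∈ Icc (0 : ℝ) 1, c t = c' t) : D.ev c = D.ev c' := by
  rw [← D.ev_cl hc, ← D.ev_cl hc']
  congr 1; ext t
  exact h _ (cl_mem t)

lemma ev_const (D : Coc U A) {x : X} (hx : x ∈ U) : D.ev (fun _ => x) = 0 := by
  obtain ⟨g, hg⟩ := D.ev_curve (c := fun _ => x) ⟨continuous_const, fun _ => hx⟩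
  rw [hg (fun _ => 0) continuous_const]; simp

lemma sq (D : Coc U A) {H : ℝ → ℝ → X} (hH : Continuous fun p : ℝ × ℝ => H p.1 p.2)
    (hU : ∀ s t, H s t ∈ U) :
    D.ev (fun s => H s 0) + D.ev (fun t => H 1 t)
      = D.ev (fun t => H 0 t) + D.ev (fun s => H s 1) := by
  obtain ⟨g, hg⟩ := D.ax _ hH fun p => hU _ _
  have h1 := hg (fun s => (s, 0)) (by fun_prop)
  have h2 := hg (fun s => (1, s)) (by fun_prop)
  have h3 := hg (fun s => (0, s)) (by fun_prop)
  have h4 := hg (fun s => (s, 1)) (by fun_prop)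
  rw [h1, h2, h3, h4]; abel

/-- Value on the segment from time `a` to time `b`. -/
def seg (D : Coc U A) (c : ℝ → X) (a b : ℝ) : A := D.ev (fun t => c (a + t * (b - a)))

lemma seg_pot (D : Coc U A) {c : ℝ → X} (hc : Cv U c) :
    ∃ g : ℝ → A, ∀ a b, D.seg c a b = g b - g a := by
  obtain ⟨g, hg⟩ := D.ev_curve hc
  refine ⟨g, fun a b => ?_⟩
  rw [seg, hg (fun t => a + t * (b - a)) (by fun_prop)]
  simp

lemma seg_add (D : Coc U A) {c : ℝ → X} (hc : Cv U c) (a b d : ℝ) :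
    D.seg c a b + D.seg c b d = D.seg c a d := by
  obtain ⟨g, hg⟩ := D.seg_pot hc
  rw [hg, hg, hg]; abel

lemma seg_zero_one (D : Coc U A) (c : ℝ → X) : D.seg c 0 1 = D.ev c := by
  simp [seg]

lemma ev_rev (D : Coc U A) {c : ℝ → X} (hc : Cv U c) :
    D.ev (fun t => c (1 - t)) = - D.ev c := by
  obtain ⟨g, hg⟩ := D.ev_curve hc
  have h1 := hg (fun t => 1 - t) (by fun_prop)
  have h2 := hg (fun t => t) (by fun_prop)
  rw [h1, h2]; simp

end Coc

/-- Concatenation of paths. -/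
lemma concat {S : Set X} {c c' : ℝ → X} (hc : Cv S c) (hc' : Cv S c')
    (h : c 1 = c' 0) : ∃ d : ℝ → X, Cv S d ∧ d 0 = c 0 ∧ d 1 = c' 1 ∧
      ∀ {A : Type*} [AddCommGroup A] {U : Set X} (D : Coc U A), S ⊆ U →
        D.ev d = D.ev c + D.ev c' := by
  let e : ℝ → X := fun t => if t ≤ 1 then c t else c' (t - 1)
  have he : Cv S e := by
    constructor
    · apply Continuous.if_le hc.1 (hc'.1.comp (by fun_prop)) continuous_id continuous_const
      intro x hx; subst hx; simpa using h
    · intro t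
      by_cases ht : t ≤ 1
      · simp [e, ht, hc.2]
      · simp [e, ht, hc'.2]
  refine ⟨fun t => e (2 * t), he.comp (by fun_prop), ?_, ?_, ?_⟩
  · simp [e]
  · simp [e]; norm_num
  · intro A _ U D hSU
    have h0 : D.ev (fun t => e (2 * t)) = D.seg e 0 2 := by
      simp only [Coc.seg]; congr 1; ext t; congr 1; ring
    rw [h0, ← D.seg_add (he.mono hSU) 0 1 2]
    congr 1
    · rw [Coc.seg]
      apply D.ev_congr ((he.mono hSU).comp (by fun_prop)) (hc.mono hSU)
      intro t ht
      simp [e, ht.2]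
    · rw [Coc.seg]
      apply D.ev_congr ((he.mono hSU).comp (by fun_prop)) (hc'.mono hSU)
      intro t ht
      rcases eq_or_lt_of_le ht.1 with h' | h'
      · subst h'; simpa [e] using h
      · simp only [e]
        rw [if_neg (by linarith)]; congr 1; ring

/-- `g` is a potential of `D` on `U ∩ S`. -/
def IsPot (D : Coc U A) (S : Set X) (g : X → A) : Prop :=
  ∀ γ : ℝ → X, Cv (U ∩ S) γ → D.ev γ = g (γ 1) - g (γ 0)

/-- `D` has a potential on `U ∩ S`. -/
def HasPot (D : Coc U A) (S : Set X) : Prop := ∃ g : X → A, IsPot D S g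

lemma IsPot.mono {D : Coc U A} {S S' : Set X} {g : X → A} (h : IsPot D S' g) (hS : U ∩ S ⊆ S') :
    IsPot D S g := fun γ hγ => h γ (hγ.mono fun _ hx => ⟨hx.1, hS hx⟩)

lemma HasPot.mono {D : Coc U A} {S S' : Set X} (h : HasPot D S') (hS : U ∩ S ⊆ S') :
    HasPot D S := by
  obtain ⟨g, hg⟩ := h
  exact ⟨g, hg.mono hS⟩

lemma IsPot.seg {D : Coc U A} {S : Set X} {g : X → A} (h : IsPot D S g) {c : ℝ → X}
    (hc : Cv U c) {a b : ℝ} (hab : a ≤ b) (hS : ∀ t ∈ Icc a b, c t ∈ S) :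
    D.seg c a b = g (c b) - g (c a) := by
  have hm : ∀ s, a + cl s * (b - a) ∈ Icc a b := by
    intro s
    have := cl_mem s
    constructor <;> nlinarith [this.1, this.2]
  have h1 := h (fun s => c (a + cl s * (b - a))) ⟨hc.1.comp (by fun_prop), fun t => ⟨hc.2 _, hS _ (hm t)⟩⟩
  rw [Coc.seg, ← D.ev_cl (hc.comp (by fun_prop)), h1]
  simp

/-- interval induction -/
lemma interval_ind {a b : ℝ} (hab : a ≤ b) (P : ℝ → ℝ → Prop)
    (h1 : ∀ x y z, a ≤ x → z ≤ b → x ≤ y → y ≤ z → P x y → P y z → P x z)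
    (loc : ∀ x ∈ Icc a b, ∃ ε > 0, ∀ u ∈ Icc a b, ∀ v ∈ Icc a b, u ≤ v → |u - x| < ε →
      |v - x| < ε → P u v) : P a b := by
  set s : Set ℝ := {x | x ∈ Icc a b ∧ P a x} with hs
  have has : a ∈ s := by
    refine ⟨⟨le_rfl, hab⟩, ?_⟩
    obtain ⟨ε, hε, h⟩ := loc a ⟨le_rfl, hab⟩
    exact h a ⟨le_rfl, hab⟩ a ⟨le_rfl, hab⟩ le_rfl (by simpa) (by simpa)
  have hbdd : BddAbove s := ⟨b, fun x hx => hx.1.2⟩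
  set c := sSup s with hc
  have hac : a ≤ c := le_csSup hbdd has
  have hcb : c ≤ b := csSup_le ⟨a, has⟩ fun x hx => hx.1.2
  obtain ⟨ε, hε, h⟩ := loc c ⟨hac, hcb⟩
  obtain ⟨x, hxs, hx⟩ := exists_lt_of_lt_csSup ⟨a, has⟩ (show c - ε < sSup s by linarith)
  have hxc : x ≤ c := le_csSup hbdd hxs
  have key : ∀ v ∈ Icc a b, c ≤ v → v < c + ε → v ∈ s := by
    intro v hv hcv hvε
    refine ⟨hv, h1 a x v le_rfl hv.2 hxs.1.1 (by linarith) hxs.2 ?_⟩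
    apply h x hxs.1 v hv (by linarith)
    · rw [abs_lt]; constructor <;> linarith
    · rw [abs_lt]; constructor <;> linarith
  by_contra hcon
  have hcb' : c < b := by
    rcases eq_or_lt_of_le hcb with h' | h'
    · exact absurd (key b ⟨hab, le_rfl⟩ h'.le (by linarith)).2 hcon
    · exact h'
  have : min b (c + ε / 2) ∈ s := by
    apply key
    · exact ⟨le_min hab (by linarith), min_le_left _ _⟩
    · exact le_min hcb (by linarith)
    · exact lt_of_le_of_lt (min_le_right _ _) (by linarith)
  have h2 := le_csSup hbdd this
  have : c < min b (c + ε / 2) := lt_min hcb' (by linarith)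
  linarith

lemma pot_of_local {D : Coc U A} {S : Set X} (g : X → A)
    (h : ∀ x ∈ U ∩ S, ∃ O : Set X, IsOpen O ∧ x ∈ O ∧ IsPot D (S ∩ O) g) : IsPot D S g := by
  intro γ hγ
  have hγU := hγ.mono inter_subset_left
  rw [← D.seg_zero_one]
  apply interval_ind zero_le_one (fun u v => D.seg γ u v = g (γ v) - g (γ u))
  · intro x y z _ _ _ _ h1 h2
    rw [← D.seg_add hγU x y z, h1, h2]; abel
  · intro t _
    obtain ⟨O, hO, hxO, hl⟩ := h (γ t) (hγ.2 t)
    obtain ⟨ε, hε, hb⟩ := Metric.isOpen_iff.1 (hO.preimage hγ.1) t hxO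
    refine ⟨ε, hε, fun u _ v _ huv hu hv => hl.seg hγU huv fun s hs => ⟨(hγ.2 _).2, hb ?_⟩⟩
    rw [Metric.mem_ball, Real.dist_eq]
    rw [abs_lt] at *
    constructor <;> linarith [hs.1, hs.2]

lemma joined_curve {S : Set X} {x y : X} (h : JoinedIn S x y) :
    ∃ c : ℝ → X, Cv S c ∧ c 0 = x ∧ c 1 = y := by
  refine ⟨h.somePath.extend, ⟨h.somePath.continuous_extend, fun t => ?_⟩, by simp, by simp⟩
  have : h.somePath.extend t ∈ range h.somePath.extend := ⟨t, rfl⟩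
  rw [Path.extend_range] at this
  obtain ⟨s, hs⟩ := this
  rw [← hs]; exact h.somePath_mem s

lemma joined_of_curve {S : Set X} {x y : X} (c : ℝ → X) (hc : ContinuousOn c (Icc 0 1))
    (h0 : c 0 = x) (h1 : c 1 = y) (hS : ∀ t ∈ Icc (0:ℝ) 1, c t ∈ S) : JoinedIn S x y :=
  ⟨⟨⟨fun t => c t, hc.comp_continuous continuous_subtype_val fun t => t.2⟩,
    by simpa using h0, by simpa using h1⟩, fun t => hS t t.2⟩

/-- gluing when the potentials differ by a constant -/
lemma glue_const {D : Coc U A} {S₁ S₂ : Set X} (o₁ : IsOpen S₁) (o₂ : IsOpen S₂) {g₁ g₂ : X → A}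
    (h₁ : IsPot D S₁ g₁) (h₂ : IsPot D S₂ g₂)
    (hc : ∀ x ∈ U ∩ S₁ ∩ S₂, ∀ y ∈ U ∩ S₁ ∩ S₂, g₁ x - g₂ x = g₁ y - g₂ y) :
    HasPot D (S₁ ∪ S₂) := by
  classical
  obtain ⟨k, hk⟩ : ∃ k : A, ∀ x ∈ U ∩ S₁ ∩ S₂, g₁ x - g₂ x = k := by
    by_cases hne : (U ∩ S₁ ∩ S₂).Nonempty
    · obtain ⟨y, hy⟩ := hne
      exact ⟨_, fun x hx => hc x hx y hy⟩
    · exact ⟨0, fun x hx => absurd ⟨x, hx⟩ hne⟩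
  set g : X → A := fun x => if x ∈ S₁ then g₁ x else g₂ x + k with hg
  have e1 : ∀ x ∈ S₁, g x = g₁ x := fun x hx => by simp [hg, hx]
  have e2 : ∀ x ∈ U, x ∈ S₂ → g x = g₂ x + k := fun x hU hx => by
    by_cases h : x ∈ S₁
    · rw [e1 x h, ← hk x ⟨⟨hU, h⟩, hx⟩]; abel
    · simp [hg, h]
  refine ⟨g, pot_of_local g ?_⟩
  rintro x ⟨hxU, hx | hx⟩
  · refine ⟨S₁, o₁, hx, fun γ hγ => ?_⟩
    rw [e1 _ (hγ.2 1).2.2, e1 _ (hγ.2 0).2.2, h₁ γ (hγ.mono fun x hx => ⟨hx.1, hx.2.2⟩)]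
  · refine ⟨S₂, o₂, hx, fun γ hγ => ?_⟩
    rw [e2 _ (hγ.2 1).1 (hγ.2 1).2.2, e2 _ (hγ.2 0).1 (hγ.2 0).2.2,
      h₂ γ (hγ.mono fun x hx => ⟨hx.1, hx.2.2⟩)]; abel

/-- any two points of `S` are joined in `S` -/
def PC (S : Set X) : Prop := ∀ x ∈ S, ∀ y ∈ S, JoinedIn S x y

lemma pot_diff {D : Coc U A} {S₁ S₂ : Set X} {g₁ g₂ : X → A}
    (h₁ : IsPot D S₁ g₁) (h₂ : IsPot D S₂ g₂) {x y : X} (hxy : JoinedIn (U ∩ S₁ ∩ S₂) x y) :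
    g₁ x - g₂ x = g₁ y - g₂ y := by
  obtain ⟨c, hc, c0, c1⟩ := joined_curve hxy
  have := h₁ c (hc.mono inter_subset_left)
  rw [h₂ c (hc.mono fun x hx => ⟨hx.1.1, hx.2⟩), c0, c1] at this
  have h3 : g₁ y - g₁ x - (g₂ y - g₂ x) = 0 := by rw [this]; abel
  rw [← sub_eq_zero, ← neg_eq_zero, ← h3]; abel

lemma HasPot.glue {D : Coc U A} {S₁ S₂ : Set X} (o₁ : IsOpen S₁) (o₂ : IsOpen S₂)
    (h₁ : HasPot D S₁) (h₂ : HasPot D S₂) (hc : PC (U ∩ S₁ ∩ S₂)) : HasPot D (S₁ ∪ S₂) := by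
  obtain ⟨g₁, h₁⟩ := h₁
  obtain ⟨g₂, h₂⟩ := h₂
  exact glue_const o₁ o₂ h₁ h₂ fun x hx y hy => pot_diff h₁ h₂ (hc x hx y hy)

lemma HasPot.of_loops {D : Coc U A} {S : Set X}
    (h : ∀ γ : ℝ → X, Cv (U ∩ S) γ → γ 0 = γ 1 → D.ev γ = 0) : HasPot D S := by
  classical
  -- representatives of path components
  have hrep : ∃ rep : X → X, (∀ x ∈ U ∩ S, JoinedIn (U ∩ S) (rep x) x) ∧
      ∀ x y, JoinedIn (U ∩ S) x y → rep x = rep y := by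
    refine ⟨fun x => if h : ∃ y, JoinedIn (U ∩ S) y x then
      @Classical.epsilon X ⟨x⟩ (fun y => JoinedIn (U ∩ S) y x) else x, fun x hx => ?_, fun x y hxy => ?_⟩
    · have h : ∃ y, JoinedIn (U ∩ S) y x := ⟨x, JoinedIn.refl hx⟩
      simp only [h, dite_true]
      exact @Classical.epsilon_spec X (fun y => JoinedIn (U ∩ S) y x) h
    · have h : ∃ z, JoinedIn (U ∩ S) z x := ⟨y, hxy.symm⟩
      have h' : ∃ z, JoinedIn (U ∩ S) z y := ⟨x, hxy⟩
      simp only [h, h', dite_true]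
      congr 1; ext z
      exact ⟨fun k => k.trans hxy, fun k => k.trans hxy.symm⟩
  obtain ⟨rep, r1, r2⟩ := hrep
  have : ∀ x, ∃ c : ℝ → X, x ∈ U ∩ S → (Cv (U ∩ S) c ∧ c 0 = rep x ∧ c 1 = x) := by
    intro x
    by_cases hx : x ∈ U ∩ S
    · obtain ⟨c, hc⟩ := joined_curve (r1 x hx)
      exact ⟨c, fun _ => hc⟩
    · exact ⟨fun _ => x, fun h => absurd h hx⟩
  choose c hc using this
  refine ⟨fun x => D.ev (c x), fun γ hγ => ?_⟩
  obtain ⟨a1, a2, a3⟩ := hc _ (hγ.2 0)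
  obtain ⟨b1, b2, b3⟩ := hc _ (hγ.2 1)
  have hj : JoinedIn (U ∩ S) (γ 0) (γ 1) :=
    joined_of_curve γ hγ.1.continuousOn rfl rfl fun t _ => hγ.2 t
  obtain ⟨d, d1, d2, d3, d5⟩ := concat a1 hγ a3
  obtain ⟨e, e1, e2, e3, e5⟩ := concat (c := d) (c' := fun t => c (γ 1) (1 - t)) d1
    (b1.comp (by fun_prop)) (by simp [d3, b3])
  have hl := h e e1 ?_
  · rw [e5 D inter_subset_left, d5 D inter_subset_left, D.ev_rev (b1.mono inter_subset_left)] at hl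
    rw [← sub_eq_zero, ← hl]; abel
  · rw [e2, e3, d2, a2]; simp only [sub_self]; rw [b2]; exact r2 _ _ hj

/-- Deformation: comparing `γ` and its image at the end of a homotopy. -/
lemma Coc.deform (D : Coc U A) {S : Set X} {k : ℝ → X → X}
    (hk : ContinuousOn (fun p : ℝ × X => k p.1 p.2) (Icc 0 1 ×ˢ (U ∩ S)))
    (hU : ∀ s ∈ Icc (0:ℝ) 1, ∀ x ∈ U ∩ S, k s x ∈ U) (h0 : ∀ x ∈ U ∩ S, k 0 x = x)
    {γ : ℝ → X} (hγ : Cv (U ∩ S) γ) :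
    D.ev γ + D.ev (fun s => k (cl s) (γ 1))
      = D.ev (fun s => k (cl s) (γ 0)) + D.ev (fun t => k 1 (γ t)) := by
  have hc : Continuous fun p : ℝ × ℝ => k (cl p.1) (γ p.2) := by
    have h := hγ.1
    have : Continuous fun p : ℝ × ℝ => ((cl p.1, γ p.2) : ℝ × X) := by fun_prop
    exact hk.comp_continuous this fun p => ⟨cl_mem _, hγ.2 _⟩
  have := D.sq (H := fun s t => k (cl s) (γ t)) hc fun s t => hU _ (cl_mem _) _ (hγ.2 _)
  simp only [cl_zero, cl_one] at this
  have e : (fun t => k 0 (γ t)) = γ := by ext t; exact h0 _ (hγ.2 t)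
  rw [e] at this
  rw [← this, add_comm]

lemma HasPot.of_deform {D : Coc U A} {S S' : Set X} {k : ℝ → X → X}
    (hk : ContinuousOn (fun p : ℝ × X => k p.1 p.2) (Icc 0 1 ×ˢ (U ∩ S)))
    (hU : ∀ s ∈ Icc (0:ℝ) 1, ∀ x ∈ U ∩ S, k s x ∈ U) (h0 : ∀ x ∈ U ∩ S, k 0 x = x)
    (h1 : ∀ x ∈ U ∩ S, k 1 x ∈ S') (hp : HasPot D S') : HasPot D S := by
  obtain ⟨g, hg⟩ := hp
  refine ⟨fun x => g (k 1 x) - D.ev (fun s => k (cl s) x), fun γ hγ => ?_⟩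
  have hc : Continuous fun t => k 1 (γ t) := by
    have h := hγ.1
    have : Continuous fun t : ℝ => (((1:ℝ), γ t) : ℝ × X) := by fun_prop
    exact hk.comp_continuous this fun p => ⟨⟨zero_le_one, le_rfl⟩, hγ.2 _⟩
  have := D.deform hk hU h0 hγ
  rw [hg (fun t => k 1 (γ t)) ⟨hc, fun t => ⟨hU _ ⟨zero_le_one, le_rfl⟩ _ (hγ.2 t), h1 _ (hγ.2 t)⟩⟩] at this
  rw [eq_sub_of_add_eq this]; beta_reduce; abel

/-- sets with one-point deformations have potentials -/
lemma HasPot.of_contract {D : Coc U A} {S : Set X} {k : ℝ → X → X} {P : X}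
    (hk : ContinuousOn (fun p : ℝ × X => k p.1 p.2) (Icc 0 1 ×ˢ (U ∩ S)))
    (hU : ∀ s ∈ Icc (0:ℝ) 1, ∀ x ∈ U ∩ S, k s x ∈ U) (h0 : ∀ x ∈ U ∩ S, k 0 x = x)
    (h1 : ∀ x ∈ U ∩ S, k 1 x = P) : HasPot D S := by
  refine HasPot.of_deform (S' := {P}) hk hU h0 (by simpa using h1) ⟨fun _ => 0, fun γ hγ => ?_⟩
  have : γ = fun _ => P := by ext t; exact (hγ.2 t).2
  have hP : P ∈ U := by have := (hγ.2 0); rw [← this.2]; exact this.1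
  rw [this, D.ev_const hP]; simp

end MF


open Set Topology

namespace MF

variable {X Y : Type*} [TopologicalSpace X] [TopologicalSpace Y] {A : Type*} [AddCommGroup A]
  {U : Set X} {V : Set Y}

/-- open rectangle -/
def rect (a b c d : ℝ) : Set ℂ := {w | a < w.re ∧ w.re < b ∧ c < w.im ∧ w.im < d}

lemma isOpen_rect (a b c d : ℝ) : IsOpen (rect a b c d) := by
  have h1 : IsOpen {w : ℂ | a < w.re} := isOpen_lt continuous_const Complex.continuous_re
  have h2 : IsOpen {w : ℂ | w.re < b} := isOpen_lt Complex.continuous_re continuous_const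
  have h3 : IsOpen {w : ℂ | c < w.im} := isOpen_lt continuous_const Complex.continuous_im
  have h4 : IsOpen {w : ℂ | w.im < d} := isOpen_lt Complex.continuous_im continuous_const
  exact h1.inter (h2.inter (h3.inter h4))

lemma rect_sub_ball (x y ε : ℝ) :
    rect (x - ε) (x + ε) (y - ε) (y + ε) ⊆ Metric.ball (⟨x, y⟩ : ℂ) (2 * ε) := by
  intro w hw
  obtain ⟨h1, h2, h3, h4⟩ := hw
  rw [Metric.mem_ball, Complex.dist_eq]
  have := Complex.norm_le_abs_re_add_abs_im (w - ⟨x, y⟩)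
  simp only [Complex.sub_re, Complex.sub_im] at this
  have h5 : |w.re - x| < ε := by rw [abs_lt]; constructor <;> linarith
  have h6 : |w.im - y| < ε := by rw [abs_lt]; constructor <;> linarith
  linarith

/-- Patching lemma over rectangles, compact version. -/
lemma patch_compact {D : Coc U A} {W : Set X} (hW : IsOpen W) {p : X → ℂ} (hp : ContinuousOn p W)
    {J : Set ℂ} (hJ : IsOpen J)
    (hPC : ∀ a b c d, rect a b c d ⊆ J → PC (U ∩ (W ∩ p ⁻¹' rect a b c d)))
    (hloc : ∀ w ∈ J, ∃ N, IsOpen N ∧ w ∈ N ∧ HasPot D (W ∩ p ⁻¹' N))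
    {a b c d : ℝ} (hab : a ≤ b) (hcd : c ≤ d)
    (hsub : ∀ w : ℂ, w.re ∈ Icc a b → w.im ∈ Icc c d → w ∈ J) :
    ∃ ε > 0, HasPot D (W ∩ p ⁻¹' rect (a - ε) (b + ε) (c - ε) (d + ε)) := by
  have hop : ∀ a b c d, IsOpen (W ∩ p ⁻¹' rect a b c d) := fun a b c d =>
    hp.isOpen_inter_preimage hW (isOpen_rect a b c d)
  have rmono : ∀ {a b c d a' b' c' d' : ℝ}, a' ≤ a → b ≤ b' → c' ≤ c → d ≤ d' →
      rect a b c d ⊆ rect a' b' c' d' := by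
    rintro a b c d a' b' c' d' h1 h2 h3 h4 w ⟨k1, k2, k3, k4⟩
    exact ⟨by linarith, by linarith, by linarith, by linarith⟩
  have pmono : ∀ {a b c d a' b' c' d' : ℝ}, a' ≤ a → b ≤ b' → c' ≤ c → d ≤ d' →
      HasPot D (W ∩ p ⁻¹' rect a' b' c' d') → HasPot D (W ∩ p ⁻¹' rect a b c d) := by
    intro a b c d a' b' c' d' h1 h2 h3 h4 h
    exact h.mono fun x hx => ⟨hx.2.1, rmono h1 h2 h3 h4 hx.2.2⟩
  let Q : ℝ → ℝ → ℝ → ℝ → Prop := fun a b c d => ∃ ε > 0,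
    rect (a - ε) (b + ε) (c - ε) (d + ε) ⊆ J ∧
    HasPot D (W ∩ p ⁻¹' rect (a - ε) (b + ε) (c - ε) (d + ε))
  have stepIm : ∀ x ∈ Icc a b, Q x x c d := by
    intro x hx
    apply interval_ind hcd (fun u v => Q x x u v)
    · rintro u v w hu hw huv hvw ⟨ε₁, p₁, s₁, h₁⟩ ⟨ε₂, p₂, s₂, h₂⟩
      set ε := min ε₁ ε₂
      have e1 : ε ≤ ε₁ := min_le_left _ _
      have e2 : ε ≤ ε₂ := min_le_right _ _
      have e0 : 0 < ε := lt_min p₁ p₂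
      have hU : rect (x - ε) (x + ε) (u - ε) (v + ε) ∪ rect (x - ε) (x + ε) (v - ε) (w + ε)
          = rect (x - ε) (x + ε) (u - ε) (w + ε) := by
        ext z
        constructor
        · rintro (⟨k1, k2, k3, k4⟩ | ⟨k1, k2, k3, k4⟩)
          · exact ⟨k1, k2, k3, by linarith⟩
          · exact ⟨k1, k2, by linarith, k4⟩
        · rintro ⟨k1, k2, k3, k4⟩
          by_cases h : z.im < v + ε
          · left; exact ⟨k1, k2, k3, h⟩
          · right; exact ⟨k1, k2, by linarith, k4⟩
      refine ⟨ε, e0, ?_, ?_⟩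
      · rw [← hU]
        exact union_subset ((rmono (by linarith) (by linarith) (by linarith) (by linarith)).trans s₁)
          ((rmono (by linarith) (by linarith) (by linarith) (by linarith)).trans s₂)
      · rw [← hU, preimage_union, inter_union_distrib_left]
        apply HasPot.glue (hop _ _ _ _) (hop _ _ _ _)
        · exact pmono (by linarith) (by linarith) (by linarith) (by linarith) h₁
        · exact pmono (by linarith) (by linarith) (by linarith) (by linarith) h₂
        · have : U ∩ (W ∩ p ⁻¹' rect (x - ε) (x + ε) (u - ε) (v + ε)) ∩
            (W ∩ p ⁻¹' rect (x - ε) (x + ε) (v - ε) (w + ε)) =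
            U ∩ (W ∩ p ⁻¹' rect (x - ε) (x + ε) (v - ε) (v + ε)) := by
            ext z
            constructor
            · rintro ⟨⟨zU, zW, k1, k2, k3, k4⟩, _, k5, k6, k7, k8⟩
              exact ⟨zU, zW, k1, k2, k7, k4⟩
            · rintro ⟨zU, zW, k1, k2, k3, k4⟩
              exact ⟨⟨zU, zW, k1, k2, by linarith, k4⟩, zW, k1, k2, k3, by linarith⟩
          rw [this]
          apply hPC
          exact (rmono (by linarith) (by linarith) (by linarith) (by linarith)).trans s₁
    · intro y hy
      obtain ⟨N, hN, hyN, hpot⟩ := hloc ⟨x, y⟩ (hsub _ hx hy)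
      obtain ⟨δ, hδ, hb⟩ := Metric.isOpen_iff.1 (hN.inter hJ) ⟨x, y⟩ ⟨hyN, hsub _ hx hy⟩
      have hr : rect (x - δ / 2) (x + δ / 2) (y - δ / 2) (y + δ / 2) ⊆ N ∩ J := by
        refine (rect_sub_ball x y (δ / 2)).trans ?_
        rw [show 2 * (δ / 2) = δ by ring]; exact hb
      refine ⟨δ / 4, by linarith, fun u hu v hv huv h1 h2 => ⟨δ / 4, by linarith, ?_, ?_⟩⟩
      all_goals rw [abs_lt] at h1 h2
      · refine (rmono ?_ ?_ ?_ ?_).trans (hr.trans inter_subset_right) <;> linarith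
      · refine hpot.mono fun z hz => ⟨hz.2.1, (hr.trans inter_subset_left) (rmono ?_ ?_ ?_ ?_ hz.2.2)⟩
          <;> linarith
  have : Q a b c d := by
    apply interval_ind hab (fun u v => Q u v c d)
    · rintro u v w hu hw huv hvw ⟨ε₁, p₁, s₁, h₁⟩ ⟨ε₂, p₂, s₂, h₂⟩
      set ε := min ε₁ ε₂
      have e1 : ε ≤ ε₁ := min_le_left _ _
      have e2 : ε ≤ ε₂ := min_le_right _ _
      have e0 : 0 < ε := lt_min p₁ p₂
      have hU : rect (u - ε) (v + ε) (c - ε) (d + ε) ∪ rect (v - ε) (w + ε) (c - ε) (d + ε)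
          = rect (u - ε) (w + ε) (c - ε) (d + ε) := by
        ext z
        constructor
        · rintro (⟨k1, k2, k3, k4⟩ | ⟨k1, k2, k3, k4⟩)
          · exact ⟨k1, by linarith, k3, k4⟩
          · exact ⟨by linarith, k2, k3, k4⟩
        · rintro ⟨k1, k2, k3, k4⟩
          by_cases h : z.re < v + ε
          · left; exact ⟨k1, h, k3, k4⟩
          · right; exact ⟨by linarith, k2, k3, k4⟩
      refine ⟨ε, e0, ?_, ?_⟩
      · rw [← hU]
        exact union_subset ((rmono (by linarith) (by linarith) (by linarith) (by linarith)).trans s₁)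
          ((rmono (by linarith) (by linarith) (by linarith) (by linarith)).trans s₂)
      · rw [← hU, preimage_union, inter_union_distrib_left]
        apply HasPot.glue (hop _ _ _ _) (hop _ _ _ _)
        · exact pmono (by linarith) (by linarith) (by linarith) (by linarith) h₁
        · exact pmono (by linarith) (by linarith) (by linarith) (by linarith) h₂
        · have : U ∩ (W ∩ p ⁻¹' rect (u - ε) (v + ε) (c - ε) (d + ε)) ∩
            (W ∩ p ⁻¹' rect (v - ε) (w + ε) (c - ε) (d + ε)) =
            U ∩ (W ∩ p ⁻¹' rect (v - ε) (v + ε) (c - ε) (d + ε)) := by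
            ext z
            constructor
            · rintro ⟨⟨zU, zW, k1, k2, k3, k4⟩, _, k5, k6, k7, k8⟩
              exact ⟨zU, zW, k5, k2, k3, k4⟩
            · rintro ⟨zU, zW, k1, k2, k3, k4⟩
              exact ⟨⟨zU, zW, by linarith, k2, k3, k4⟩, zW, k1, by linarith, k3, k4⟩
          rw [this]
          apply hPC
          exact (rmono (by linarith) (by linarith) (by linarith) (by linarith)).trans s₁
    · intro x hx
      obtain ⟨ε, he, hs, hpt⟩ := stepIm x hx
      refine ⟨ε / 2, by linarith, fun u hu v hv huv h1 h2 => ⟨ε / 2, by linarith, ?_, ?_⟩⟩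
      all_goals rw [abs_lt] at h1 h2
      · refine (rmono ?_ ?_ ?_ ?_).trans hs <;> linarith
      · refine pmono ?_ ?_ ?_ ?_ hpt <;> linarith
  obtain ⟨ε, he, hs, hpt⟩ := this
  exact ⟨ε, he, hpt⟩

/-- Patching lemma over rectangles (possibly unbounded). -/
lemma patch {D : Coc U A} {W : Set X} (hW : IsOpen W) {p : X → ℂ} (hp : ContinuousOn p W)
    {I₁ I₂ : Set ℝ} (o₁ : IsOpen I₁) (o₂ : IsOpen I₂) (c₁ : I₁.OrdConnected) (c₂ : I₂.OrdConnected)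
    (hPC : ∀ a b c d, rect a b c d ⊆ {w | w.re ∈ I₁ ∧ w.im ∈ I₂} →
      PC (U ∩ (W ∩ p ⁻¹' rect a b c d)))
    (hloc : ∀ w : ℂ, w.re ∈ I₁ → w.im ∈ I₂ → ∃ N, IsOpen N ∧ w ∈ N ∧ HasPot D (W ∩ p ⁻¹' N)) :
    HasPot D (W ∩ p ⁻¹' {w | w.re ∈ I₁ ∧ w.im ∈ I₂}) := by
  apply HasPot.of_loops
  intro γ hγ hl
  have hJ : IsOpen {w : ℂ | w.re ∈ I₁ ∧ w.im ∈ I₂} :=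
    (o₁.preimage Complex.continuous_re).inter (o₂.preimage Complex.continuous_im)
  have hpc : Continuous fun t => p (γ t) := hp.comp_continuous hγ.1 fun t => (hγ.2 t).2.1
  have hre : Continuous fun t => (p (γ t)).re := Complex.continuous_re.comp hpc
  have him : Continuous fun t => (p (γ t)).im := Complex.continuous_im.comp hpc
  have hne : (Icc (0:ℝ) 1).Nonempty := ⟨0, by simp⟩
  obtain ⟨ta, _, ha⟩ := isCompact_Icc.exists_isMinOn hne hre.continuousOn
  obtain ⟨tb, _, hb⟩ := isCompact_Icc.exists_isMaxOn hne hre.continuousOn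
  obtain ⟨tc, _, hc⟩ := isCompact_Icc.exists_isMinOn hne him.continuousOn
  obtain ⟨td, _, hd⟩ := isCompact_Icc.exists_isMaxOn hne him.continuousOn
  have m0 : (0:ℝ) ∈ Icc (0:ℝ) 1 := by simp
  obtain ⟨ε, he, g, hg⟩ := patch_compact (D := D) hW hp hJ hPC (fun w hw => hloc w hw.1 hw.2)
    (le_trans (ha m0) (hb m0)) (le_trans (hc m0) (hd m0))
    (fun w h1 h2 => ⟨c₁.out (hγ.2 ta).2.2.1 (hγ.2 tb).2.2.1 h1,
      c₂.out (hγ.2 tc).2.2.2 (hγ.2 td).2.2.2 h2⟩)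
  rw [← D.ev_cl (hγ.mono inter_subset_left), hg (fun t => γ (cl t))]
  · simp [hl]
  · refine ⟨hγ.1.comp continuous_cl, fun t => ⟨(hγ.2 _).1, (hγ.2 _).2.1, ?_⟩⟩
    have h1 := ha (cl_mem t)
    have h2 := hb (cl_mem t)
    have h3 := hc (cl_mem t)
    have h4 := hd (cl_mem t)
    simp only [mem_ofPred_eq] at h1 h2 h3 h4
    exact ⟨by linarith, by linarith, by linarith, by linarith⟩

/-- extending a potential over a thin set -/
lemma HasPot.extend {D : Coc U A} {S : Set X} (h : HasPot D S)
    (hloc : ∀ P ∈ U, ∃ O, IsOpen O ∧ P ∈ O ∧ HasPot D O)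
    (hnear : ∀ P ∈ U, ∀ O, IsOpen O → P ∈ O → ∃ O', IsOpen O' ∧ P ∈ O' ∧
      ∀ x ∈ U ∩ O' ∩ S, ∀ y ∈ U ∩ O' ∩ S, JoinedIn (U ∩ O ∩ S) x y)
    (hdense : ∀ P ∈ U, ∀ O, IsOpen O → P ∈ O → ∃ x ∈ S, JoinedIn (U ∩ O) P x) :
    HasPot D univ := by
  classical
  obtain ⟨g, hg⟩ := h
  have key : ∀ P : X, ∃ (O : Set X) (h : X → A), P ∈ U → IsOpen O ∧ P ∈ O ∧ IsPot D O h ∧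
      ∀ x ∈ U ∩ O ∩ S, g x = h x := by
    intro P
    by_cases hP : P ∈ U
    · obtain ⟨O, oO, PO, h, hh⟩ := hloc P hP
      obtain ⟨O', oO', PO', hj⟩ := hnear P hP O oO PO
      have : ∃ k : A, ∀ x ∈ U ∩ (O' ∩ O) ∩ S, g x - h x = k := by
        by_cases hne : (U ∩ (O' ∩ O) ∩ S).Nonempty
        · obtain ⟨y, hy⟩ := hne
          refine ⟨g y - h y, fun x hx => pot_diff hg hh ((hj x ⟨⟨hx.1.1, hx.1.2.1⟩, hx.2⟩ y
            ⟨⟨hy.1.1, hy.1.2.1⟩, hy.2⟩).mono fun z hz => ⟨⟨hz.1.1, hz.2⟩, hz.1.2⟩)⟩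
        · exact ⟨0, fun x hx => absurd ⟨x, hx⟩ hne⟩
      obtain ⟨k, hk⟩ := this
      refine ⟨O' ∩ O, fun x => h x + k, fun _ => ⟨oO'.inter oO, ⟨PO', PO⟩, fun γ hγ => ?_, ?_⟩⟩
      · rw [hh γ (hγ.mono fun x hx => ⟨hx.1, hx.2.2⟩)]; beta_reduce; abel
      · intro x hx
        beta_reduce; rw [← hk x hx]; abel
    · exact ⟨univ, g, fun h => absurd h hP⟩
  choose O h hOh using key
  refine ⟨fun P => h P P, pot_of_local _ ?_⟩
  rintro P ⟨hP, -⟩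
  obtain ⟨o1, o2, o3, o4⟩ := hOh P hP
  have claim : ∀ Q ∈ U ∩ O P, h Q Q = h P Q := by
    intro Q hQ
    obtain ⟨q1, q2, q3, q4⟩ := hOh Q hQ.1
    obtain ⟨x, xS, hx⟩ := hdense Q hQ.1 (O P ∩ O Q) (o1.inter q1) ⟨hQ.2, q2⟩
    have hxm := hx.target_mem
    have e := pot_diff o3 q3 (hx.mono fun z hz => ⟨⟨hz.1, hz.2.1⟩, hz.2.2⟩)
    rw [← o4 x ⟨⟨hxm.1, hxm.2.1⟩, xS⟩, ← q4 x ⟨⟨hxm.1, hxm.2.2⟩, xS⟩, sub_self, sub_eq_zero] at e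
    exact e.symm
  refine ⟨O P, o1, o2, fun γ hγ => ?_⟩
  have hγ' : Cv (U ∩ O P) γ := hγ.mono fun x hx => ⟨hx.1, hx.2.2⟩
  beta_reduce; rw [o3 γ hγ', claim _ (hγ'.2 1), claim _ (hγ'.2 0)]

/-- complement of finitely many affine hyperplanes in an open convex set is path connected -/
lemma pc_convex_minus {E : Type*} [AddCommGroup E] [Module ℂ E] [TopologicalSpace E]
    [ContinuousAdd E] [ContinuousSMul ℂ E] {K : Set E} (hK : IsOpen K)
    (hconv : ∀ x ∈ K, ∀ y ∈ K, ∀ t : ℝ, t ∈ Icc (0:ℝ) 1 → x + (t : ℂ) • (y - x) ∈ K)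
    {ι : Type*} [Finite ι] (φ : ι → E → ℂ)
    (hφ : ∀ i x y, ∀ τ : ℂ, φ i (x + τ • (y - x)) = φ i x + τ * (φ i y - φ i x)) :
    PC {z | z ∈ K ∧ ∀ i, φ i z ≠ 0} := by
  rintro x ⟨hx, hx'⟩ y ⟨hy, hy'⟩
  let τ : ℝ → ℝ → ℂ := fun c t => (t : ℂ) + Complex.I * (c * t * (1 - t) : ℝ)
  have hτ : Continuous fun p : ℝ × ℝ => τ p.1 p.2 := by
    simp only [τ]; fun_prop
  have hτ' : ∀ c, Continuous (τ c) := fun c => by simp only [τ]; fun_prop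
  -- small c stay inside K
  have ev1 : ∀ᶠ c in 𝓝 (0:ℝ), ∀ t ∈ Icc (0:ℝ) 1, x + τ c t • (y - x) ∈ K := by
    apply isCompact_Icc.eventually_forall_of_forall_eventually
    intro t ht
    have hc : Continuous fun p : ℝ × ℝ => x + τ p.1 p.2 • (y - x) := by fun_prop
    refine (hK.preimage hc).mem_nhds ?_
    have := hconv x hx y hy t ht
    simpa [τ] using this
  let bad : ι → ℝ := fun i => (φ i x / (φ i x - φ i y)).im /
    ((φ i x / (φ i x - φ i y)).re * (1 - (φ i x / (φ i x - φ i y)).re))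
  obtain ⟨ε, hε, hb⟩ := Metric.eventually_nhds_iff.1 ev1
  obtain ⟨c, hc1, hc2⟩ : ∃ c ∈ Ioo (0:ℝ) ε, c ∉ range bad :=
    ((Ioo_infinite hε).sdiff (finite_range bad)).nonempty
  have hc3 := hb (y := c) (by rw [Real.dist_eq, sub_zero, abs_of_pos hc1.1]; exact hc1.2)
  have h0 : τ c 0 = 0 := by simp [τ]
  have h1 : τ c 1 = 1 := by simp [τ]
  have hcont := hτ' c
  refine joined_of_curve (fun t => x + τ c t • (y - x)) (by fun_prop) (by simp [h0]) (by simp [h1])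
    fun t ht => ⟨hc3 t ht, fun i hi => ?_⟩
  rw [hφ] at hi
  have hne : φ i x - φ i y ≠ 0 := by
    intro h
    have : φ i y - φ i x = 0 := by rw [← neg_sub, h, neg_zero]
    rw [this, mul_zero, add_zero] at hi
    exact hx' i hi
  have hτe : φ i x / (φ i x - φ i y) = τ c t := by
    rw [div_eq_iff hne]; linear_combination hi
  have hre : (τ c t).re = t := by simp [τ]
  have him : (τ c t).im = c * t * (1 - t) := by simp [τ]
  have ht0 : t ≠ 0 := by
    rintro rfl
    rw [h0, zero_mul, add_zero] at hi; exact hx' i hi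
  have ht1 : t ≠ 1 := by
    rintro rfl
    rw [h1, one_mul] at hi; apply hy' i; linear_combination hi
  apply hc2
  refine ⟨i, ?_⟩
  simp only [bad]
  rw [hτe, hre, him]
  have : 1 - t ≠ 0 := sub_ne_zero.2 (Ne.symm ht1)
  field_simp

/-- continuous logarithm -/
lemma exists_log {Z : Type*} [TopologicalSpace Z] [SimplyConnectedSpace Z]
    [LocallyPathConnectedSpace Z] [Nonempty Z] {f : Z → ℂ} (hf : Continuous f) (h0 : ∀ x, f x ≠ 0) :
    ∃ L : Z → ℂ, Continuous L ∧ ∀ x, Complex.exp (L x) = f x := by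
  obtain ⟨z⟩ := ‹Nonempty Z›
  have := Complex.isCoveringMap_exp.existsUnique_continuousMap_lifts
    (f := ⟨fun x => (⟨f x, h0 x⟩ : {z : ℂ // z ≠ 0}), by fun_prop⟩) z (Complex.log (f z))
    (by simp [Complex.exp_log (h0 z)])
  obtain ⟨L, ⟨_, hL⟩, _⟩ := this
  refine ⟨L, L.continuous, fun x => ?_⟩
  have := congrFun hL x
  exact congrArg Subtype.val this

lemma log_unique {L L' : ℝ → ℂ} (h : Continuous L) (h' : Continuous L')
    (he : ∀ t, Complex.exp (L t) = Complex.exp (L' t)) : ∀ t s, L t - L' t = L s - L' s := by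
  have hz : ∀ t, ∃ m : ℤ, L t - L' t = m * (2 * Real.pi * Complex.I) := by
    intro t
    rw [← Complex.exp_eq_one_iff, Complex.exp_sub, he, div_self (Complex.exp_ne_zero _)]
  choose m hm using hz
  have hpi : (2 * Real.pi * Complex.I) ≠ 0 := Complex.two_pi_I_ne_zero
  have hc : Continuous fun t => ((m t : ℤ) : ℝ) := by
    have : (fun t => ((m t : ℤ) : ℝ)) = fun t => ((L t - L' t) / (2 * Real.pi * Complex.I)).re := by
      ext t; rw [hm t, mul_div_cancel_right₀ _ hpi]; simp
    rw [this]; fun_prop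
  have hc2 : Continuous m := by
    exact Int.isClosedEmbedding_coe_real.isInducing.continuous_iff.2 hc
  intro t s
  rw [hm, hm, PreconnectedSpace.constant inferInstance hc2 (x := t) (y := s)]

end MF


open Set Topology

namespace MF

set_option linter.unusedSectionVars false

variable {E : Type*} [NormedAddCommGroup E] [NormedSpace ℂ E] {ι : Type*} [Fintype ι]
  {A : Type*} [AddCommGroup A]

/-- Milnor fibre -/
def Fb (ℓ : ι → E →L[ℂ] ℂ) : Set E := {z | ∏ i, ℓ i z = 1}

/-- complement of the arrangement -/
def Mc (ℓ : ι → E →L[ℂ] ℂ) : Set E := {z | ∀ i, ℓ i z ≠ 0}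

/-- cone sets -/
def Cone (S : Set E) : Prop := ∀ c : ℂ, c ≠ 0 → ∀ z ∈ S, c • z ∈ S

variable {ℓ : ι → E →L[ℂ] ℂ}

lemma mem_Fb {z : E} : z ∈ Fb ℓ ↔ ∏ i, ℓ i z = 1 := Iff.rfl

lemma Fb_sub_Mc : Fb ℓ ⊆ Mc ℓ := by
  intro z hz i h0
  rw [mem_Fb, Finset.prod_eq_zero (Finset.mem_univ i) h0] at hz
  exact zero_ne_one hz

lemma prod_smul (c : ℂ) (z : E) : ∏ i, ℓ i (c • z) = c ^ (Fintype.card ι) * ∏ i, ℓ i z := by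
  simp [Finset.prod_mul_distrib, Finset.card_univ]

lemma smul_mem_Fb {c : ℂ} (hc : c ^ (Fintype.card ι) = 1) {z : E} (hz : z ∈ Fb ℓ) :
    c • z ∈ Fb ℓ := by
  rw [mem_Fb, prod_smul, hc, hz, one_mul]

lemma exp_div_card [Nonempty ι] (L : ℂ) :
    (Complex.exp (-L / (Fintype.card ι : ℂ))) ^ (Fintype.card ι) = Complex.exp (-L) := by
  rw [← Complex.exp_nat_mul]
  congr 1
  have : (Fintype.card ι : ℂ) ≠ 0 := by exact_mod_cast Fintype.card_ne_zero
  field_simp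

lemma normalize_mem [Nonempty ι] {w : E} {L : ℂ} (h : ∏ i, ℓ i w = Complex.exp L) :
    Complex.exp (-L / (Fintype.card ι : ℂ)) • w ∈ Fb ℓ := by
  rw [mem_Fb, prod_smul, exp_div_card, h, ← Complex.exp_add]; simp

/-- the monodromy scalar -/
noncomputable def om (ι : Type*) [Fintype ι] : ℂ :=
  Complex.exp (-(2 * Real.pi * Complex.I) / (Fintype.card ι : ℂ))

lemma om_ne : om ι ≠ 0 := Complex.exp_ne_zero _

lemma om_pow [Nonempty ι] : om ι ^ (Fintype.card ι) = 1 := by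
  rw [om, exp_div_card, Complex.exp_neg, Complex.exp_two_pi_mul_I, inv_one]

lemma om_pow_nat (k : ℕ) :
    om ι ^ k = Complex.exp (-(k * (2 * Real.pi * Complex.I)) / (Fintype.card ι : ℂ)) := by
  rw [om, ← Complex.exp_nat_mul]; congr 1; ring

lemma root_eq_om_pow [Nonempty ι] {c : ℂ} (hc : c ^ (Fintype.card ι) = 1) : ∃ k : ℕ, c = om ι ^ k := by
  have hp : IsPrimitiveRoot (om ι) (Fintype.card ι) := by
    have h := Complex.isPrimitiveRoot_exp (Fintype.card ι) Fintype.card_ne_zero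
    have : om ι = (Complex.exp (2 * Real.pi * Complex.I / (Fintype.card ι : ℂ)))⁻¹ := by
      rw [om, ← Complex.exp_neg]; congr 1; ring
    rw [this]; exact h.inv
  obtain ⟨k, -, hk⟩ := hp.eq_pow_of_pow_eq_one hc
  exact ⟨k, hk.symm⟩

lemma Cone.om_pow {S : Set E} (hS : Cone S) (k : ℕ) {z : E} (hz : z ∈ S) :
    om ι ^ k • z ∈ S := hS _ (pow_ne_zero _ om_ne) _ hz

lemma om_smul_Fb [Nonempty ι] (k : ℕ) {z : E} (hz : z ∈ Fb ℓ) : om ι ^ k • z ∈ Fb ℓ :=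
  smul_mem_Fb (by rw [← pow_mul, mul_comm, pow_mul, MF.om_pow, one_pow]) hz

/-- slit plane from closeness -/
lemma mem_slit_of_close {a b : ℂ} (h : ‖b - a‖ < ‖a‖) : b / a ∈ Complex.slitPlane := by
  have ha : a ≠ 0 := by rintro rfl; simp at h; exact absurd h (not_lt.2 (norm_nonneg _))
  left
  have h1 : ‖b / a - 1‖ < 1 := by
    rw [div_sub_one ha, norm_div, div_lt_one (norm_pos_iff.2 ha)]; exact h
  have h2 := (Complex.abs_re_le_norm (b / a - 1)).trans_lt h1
  rw [abs_lt] at h2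
  simp at h2; linarith

/-- normalized deformation -/
noncomputable def nd (ℓ : ι → E →L[ℂ] ℂ) (h : ℝ → E → E) (s : ℝ) (z : E) : E :=
  Complex.exp (-(∑ i, Complex.log (ℓ i (h s z) / ℓ i z)) / (Fintype.card ι : ℂ)) • h s z

lemma nd_mem [Nonempty ι] {h : ℝ → E → E} {s : ℝ} {z : E} (hz : z ∈ Fb ℓ)
    (hc : ∀ i, ‖ℓ i (h s z) - ℓ i z‖ < ‖ℓ i z‖) : nd ℓ h s z ∈ Fb ℓ := by
  apply normalize_mem
  rw [Complex.exp_sum]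
  have : ∀ i, Complex.exp (Complex.log (ℓ i (h s z) / ℓ i z)) = ℓ i (h s z) / ℓ i z := fun i =>
    Complex.exp_log (Complex.slitPlane_ne_zero (mem_slit_of_close (hc i)))
  simp_rw [this]
  rw [Finset.prod_div_distrib, mem_Fb.1 hz, div_one]

lemma nd_zero {h : ℝ → E → E} {z : E} (hz : z ∈ Fb ℓ) (h0 : h 0 z = z) : nd ℓ h 0 z = z := by
  have := Fb_sub_Mc hz
  simp only [nd, h0]
  rw [Finset.sum_eq_zero]
  · simp
  · intro i _; rw [div_self (this i), Complex.log_one]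

lemma nd_cont {h : ℝ → E → E} {S : Set E}
    (hh : ContinuousOn (fun p : ℝ × E => h p.1 p.2) (Icc 0 1 ×ˢ (Fb ℓ ∩ S)))
    (hc : ∀ s ∈ Icc (0:ℝ) 1, ∀ z ∈ Fb ℓ ∩ S, ∀ i, ‖ℓ i (h s z) - ℓ i z‖ < ‖ℓ i z‖) :
    ContinuousOn (fun p : ℝ × E => nd ℓ h p.1 p.2) (Icc 0 1 ×ˢ (Fb ℓ ∩ S)) := by
  unfold nd
  apply ContinuousOn.smul _ hh
  apply Complex.continuous_exp.comp_continuousOn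
  apply ContinuousOn.div_const
  apply ContinuousOn.neg
  apply continuousOn_finsetSum
  intro i _
  apply ContinuousOn.clog
  · apply ContinuousOn.div
    · exact (ℓ i).continuous.comp_continuousOn hh
    · exact ((ℓ i).continuous.comp continuous_snd).continuousOn
    · rintro ⟨s, z⟩ ⟨_, hz⟩
      exact Fb_sub_Mc hz.1 i
  · rintro ⟨s, z⟩ ⟨hs, hz⟩
    exact mem_slit_of_close (hc s hs z hz i)

lemma HasPot.of_nd [Nonempty ι] {D : Coc (Fb ℓ) A} {S S' : Set E} {h : ℝ → E → E}
    (hh : ContinuousOn (fun p : ℝ × E => h p.1 p.2) (Icc 0 1 ×ˢ (Fb ℓ ∩ S)))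
    (hc : ∀ s ∈ Icc (0:ℝ) 1, ∀ z ∈ Fb ℓ ∩ S, ∀ i, ‖ℓ i (h s z) - ℓ i z‖ < ‖ℓ i z‖)
    (h0 : ∀ z ∈ Fb ℓ ∩ S, h 0 z = z) (h1 : ∀ z ∈ Fb ℓ ∩ S, h 1 z ∈ S') (hS' : Cone S')
    (hp : HasPot D S') : HasPot D S :=
  HasPot.of_deform (k := nd ℓ h) (nd_cont hh hc) (fun s hs z hz => nd_mem hz.1 (hc s hs z hz))
    (fun z hz => nd_zero hz.1 (h0 z hz)) (fun z hz => hS' _ (Complex.exp_ne_zero _) _ (h1 z hz)) hp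

/-! ### flows -/

/-- domain of the rotation flow -/
def FD (ℓ : ι → E →L[ℂ] ℂ) (N : E →L[ℂ] E) (I : Finset ι) : Set E :=
  {z | (∀ i ∈ I, ℓ i (N z) = ℓ i z) ∧ ∀ i ∉ I, 2 * ‖ℓ i (N z)‖ < ‖ℓ i z‖}

lemma FD_cone (N : E →L[ℂ] E) (I : Finset ι) : Cone (FD ℓ N I) := by
  intro c hc z hz
  refine ⟨fun i hi => by simp [hz.1 i hi], fun i hi => ?_⟩
  have := hz.2 i hi
  simp only [map_smul, smul_eq_mul, norm_mul]
  have h : 0 < ‖c‖ := norm_pos_iff.2 hc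
  nlinarith

/-- angular factor -/
noncomputable def ea (θ : ℝ) : ℂ := Complex.exp (θ * Complex.I)

lemma norm_ea_sub (θ : ℝ) : ‖ea θ - 1‖ ≤ 2 := by
  calc ‖ea θ - 1‖ ≤ ‖ea θ‖ + ‖(1:ℂ)‖ := norm_sub_le _ _
    _ = 2 := by rw [ea, Complex.norm_exp_ofReal_mul_I, norm_one]; norm_num

@[fun_prop] lemma continuous_ea : Continuous ea := by unfold ea; fun_prop

@[simp] lemma ea_zero : ea 0 = 1 := by simp [ea]
@[simp] lemma ea_two_pi : ea (2 * Real.pi) = 1 := by simp [ea, Complex.exp_two_pi_mul_I]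

/-- rotation flow -/
noncomputable def fl [DecidableEq ι] (ℓ : ι → E →L[ℂ] ℂ) (N : E →L[ℂ] E) (I : Finset ι) (θ : ℝ) (z : E) : E :=
  Complex.exp (-(∑ i, if i ∈ I then θ * Complex.I else
    Complex.log (1 + (ea θ - 1) * (ℓ i (N z) / ℓ i z))) / (Fintype.card ι : ℂ)) •
      (z + (ea θ - 1) • N z)

section fl
variable [DecidableEq ι] {N : E →L[ℂ] E} {I : Finset ι}

lemma fl_slit {z : E} (hz : z ∈ FD ℓ N I) {i : ι} (hi : i ∉ I) (θ : ℝ) :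
    1 + (ea θ - 1) * (ℓ i (N z) / ℓ i z) ∈ Complex.slitPlane := by
  have h := hz.2 i hi
  have h0 : 0 < ‖ℓ i z‖ := lt_of_le_of_lt (by positivity) h
  have := mem_slit_of_close (a := 1) (b := 1 + (ea θ - 1) * (ℓ i (N z) / ℓ i z)) (by
    rw [add_sub_cancel_left, norm_mul, norm_div, norm_one, ← mul_div_assoc, div_lt_one h0]
    have := norm_ea_sub θ
    nlinarith [norm_nonneg (ℓ i (N z))])
  simpa using this

lemma fl_mem [Nonempty ι] {z : E} (hz : z ∈ Fb ℓ ∩ FD ℓ N I) (θ : ℝ) : fl ℓ N I θ z ∈ Fb ℓ := by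
  apply normalize_mem
  rw [Complex.exp_sum]
  have hM := Fb_sub_Mc hz.1
  have : ∀ i, Complex.exp (if i ∈ I then θ * Complex.I else
    Complex.log (1 + (ea θ - 1) * (ℓ i (N z) / ℓ i z))) = ℓ i (z + (ea θ - 1) • N z) / ℓ i z := by
    intro i
    have hi0 := hM i
    by_cases hi : i ∈ I
    · rw [if_pos hi]
      simp [hz.2.1 i hi]
      field_simp
      rw [ea]; ring
    · rw [if_neg hi, Complex.exp_log (Complex.slitPlane_ne_zero (fl_slit hz.2 hi θ))]
      simp; field_simp
  simp_rw [this]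
  rw [Finset.prod_div_distrib, mem_Fb.1 hz.1, div_one]

lemma fl_zero (z : E) : fl ℓ N I 0 z = z := by
  simp [fl]

lemma fl_two_pi (z : E) : fl ℓ N I (2 * Real.pi) z = om ι ^ I.card • z := by
  simp [fl, om_pow_nat]

lemma fl_smul {c : ℂ} (hc : c ≠ 0) (θ : ℝ) (z : E) : fl ℓ N I θ (c • z) = c • fl ℓ N I θ z := by
  simp only [fl, map_smul, smul_eq_mul, mul_div_mul_left _ _ hc]
  module

lemma fl_cont : ContinuousOn (fun p : ℝ × E => fl ℓ N I p.1 p.2) (univ ×ˢ (Fb ℓ ∩ FD ℓ N I)) := by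
  unfold fl
  apply ContinuousOn.smul _ (by fun_prop)
  apply Complex.continuous_exp.comp_continuousOn
  apply ContinuousOn.div_const
  apply ContinuousOn.neg
  apply continuousOn_finsetSum
  intro i _
  by_cases hi : i ∈ I
  · simp only [hi, if_true]; fun_prop
  · simp only [hi, if_false]
    apply ContinuousOn.clog
    · apply ContinuousOn.add continuousOn_const
      apply ContinuousOn.mul (by fun_prop)
      apply ContinuousOn.div (by fun_prop) (by fun_prop)
      rintro ⟨s, z⟩ ⟨_, hz⟩
      exact Fb_sub_Mc hz.1 i
    · rintro ⟨s, z⟩ ⟨_, hz⟩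
      exact fl_slit hz.2 hi s

lemma fl_cv [Nonempty ι] {z : E} (hz : z ∈ Fb ℓ ∩ FD ℓ N I) : Cv (Fb ℓ) (fun θ => fl ℓ N I θ z) := by
  refine ⟨?_, fl_mem hz⟩
  have h := (fl_cont (ℓ := ℓ) (N := N) (I := I)).comp_continuous
    (f := fun θ : ℝ => ((θ, z) : ℝ × E)) (by fun_prop) (fun θ => ⟨mem_univ _, hz⟩)
  exact h

end fl

/-- difference under scalar multiplication -/
noncomputable def Dz (Φ : Coc (Fb ℓ) A) (ζ : ℂ) (hζ : ζ ^ (Fintype.card ι) = 1) : Coc (Fb ℓ) A :=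
  (Φ.pull (fun z => ζ • z) (by fun_prop) (fun _ hz => smul_mem_Fb hζ hz)).sub Φ

lemma Dz_ev (Φ : Coc (Fb ℓ) A) (ζ : ℂ) (hζ) (γ : ℝ → E) :
    (Dz Φ ζ hζ).ev γ = Φ.ev (fun t => ζ • γ t) - Φ.ev γ := rfl

/-- `Φ ∘ (scaling by ζ) - Φ` has a potential on `S`. -/
def HP (Φ : Coc (Fb ℓ) A) (ζ : ℂ) (S : Set E) : Prop :=
  ∃ hζ : ζ ^ (Fintype.card ι) = 1, HasPot (Dz Φ ζ hζ) S

lemma HP.mul {Φ : Coc (Fb ℓ) A} {ζ ζ' : ℂ} {S : Set E} (hS : Cone S) (hz : ζ ≠ 0)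
    (h : HP Φ ζ S) (h' : HP Φ ζ' S) : HP Φ (ζ' * ζ) S := by
  obtain ⟨h1, g, hg⟩ := h
  obtain ⟨h2, g', hg'⟩ := h'
  refine ⟨by rw [mul_pow, h1, h2, one_mul], fun z => g' (ζ • z) + g z, fun γ hγ => ?_⟩
  have e1 := hg γ hγ
  have e2 := hg' (fun t => ζ • γ t) (hγ.map (by fun_prop) fun z hz' =>
    ⟨smul_mem_Fb h1 hz'.1, hS _ hz _ hz'.2⟩)
  rw [Dz_ev] at *
  have : (fun t => (ζ' * ζ) • γ t) = fun t => ζ' • ζ • γ t := by ext t; rw [mul_smul]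
  rw [this, ← sub_add_sub_cancel _ (Φ.ev fun t => ζ • γ t), e1, e2]
  beta_reduce; abel

lemma HP.one (Φ : Coc (Fb ℓ) A) (S : Set E) : HP Φ 1 S :=
  ⟨one_pow _, 0, fun γ _ => by rw [Dz_ev]; simp⟩

lemma HP.pow {Φ : Coc (Fb ℓ) A} {ζ : ℂ} {S : Set E} (hS : Cone S) (hz : ζ ≠ 0)
    (h : HP Φ ζ S) (k : ℕ) : HP Φ (ζ ^ k) S := by
  induction k with
  | zero => rw [pow_zero]; exact HP.one Φ S
  | succ k ih => rw [_root_.pow_succ]; exact HP.mul hS hz h ih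

lemma HP.mono {Φ : Coc (Fb ℓ) A} {ζ : ℂ} {S S' : Set E} (h : HP Φ ζ S') (hS : Fb ℓ ∩ S ⊆ S') :
    HP Φ ζ S := ⟨h.1, h.2.mono hS⟩

lemma flow_isPot [Nonempty ι] [DecidableEq ι] (Φ : Coc (Fb ℓ) A) (N : E →L[ℂ] E) (I : Finset ι)
    (hζ : (om ι ^ I.card) ^ (Fintype.card ι) = 1) :
    IsPot (Dz Φ (om ι ^ I.card) hζ) (FD ℓ N I)
      (fun z => Φ.ev (fun s => fl ℓ N I (2 * Real.pi * cl s) z)) := by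
  intro γ hγ
  have := Φ.deform (k := fun s z => fl ℓ N I (2 * Real.pi * s) z) (S := FD ℓ N I) ?_ ?_ ?_ hγ
  · simp only [mul_one, fl_two_pi] at this
    rw [Dz_ev]; beta_reduce
    rw [sub_eq_sub_iff_add_eq_add, add_comm, ← this, add_comm]
  · have h2 : Continuous fun p : ℝ × E => ((2 * Real.pi * p.1, p.2) : ℝ × E) := by fun_prop
    have h := (fl_cont (ℓ := ℓ) (N := N) (I := I)).comp (s := Icc (0:ℝ) 1 ×ˢ (Fb ℓ ∩ FD ℓ N I))
      (f := fun p : ℝ × E => ((2 * Real.pi * p.1, p.2) : ℝ × E))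
      h2.continuousOn fun p hp => ⟨mem_univ _, hp.2⟩
    exact h
  · intro s _ z hz; exact fl_mem hz _
  · intro z _; simp [fl_zero]

lemma HP.flow [Nonempty ι] (Φ : Coc (Fb ℓ) A) (N : E →L[ℂ] E) (I : Finset ι) :
    HP Φ (om ι ^ I.card) (FD ℓ N I) := by
  classical
  exact ⟨by rw [← pow_mul, mul_comm, pow_mul, om_pow, one_pow], _, flow_isPot Φ N I _⟩

lemma HP.flow_coprime [Nonempty ι] (Φ : Coc (Fb ℓ) A) (N : E →L[ℂ] E) (I : Finset ι)
    (hI : Nat.gcd I.card (Fintype.card ι) = 1) : HP Φ (om ι) (FD ℓ N I) := by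
  obtain ⟨k, hk⟩ : ∃ k : ℕ, (om ι ^ I.card) ^ k = om ι := by
    rcases Nat.lt_or_ge 1 (Fintype.card ι) with h | h
    · obtain ⟨k, hk⟩ := Nat.exists_mul_mod_eq_one_of_coprime hI h
      refine ⟨k, ?_⟩
      rw [← pow_mul, ← Nat.div_add_mod (I.card * k) (Fintype.card ι), hk.2, pow_add, pow_mul, om_pow]
      simp
    · have : Fintype.card ι = 1 := le_antisymm h Fintype.card_pos
      have h1 := om_pow (ι := ι)
      rw [this, pow_one] at h1
      exact ⟨0, by rw [h1]; simp⟩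
  rw [← hk]
  exact (HP.flow Φ N I).pow (FD_cone N I) (pow_ne_zero _ om_ne) k

/-- flow path gives a joining -/
lemma joined_flow [Nonempty ι] [DecidableEq ι] {N : E →L[ℂ] E} {I : Finset ι} {S : Set E} {z : E} (hz : z ∈ Fb ℓ ∩ FD ℓ N I)
    (hS : Cone S) (h : ∀ θ, z + (ea θ - 1) • N z ∈ S) :
    JoinedIn (Fb ℓ ∩ S) z (om ι ^ I.card • z) := by
  refine joined_of_curve (fun s => fl ℓ N I (2 * Real.pi * s) z)
    ((fl_cv hz).comp (φ := fun s => 2 * Real.pi * s) (by fun_prop)).1.continuousOn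
    (by simp [fl_zero]) (by simp [fl_two_pi]) fun t _ => ⟨fl_mem hz _, hS _ (Complex.exp_ne_zero _) _ (h _)⟩

/-- connectedness in the Milnor fibre from connectedness in the complement -/
lemma pc_Fb [Nonempty ι] {S : Set E} (hS : Cone S) (hM : PC (Mc ℓ ∩ S))
    (hP : ∃ P ∈ Fb ℓ ∩ S, JoinedIn (Fb ℓ ∩ S) P (om ι • P)) : PC (Fb ℓ ∩ S) := by
  obtain ⟨P, hPm, hPj⟩ := hP
  have step : ∀ k : ℕ, JoinedIn (Fb ℓ ∩ S) P (om ι ^ k • P) := by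
    intro k
    induction k with
    | zero => simpa using JoinedIn.refl hPm
    | succ k ih =>
      refine ih.trans ?_
      obtain ⟨c, hc, c0, c1⟩ := joined_curve hPj
      have hcc := hc.1
      refine joined_of_curve (fun t => om ι ^ k • c t) (by fun_prop) (by simp [c0])
        (by simp [c1, pow_succ, mul_smul]) fun t _ => ⟨om_smul_Fb k (hc.2 t).1, hS.om_pow k (hc.2 t).2⟩
  have key : ∀ x ∈ Fb ℓ ∩ S, JoinedIn (Fb ℓ ∩ S) P x := by
    intro x hx
    obtain ⟨c, hc, c0, c1⟩ := joined_curve (hM x ⟨Fb_sub_Mc hx.1, hx.2⟩ P ⟨Fb_sub_Mc hPm.1, hPm.2⟩)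
    have hcc := hc.1
    obtain ⟨L, hL, hLe⟩ := exists_log (f := fun t => ∏ i, ℓ i (c t)) (by fun_prop)
      (fun t => Finset.prod_ne_zero_iff.2 fun i _ => (hc.2 t).1 i)
    have hL0 : Complex.exp (L 0) = 1 := by rw [hLe, c0]; exact hx.1
    have hL1 : Complex.exp (L 1) = 1 := by rw [hLe, c1]; exact hPm.1
    have hroot : (Complex.exp (-(L 1 - L 0) / (Fintype.card ι : ℂ))) ^ (Fintype.card ι) = 1 := by
      rw [exp_div_card, Complex.exp_neg, Complex.exp_sub, hL1, hL0]; simp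
    obtain ⟨k, hk⟩ := root_eq_om_pow hroot
    have : JoinedIn (Fb ℓ ∩ S) x (om ι ^ k • P) := by
      refine joined_of_curve (fun t => Complex.exp (-(L t - L 0) / (Fintype.card ι : ℂ)) • c t)
        (by fun_prop) (by simp [c0]) (by rw [hk, c1]) fun t _ => ⟨normalize_mem ?_,
          hS _ (Complex.exp_ne_zero _) _ (hc.2 t).2⟩
      rw [Complex.exp_sub, hL0, div_one, hLe]
    exact (step k).trans this.symm
  intro x hx y hy
  exact (key x hx).symm.trans (key y hy)

/-! ### retraction near a point of the fibre, and extension over hyperplane sections -/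

/-- local retraction -/
noncomputable def nu (ℓ : ι → E →L[ℂ] ℂ) (z : E) : E :=
  Complex.exp (-Complex.log (∏ i, ℓ i z) / (Fintype.card ι : ℂ)) • z

lemma nu_fix {z : E} (hz : z ∈ Fb ℓ) : nu ℓ z = z := by
  rw [nu, mem_Fb.1 hz]; simp

lemma nu_ball [Nonempty ι] {P : E} (hP : P ∈ Fb ℓ) {O : Set E} (hO : IsOpen O) (hPO : P ∈ O) :
    ∃ r > 0, ContinuousOn (nu ℓ) (Metric.ball P r) ∧ ∀ z ∈ Metric.ball P r, nu ℓ z ∈ Fb ℓ ∩ O := by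
  set W : Set E := {z | ∏ i, ℓ i z ∈ Complex.slitPlane} with hW
  have oW : IsOpen W := Complex.isOpen_slitPlane.preimage (by fun_prop)
  have hc : ContinuousOn (nu ℓ) W := by
    unfold nu
    apply ContinuousOn.smul _ continuousOn_id
    apply Complex.continuous_exp.comp_continuousOn
    apply ContinuousOn.div_const
    apply ContinuousOn.neg
    apply ContinuousOn.clog (by fun_prop)
    intro z hz; exact hz
  have hPW : P ∈ W := by simp [hW, mem_Fb.1 hP]
  obtain ⟨r, hr, hb⟩ := Metric.isOpen_iff.1 (hc.isOpen_inter_preimage oW hO) P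
    ⟨hPW, by rw [mem_preimage, nu_fix hP]; exact hPO⟩
  refine ⟨r, hr, hc.mono fun z hz => (hb hz).1, fun z hz => ⟨?_, (hb hz).2⟩⟩
  exact normalize_mem (Complex.exp_log (Complex.slitPlane_ne_zero (hb hz).1)).symm

lemma ball_line {P x y : E} {r : ℝ} (hx : x ∈ Metric.ball P r) (hy : y ∈ Metric.ball P r) {t : ℝ}
    (ht : t ∈ Icc (0:ℝ) 1) : x + (t : ℂ) • (y - x) ∈ Metric.ball P r := by
  rw [mem_ball_iff_norm] at *
  have : x + (t : ℂ) • (y - x) - P = ((1 - t : ℝ) : ℂ) • (x - P) + (t : ℂ) • (y - P) := by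
    push_cast; module
  rw [this]
  refine (norm_add_le _ _).trans_lt ?_
  rw [norm_smul, norm_smul, Complex.norm_real, Complex.norm_real, Real.norm_of_nonneg ht.1,
    Real.norm_of_nonneg (by linarith [ht.2])]
  rcases eq_or_lt_of_le ht.1 with h | h
  · subst h; simpa using hx
  · nlinarith [ht.2]

lemma HasPot.local_Fb [Nonempty ι] (D : Coc (Fb ℓ) A) {P : E} (hP : P ∈ Fb ℓ) :
    ∃ O, IsOpen O ∧ P ∈ O ∧ HasPot D O := by
  obtain ⟨r, hr, hc, hm⟩ := nu_ball hP isOpen_univ (mem_univ P)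
  have hPb := Metric.mem_ball_self (x := P) hr
  refine ⟨Metric.ball P r, Metric.isOpen_ball, hPb,
    HasPot.of_contract (k := fun s z => nu ℓ (z + (s : ℂ) • (P - z))) (P := P) ?_ ?_ ?_ ?_⟩
  · have h2 : Continuous fun p : ℝ × E => p.2 + (p.1 : ℂ) • (P - p.2) := by fun_prop
    exact hc.comp h2.continuousOn fun p hp => ball_line hp.2.2 hPb hp.1
  · intro s hs z hz; exact (hm _ (ball_line hz.2 hPb hs)).1
  · intro z hz; simp [nu_fix hz.1]
  · intro z hz; simp [nu_fix hP]

lemma HasPot.extend_Fb [Nonempty ι] {D : Coc (Fb ℓ) A} {κ : Type*} [Finite κ] (φ : κ → E →L[ℂ] ℂ)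
    (hne : ∃ d, ∀ k, φ k d ≠ 0) (h : HasPot D {z | ∀ k, φ k z ≠ 0}) : HasPot D univ := by
  have hcone : Cone {z : E | ∀ k, φ k z ≠ 0} := fun c hc z hz k => by
    simpa [hc] using hz k
  apply HasPot.extend h (fun P hP => HasPot.local_Fb D hP)
  · intro P hP O hO hPO
    obtain ⟨r, hr, hc, hm⟩ := nu_ball hP hO hPO
    refine ⟨Metric.ball P r, Metric.isOpen_ball, Metric.mem_ball_self hr, fun x hx y hy => ?_⟩
    obtain ⟨c, hcv, c0, c1⟩ := joined_curve (pc_convex_minus (K := Metric.ball P r) Metric.isOpen_ball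
      (fun x hx y hy t ht => ball_line hx hy ht) (fun k z => φ k z)
      (fun k x y τ => by simp) x ⟨hx.1.2, hx.2⟩ y ⟨hy.1.2, hy.2⟩)
    refine joined_of_curve (fun t => nu ℓ (c t)) (hc.comp_continuous hcv.1
      fun t => (hcv.2 t).1).continuousOn (by rw [c0, nu_fix hx.1.1]) (by rw [c1, nu_fix hy.1.1])
      fun t _ => ⟨hm _ (hcv.2 t).1, hcone _ (Complex.exp_ne_zero _) _ (hcv.2 t).2⟩
  · intro P hP O hO hPO
    obtain ⟨r, hr, hc, hm⟩ := nu_ball hP hO hPO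
    obtain ⟨d, hd⟩ := hne
    have hcon : Continuous fun t : ℝ => P + (t : ℂ) • d := by fun_prop
    obtain ⟨ε, hε, hb⟩ := Metric.isOpen_iff.1 ((Metric.isOpen_ball (x := P) (ε := r)).preimage hcon) 0
      (by simpa using hr)
    let bad : κ → ℝ := fun k => (-(φ k P) / φ k d).re
    obtain ⟨t, ht, hbad⟩ : ∃ t ∈ Ioo (0:ℝ) ε, t ∉ range bad :=
      ((Ioo_infinite hε).sdiff (finite_range bad)).nonempty
    have hball : ∀ s ∈ Icc (0:ℝ) 1, P + ((s * t : ℝ) : ℂ) • d ∈ Metric.ball P r := by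
      intro s hs
      apply hb
      rw [Metric.mem_ball, Real.dist_eq, sub_zero, abs_of_nonneg (mul_nonneg hs.1 ht.1.le)]
      nlinarith [ht.1, ht.2, hs.1, hs.2]
    refine ⟨nu ℓ (P + (t : ℂ) • d), hcone _ (Complex.exp_ne_zero _) _ fun k hk => ?_,
      joined_of_curve (fun s => nu ℓ (P + ((s * t : ℝ) : ℂ) • d)) ?_ ?_ ?_ fun s hs => hm _ (hball s hs)⟩
    · apply hbad
      refine ⟨k, ?_⟩
      simp only [bad]
      have : -(φ k P) / φ k d = t := by
        rw [div_eq_iff (hd k)]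
        simp at hk; linear_combination -hk
      rw [this]; simp
    · have : Continuous fun s : ℝ => P + ((s * t : ℝ) : ℂ) • d := by fun_prop
      exact hc.comp this.continuousOn hball
    · simp [nu_fix hP]
    · simp

end MF


open Set Topology

namespace MF

set_option linter.unusedSectionVars false

section near
variable {E : Type*} [NormedAddCommGroup E] [NormedSpace ℂ E] {ι : Type*} [Fintype ι]
  {ℓ : ι → E →L[ℂ] ℂ}

/-- points near a fixed point of the flow generator lie in the flow domain -/
lemma near_FD {N : E →L[ℂ] E} {I : Finset ι} {q : E} (hq : N q = 0)
    (hI : ∀ i ∈ I, ∀ z, ℓ i (N z) = ℓ i z) (hI' : ∀ i ∉ I, (∀ z, ℓ i (N z) = 0) ∨ ℓ i q ≠ 0) :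
    ∃ δ > 0, ∀ z ∈ Metric.ball q δ, z ∈ Mc ℓ → z ∈ FD ℓ N I := by
  have : ∀ᶠ z in 𝓝 q, ∀ i, (i ∉ I → ¬ (∀ z, ℓ i (N z) = 0) → 2 * ‖ℓ i (N z)‖ < ‖ℓ i z‖) := by
    rw [Filter.eventually_all]
    intro i
    by_cases h1 : i ∈ I
    · exact Filter.Eventually.of_forall fun z h => absurd h1 h
    by_cases h2 : ∀ z, ℓ i (N z) = 0
    · exact Filter.Eventually.of_forall fun z _ h => absurd h2 h
    have h3 : ℓ i q ≠ 0 := (hI' i h1).resolve_left h2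
    have : IsOpen {z | 2 * ‖ℓ i (N z)‖ < ‖ℓ i z‖} := isOpen_lt (by fun_prop) (by fun_prop)
    filter_upwards [this.mem_nhds (by simp [hq, h3])] with z hz _ _ using hz
  obtain ⟨δ, hδ, h⟩ := Metric.eventually_nhds_iff.1 this
  refine ⟨δ, hδ, fun z hz hM => ⟨fun i hi => hI i hi z, fun i hi => ?_⟩⟩
  by_cases h2 : ∀ z, ℓ i (N z) = 0
  · rw [h2]; simpa using hM i
  · exact h hz i hi h2

end near

lemma PC.image {X Y : Type*} [TopologicalSpace X] [TopologicalSpace Y] {S : Set X} (h : PC S)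
    {f : X → Y} (hf : ContinuousOn f S) : PC (Set.image f S) := by
  rintro _ ⟨x, hx, rfl⟩ _ ⟨y, hy, rfl⟩
  obtain ⟨c, hc, c0, c1⟩ := joined_curve (h x hx y hy)
  exact joined_of_curve (fun t => f (c t)) (hf.comp_continuous hc.1 hc.2).continuousOn (by rw [c0])
    (by rw [c1]) fun t _ => ⟨c t, hc.2 t, rfl⟩

/-- coordinates -/
abbrev E3 := ℂ × ℂ × ℂ

/-- linear form with given coefficients -/
noncomputable def cf (a b c : ℂ) : E3 →L[ℂ] ℂ :=
  a • ContinuousLinearMap.fst ℂ ℂ (ℂ × ℂ) +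
  b • ((ContinuousLinearMap.fst ℂ ℂ ℂ).comp (ContinuousLinearMap.snd ℂ ℂ (ℂ × ℂ))) +
  c • ((ContinuousLinearMap.snd ℂ ℂ ℂ).comp (ContinuousLinearMap.snd ℂ ℂ (ℂ × ℂ)))

@[simp] lemma cf_apply (a b c : ℂ) (z : E3) : cf a b c z = a * z.1 + b * z.2.1 + c * z.2.2 := by
  simp [cf]

/-- linear form times a vector -/
noncomputable def rk (f : E3 →L[ℂ] ℂ) (v : E3) : E3 →L[ℂ] E3 := f.smulRight v

@[simp] lemma rk_apply (f : E3 →L[ℂ] ℂ) (v z : E3) : rk f v z = f z • v := rfl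

open Classical in
/-- normalized arrangement data -/
structure Arr (ι : Type*) [Fintype ι] where
  A : ι → ℂ
  B : ι → ℂ
  C : ι → ℂ
  j : ι
  l0 : ι
  hA : A j = 1
  hB : B j = 0
  hC : C j = 0
  hl0 : C l0 ≠ 0
  np : ∀ i i', i ≠ i' → ∀ c, A i = c * A i' → B i = c * B i' → C i = c * C i' → False
  pts : ∀ π : ℂ, (Finset.univ.filter fun i => B i + C i * π = 0).card ≤ 2 ∨
    Nat.gcd (Finset.univ.filter fun i => B i + C i * π = 0).card (Fintype.card ι) = 1

namespace Arr
variable {ι : Type*} [Fintype ι] (R : Arr ι)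

/-- the forms -/
noncomputable def lf (i : ι) : E3 →L[ℂ] ℂ := cf (R.A i) (R.B i) (R.C i)

@[simp] lemma lf_apply (i : ι) (z : E3) :
    R.lf i z = R.A i * z.1 + R.B i * z.2.1 + R.C i * z.2.2 := by simp [lf]

lemma lf_j (z : E3) : R.lf R.j z = z.1 := by simp [R.hA, R.hB, R.hC]

lemma BC {i : ι} (hi : i ≠ R.j) (hB : R.B i = 0) : R.C i ≠ 0 := by
  intro hC
  exact R.np i R.j hi (R.A i) (by simp [R.hA]) (by simp [hB, R.hB]) (by simp [hC, R.hC])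

lemma nonemp {ι : Type*} [Fintype ι] (R : Arr ι) : Nonempty ι := ⟨R.j⟩

lemma z1_ne {z : E3} (hz : z ∈ Mc R.lf) : z.1 ≠ 0 := by
  have := hz R.j; rwa [lf_j] at this

/-- critical values of the first projection -/
def Crit : Set ℂ := {x | (∃ i, R.C i = 0 ∧ R.A i + R.B i * x = 0) ∨
  ∃ l l', l ≠ l' ∧ R.C l ≠ 0 ∧ R.C l' ≠ 0 ∧ (R.A l + R.B l * x) * R.C l' = (R.A l' + R.B l' * x) * R.C l}

lemma finite_Crit : R.Crit.Finite := by
  have e : R.Crit = (⋃ i, {x | R.C i = 0 ∧ R.A i + R.B i * x = 0}) ∪ ⋃ l, ⋃ l', {x | l ≠ l' ∧ R.C l ≠ 0 ∧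
    R.C l' ≠ 0 ∧ (R.A l + R.B l * x) * R.C l' = (R.A l' + R.B l' * x) * R.C l} := by
    ext x; simp [Crit]
  rw [e]
  refine (finite_iUnion fun i => Subsingleton.finite ?_).union
    (finite_iUnion fun l => finite_iUnion fun l' => Subsingleton.finite ?_)
  · rintro x ⟨hC, hx⟩ y ⟨_, hy⟩
    by_contra hxy
    have hb : R.B i = 0 := by
      have : R.B i * (x - y) = 0 := by linear_combination hx - hy
      exact (mul_eq_zero.1 this).resolve_right (sub_ne_zero.2 hxy)
    by_cases hi : i = R.j
    · subst hi; rw [R.hA, hb] at hx; simp at hx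
    · exact R.BC hi hb hC
  · rintro x ⟨hl, hC, hC', hx⟩ y ⟨_, _, _, hy⟩
    by_contra hxy
    have hb : R.B l * R.C l' = R.B l' * R.C l := by
      have : (R.B l * R.C l' - R.B l' * R.C l) * (x - y) = 0 := by linear_combination hx - hy
      exact sub_eq_zero.1 ((mul_eq_zero.1 this).resolve_right (sub_ne_zero.2 hxy))
    have ha : R.A l * R.C l' = R.A l' * R.C l := by linear_combination hx - x * hb
    refine R.np l l' hl (R.C l / R.C l') ?_ ?_ ?_ <;> field_simp
    · linear_combination ha
    · linear_combination hb

/-- the roots in the fibre -/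
noncomputable def f (l : ι) (x : ℂ) : ℂ := -(R.A l + R.B l * x) / R.C l

lemma f_spec {l : ι} (hl : R.C l ≠ 0) (x : ℂ) : R.A l + R.B l * x + R.C l * R.f l x = 0 := by
  rw [f]; field_simp; ring

lemma f_ne {x : ℂ} (hx : x ∉ R.Crit) {i l : ι} (hil : i ≠ l) (hl : R.C l ≠ 0) :
    R.A i + R.B i * x + R.C i * R.f l x ≠ 0 := by
  intro h
  apply hx
  by_cases hi : R.C i = 0
  · left; exact ⟨i, hi, by rw [hi] at h; linear_combination h⟩
  · right; refine ⟨i, l, hil, hi, hl, ?_⟩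
    have := R.f_spec hl x
    linear_combination R.C l * h - R.C i * this

lemma exists_norm {z : E3} (hz : z ∈ Mc R.lf) : ∃ c : ℂ, c ≠ 0 ∧ c • z ∈ Fb R.lf := by
  have := R.nonemp
  exact ⟨_, Complex.exp_ne_zero _, normalize_mem (Complex.exp_log
    (Finset.prod_ne_zero_iff.2 fun i _ => hz i)).symm⟩

/-! #### connectedness of the pieces -/

lemma pc_inf {ε a b c d : ℝ} (hε : 0 < ε) :
    PC (Fb R.lf ∩ ({z : E3 | ‖z.1‖ < ε * ‖z.2.1‖} ∩ (fun z : E3 => z.2.2 / z.2.1) ⁻¹' rect a b c d)) := by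
  classical
  have := R.nonemp
  set S : Set E3 := {z : E3 | ‖z.1‖ < ε * ‖z.2.1‖} ∩ (fun z : E3 => z.2.2 / z.2.1) ⁻¹' rect a b c d with hS
  have hcone : Cone S := by
    rintro k hk z ⟨hz1, hz2⟩
    have hk' : 0 < ‖k‖ := norm_pos_iff.2 hk
    refine ⟨?_, ?_⟩
    · simp only [mem_ofPred_eq] at hz1
      simp [norm_mul]; nlinarith
    · simp only [mem_preimage] at hz2 ⊢
      simpa [mul_div_mul_left _ _ hk] using hz2
  have hz21 : ∀ z ∈ S, z.2.1 ≠ 0 := by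
    rintro z ⟨hz1, _⟩ h0
    simp [h0] at hz1
    exact absurd hz1 (not_lt.2 (norm_nonneg _))
  rcases (rect a b c d).eq_empty_or_nonempty with he | hne
  · intro x hx; exact absurd hx.2.2 (by rw [mem_preimage, he]; simp)
  apply pc_Fb hcone
  · -- chart
    let K : Set E3 := {p | ‖p.2.1‖ < ε ∧ p.2.2 ∈ rect a b c d}
    let φ : Option ι → E3 → ℂ := fun o p => o.elim p.1 fun i => R.A i * p.2.1 + R.B i + R.C i * p.2.2
    have hK : IsOpen K := by
      have h1 : IsOpen {p : E3 | ‖p.2.1‖ < ε} := isOpen_lt (by fun_prop) continuous_const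
      have h2 : IsOpen ((fun p : E3 => p.2.2) ⁻¹' rect a b c d) :=
        (isOpen_rect a b c d).preimage (by fun_prop)
      exact h1.inter h2
    have hpc : PC {p | p ∈ K ∧ ∀ i, φ i p ≠ 0} := by
      apply pc_convex_minus hK
      · rintro x ⟨hx1, hx2, hx3, hx4, hx5⟩ y ⟨hy1, hy2, hy3, hy4, hy5⟩ t ht
        constructor
        · have := ball_line (P := (0:ℂ)) (x := x.2.1) (y := y.2.1) (r := ε) (by simpa using hx1) (by simpa using hy1) ht
          simpa using this
        · have h0 := ht.1
          have h1 := ht.2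
          rcases eq_or_lt_of_le h0 with h | h
          · subst h; simp [rect]; exact ⟨hx2, hx3, hx4, hx5⟩
          refine ⟨?_, ?_, ?_, ?_⟩ <;> simp <;> nlinarith
      · rintro (_ | i) x y τ
        · simp [φ]
        · simp [φ]; ring
    have him : Set.image (fun p : E3 => (p.1 * p.2.1, p.1, p.1 * p.2.2)) {p | p ∈ K ∧ ∀ i, φ i p ≠ 0} = Mc R.lf ∩ S := by
      ext z
      constructor
      · rintro ⟨p, ⟨⟨hp1, hp2⟩, hp3⟩, rfl⟩
        have hp0 : p.1 ≠ 0 := hp3 none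
        have hp0' : 0 < ‖p.1‖ := norm_pos_iff.2 hp0
        refine ⟨fun i => ?_, ?_, ?_⟩
        · have := mul_ne_zero hp0 (hp3 (some i))
          simp only [φ, Option.elim] at this
          rw [lf_apply]; intro h; apply this; simp only at h; linear_combination h
        · simp [norm_mul]; nlinarith
        · simp only [mem_preimage]
          rw [mul_div_cancel_left₀ _ hp0]; exact hp2
      · rintro ⟨hM, hzS⟩
        have h21 := hz21 z hzS
        have h21' : 0 < ‖z.2.1‖ := norm_pos_iff.2 h21
        refine ⟨(z.2.1, z.1 / z.2.1, z.2.2 / z.2.1), ⟨⟨?_, hzS.2⟩, ?_⟩, ?_⟩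
        · simp only [norm_div]; rw [div_lt_iff₀ h21']; exact hzS.1
        · rintro (_ | i)
          · exact h21
          · have := hM i
            rw [lf_apply] at this
            simp only [φ, Option.elim]
            intro h; apply this
            field_simp at h
            linear_combination h
        · simp only
          rw [mul_div_cancel₀ _ h21, mul_div_cancel₀ _ h21]
    rw [← him]
    exact hpc.image (by fun_prop)
  · -- a meridian
    obtain ⟨v, hv, hvg⟩ : ∃ v ∈ rect a b c d, ∀ i, i ≠ R.j → R.B i + R.C i * v ≠ 0 := by
      have hinf : (rect a b c d).Infinite := by
        obtain ⟨w, hw⟩ := hne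
        exact infinite_of_mem_nhds w ((isOpen_rect a b c d).mem_nhds hw)
      have hfin : (⋃ i, {v : ℂ | i ≠ R.j ∧ R.B i + R.C i * v = 0}).Finite := by
        refine finite_iUnion fun i => Subsingleton.finite ?_
        rintro x ⟨hi, hx⟩ y ⟨_, hy⟩
        by_contra hxy
        have hc : R.C i = 0 := by
          have : R.C i * (x - y) = 0 := by linear_combination hx - hy
          exact (mul_eq_zero.1 this).resolve_right (sub_ne_zero.2 hxy)
        rw [hc] at hx
        exact R.BC hi (by linear_combination hx) hc
      obtain ⟨v, hv, hv2⟩ := (hinf.sdiff hfin).nonempty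
      refine ⟨v, hv, fun i hi h => hv2 ?_⟩
      rw [mem_iUnion]; exact ⟨i, hi, h⟩
    have hev : ∀ᶠ u : ℝ in 𝓝 (0:ℝ), ∀ i, i ≠ R.j →
        2 * ‖R.A i * (u:ℂ)‖ < ‖R.A i * u + R.B i + R.C i * v‖ := by
      rw [Filter.eventually_all]; intro i
      by_cases hi : i = R.j
      · exact Filter.Eventually.of_forall fun _ h => absurd hi h
      have : IsOpen {u : ℝ | 2 * ‖R.A i * (u:ℂ)‖ < ‖R.A i * u + R.B i + R.C i * v‖} :=
        isOpen_lt (by fun_prop) (by fun_prop)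
      filter_upwards [this.mem_nhds (by simp [hvg i hi])] with u hu _ using hu
    obtain ⟨δ, hδ, hu⟩ := Metric.eventually_nhds_iff.1 hev
    obtain ⟨u, hu0, hu1⟩ : ∃ u : ℝ, 0 < u ∧ u < min δ ε := exists_between (lt_min hδ hε)
    have hu' := hu (y := u) (by rw [Real.dist_eq, sub_zero, abs_of_pos hu0]; exact hu1.trans_le (min_le_left _ _))
    set N := rk (R.lf R.j) (1, 0, 0) with hN
    have hF : ((u : ℂ), (1 : ℂ), v) ∈ FD R.lf N {R.j} := by
      constructor
      · intro i hi
        rw [Finset.mem_singleton] at hi; subst hi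
        simp [hN, R.hA, R.hB, R.hC]
      · intro i hi
        rw [Finset.mem_singleton] at hi
        have := hu' i hi
        simpa [hN, R.hA, R.hB, R.hC, mul_comm] using this
    have hM : ((u : ℂ), (1 : ℂ), v) ∈ Mc R.lf := by
      intro i
      by_cases hi : i = R.j
      · subst hi; rw [lf_j]; simpa using hu0.ne'
      · have := hu' i hi
        have h2 : 0 < ‖R.A i * u + R.B i + R.C i * v‖ := lt_of_le_of_lt (by positivity) this
        rw [norm_pos_iff] at h2; simpa using h2
    have hzS : ∀ θ : ℝ, ((u : ℂ), (1 : ℂ), v) + (ea θ - 1) • N ((u : ℂ), (1 : ℂ), v) ∈ S := by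
      intro θ
      refine ⟨?_, ?_⟩
      · have : ‖(u:ℂ) + (ea θ - 1) * u‖ < ε := by
          have h3 : (u:ℂ) + (ea θ - 1) * u = ea θ * u := by ring
          rw [h3, norm_mul, ea, Complex.norm_exp_ofReal_mul_I, Complex.norm_real, Real.norm_of_nonneg hu0.le]
          linarith [min_le_right δ ε]
        simpa [hN, R.hA, R.hB, R.hC] using this
      · simpa [hN] using hv
    obtain ⟨k, hk, hkF⟩ := R.exists_norm hM
    refine ⟨_, ⟨hkF, hcone k hk _ (by simpa using hzS 0)⟩, ?_⟩
    have := joined_flow (N := N) (I := {R.j}) (S := S) ⟨hkF, FD_cone _ _ k hk _ hF⟩ hcone (fun θ => by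
      have := hcone k hk _ (hzS θ)
      rw [map_smul, smul_comm, ← smul_add]; exact this)
    simpa using this

/-- the noncritical part -/
def W1 : Set E3 := {z | z.1 ≠ 0 ∧ ∀ c ∈ R.Crit, z.2.1 - c * z.1 ≠ 0}

lemma W1_iff {z : E3} : z ∈ R.W1 ↔ z.1 ≠ 0 ∧ z.2.1 / z.1 ∉ R.Crit := by
  constructor
  · rintro ⟨h1, h2⟩
    refine ⟨h1, fun h => h2 _ h ?_⟩
    field_simp; ring
  · rintro ⟨h1, h2⟩
    refine ⟨h1, fun c hc h => h2 ?_⟩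
    rwa [show z.2.1 / z.1 = c by field_simp; linear_combination h]

lemma isOpen_W1 : IsOpen R.W1 := by
  have : R.W1 = {z | z.1 ≠ 0} ∩ ⋂ c ∈ R.Crit, {z | z.2.1 - c * z.1 ≠ 0} := by
    ext z; simp [W1]
  rw [this]
  refine (isOpen_ne_fun (by fun_prop) continuous_const).inter (R.finite_Crit.isOpen_biInter fun c _ => ?_)
  exact isOpen_ne_fun (by fun_prop) continuous_const

lemma cont_x : ContinuousOn (fun z : E3 => z.2.1 / z.1) R.W1 :=
  ContinuousOn.div (by fun_prop) (by fun_prop) fun z hz => hz.1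

/-- a flow around the plane `l0` inside fibres -/
noncomputable def N0 : E3 →L[ℂ] E3 := rk (R.lf R.l0) (0, 0, (R.C R.l0)⁻¹)

lemma N0_good {x : ℂ} (hx : x ∉ R.Crit) {δ : ℝ} (hδ : 0 < δ) :
    ∃ y, ‖y - R.f R.l0 x‖ < δ ∧ ((1 : ℂ), x, y) ∈ FD R.lf R.N0 {R.l0} ∧ ((1 : ℂ), x, y) ∈ Mc R.lf := by
  have hev : ∀ᶠ u : ℝ in 𝓝 (0:ℝ), ∀ i, i ≠ R.l0 →
      2 * ‖R.C i * (u:ℂ)‖ < ‖R.A i + R.B i * x + R.C i * (R.f R.l0 x + u)‖ := by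
    rw [Filter.eventually_all]; intro i
    by_cases hi : i = R.l0
    · exact Filter.Eventually.of_forall fun _ h => absurd hi h
    have : IsOpen {u : ℝ | 2 * ‖R.C i * (u:ℂ)‖ < ‖R.A i + R.B i * x + R.C i * (R.f R.l0 x + u)‖} :=
      isOpen_lt (by fun_prop) (by fun_prop)
    filter_upwards [this.mem_nhds (by simpa using R.f_ne hx hi R.hl0)] with u hu _ using hu
  obtain ⟨δ', hδ', hu⟩ := Metric.eventually_nhds_iff.1 hev
  obtain ⟨u, hu0, hu1⟩ : ∃ u : ℝ, 0 < u ∧ u < min δ δ' := exists_between (lt_min hδ hδ')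
  have hu' := hu (y := u) (by rw [Real.dist_eq, sub_zero, abs_of_pos hu0]; exact hu1.trans_le (min_le_right _ _))
  have hl : R.lf R.l0 (1, x, R.f R.l0 x + u) = R.C R.l0 * u := by
    rw [lf_apply]; linear_combination R.f_spec R.hl0 x
  have hl0 := R.hl0
  refine ⟨R.f R.l0 x + u, ?_, ⟨?_, ?_⟩, ?_⟩
  · rw [add_sub_cancel_left, Complex.norm_real, Real.norm_of_nonneg hu0.le]
    exact hu1.trans_le (min_le_left _ _)
  · intro i hi
    rw [Finset.mem_singleton] at hi; subst hi
    rw [N0, rk_apply, map_smul, smul_eq_mul, lf_apply (z := (0, 0, _))]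
    simp only; field_simp; simp
  · intro i hi
    rw [Finset.mem_singleton] at hi
    have h2 := hu' i hi
    rw [N0, rk_apply, map_smul, smul_eq_mul, lf_apply (z := (0, 0, _)), hl, lf_apply]
    simp only [mul_zero, zero_add, mul_one]
    rw [show R.C R.l0 * u * (R.C i * (R.C R.l0)⁻¹) = R.C i * u by field_simp]
    exact h2
  · intro i
    by_cases hi : i = R.l0
    · subst hi; rw [hl]; exact mul_ne_zero R.hl0 (by exact_mod_cast hu0.ne')
    · have h2 := hu' i hi
      have h3 := lt_of_le_of_lt (by positivity) h2
      rw [norm_pos_iff] at h3; simpa using h3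

lemma N0_move (z : E3) (t : ℂ) : (z + t • R.N0 z).1 = z.1 ∧ (z + t • R.N0 z).2.1 = z.2.1 := by
  simp [N0]

lemma W1_cone : Cone R.W1 := by
  rintro k hk z hz
  rw [W1_iff] at *
  simpa [hk, mul_div_mul_left _ _ hk] using hz

lemma pc_fin {a b c d : ℝ} :
    PC (Fb R.lf ∩ (R.W1 ∩ (fun z : E3 => z.2.1 / z.1) ⁻¹' rect a b c d)) := by
  classical
  have := R.nonemp
  have := R.finite_Crit.to_subtype
  set S : Set E3 := R.W1 ∩ (fun z : E3 => z.2.1 / z.1) ⁻¹' rect a b c d with hS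
  have hcone : Cone S := by
    rintro k hk z ⟨hz1, hz2⟩
    refine ⟨R.W1_cone k hk z hz1, ?_⟩
    simp only [mem_preimage] at hz2 ⊢
    simpa [mul_div_mul_left _ _ hk] using hz2
  rcases (rect a b c d).eq_empty_or_nonempty with he | hne
  · intro x hx; exact absurd hx.2.2 (by rw [mem_preimage, he]; simp)
  apply pc_Fb hcone
  · -- chart
    let K : Set E3 := {p | p.2.1 ∈ rect a b c d}
    let φ : Option (ι ⊕ R.Crit) → E3 → ℂ := fun o p => o.elim p.1 (Sum.elim
      (fun i => R.A i + R.B i * p.2.1 + R.C i * p.2.2) (fun k => p.2.1 - k.1))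
    have hK : IsOpen K := (isOpen_rect a b c d).preimage (by fun_prop)
    have hpc : PC {p | p ∈ K ∧ ∀ i, φ i p ≠ 0} := by
      apply pc_convex_minus hK
      · rintro x ⟨hx2, hx3, hx4, hx5⟩ y ⟨hy2, hy3, hy4, hy5⟩ t ht
        have h0 := ht.1
        have h1 := ht.2
        rcases eq_or_lt_of_le h0 with h | h
        · subst h; simp [K, rect]; exact ⟨hx2, hx3, hx4, hx5⟩
        refine ⟨?_, ?_, ?_, ?_⟩ <;> simp <;> nlinarith
      · rintro (_ | i | k) x y τ
        · simp [φ]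
        · simp [φ]; ring
        · simp [φ]; ring
    have him : Set.image (fun p : E3 => (p.1, p.1 * p.2.1, p.1 * p.2.2)) {p | p ∈ K ∧ ∀ i, φ i p ≠ 0} = Mc R.lf ∩ S := by
      ext z
      constructor
      · rintro ⟨p, ⟨hp2, hp3⟩, rfl⟩
        have hp0 : p.1 ≠ 0 := hp3 none
        refine ⟨fun i => ?_, ?_, ?_⟩
        · have := mul_ne_zero hp0 (hp3 (some (Sum.inl i)))
          simp only [φ, Option.elim, Sum.elim_inl] at this
          rw [lf_apply]; intro h; apply this; simp only at h; linear_combination h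
        · refine ⟨hp0, fun c hc h => hp3 (some (Sum.inr ⟨c, hc⟩)) ?_⟩
          simp only [φ, Option.elim, Sum.elim_inr] at h ⊢
          have : p.1 * (p.2.1 - c) = 0 := by linear_combination h
          exact (mul_eq_zero.1 this).resolve_left hp0
        · simp only [mem_preimage]
          rw [mul_div_cancel_left₀ _ hp0]; exact hp2
      · rintro ⟨hM, hzS⟩
        have h1 : z.1 ≠ 0 := hzS.1.1
        refine ⟨(z.1, z.2.1 / z.1, z.2.2 / z.1), ⟨hzS.2, ?_⟩, ?_⟩
        · rintro (_ | i | k)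
          · exact h1
          · have := hM i
            rw [lf_apply] at this
            simp only [φ, Option.elim, Sum.elim_inl]
            intro h; apply this
            field_simp at h
            linear_combination h
          · simp only [φ, Option.elim, Sum.elim_inr]
            intro h
            apply (R.W1_iff.1 hzS.1).2
            rw [sub_eq_zero.1 h]; exact k.2
        · simp only
          rw [mul_div_cancel₀ _ h1, mul_div_cancel₀ _ h1]
    rw [← him]
    exact hpc.image (by fun_prop)
  · -- a meridian
    obtain ⟨x, hx, hxc⟩ : ∃ x ∈ rect a b c d, x ∉ R.Crit := by
      have hinf : (rect a b c d).Infinite := by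
        obtain ⟨w, hw⟩ := hne
        exact infinite_of_mem_nhds w ((isOpen_rect a b c d).mem_nhds hw)
      exact (hinf.sdiff R.finite_Crit).nonempty
    obtain ⟨y, -, hF, hM⟩ := R.N0_good hxc one_pos
    have hzS : ∀ θ : ℝ, ((1 : ℂ), x, y) + (ea θ - 1) • R.N0 ((1 : ℂ), x, y) ∈ S := by
      intro θ
      have := R.N0_move (1, x, y) (ea θ - 1)
      refine ⟨?_, ?_⟩
      · rw [W1_iff, this.1, this.2]; simpa using hxc
      · rw [mem_preimage]; beta_reduce; rw [this.1, this.2]; simpa using hx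
    obtain ⟨k, hk, hkF⟩ := R.exists_norm hM
    refine ⟨_, ⟨hkF, hcone k hk _ (by simpa using hzS 0)⟩, ?_⟩
    have := joined_flow (N := R.N0) (I := {R.l0}) (S := S) ⟨hkF, FD_cone _ _ k hk _ hF⟩ hcone (fun θ => by
      have := hcone k hk _ (hzS θ)
      rw [map_smul, smul_comm, ← smul_add]; exact this)
    simpa using this

end Arr

end MF


open Set Topology

namespace MF

namespace Arr
variable {ι : Type*} [Fintype ι] (R : Arr ι) {A : Type*} [AddCommGroup A] (Φ : Coc (Fb R.lf) A)

lemma A_of {π : ℂ} {N : E3 →L[ℂ] E3} {I : Finset ι} (hq : N (0, 1, π) = 0)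
    (hI : ∀ i ∈ I, ∀ z, R.lf i (N z) = R.lf i z)
    (hI' : ∀ i ∉ I, (∀ z, R.lf i (N z) = 0) ∨ R.lf i (0, 1, π) ≠ 0)
    (hg : Nat.gcd I.card (Fintype.card ι) = 1) :
    ∃ δ > 0, HP Φ (om ι) {z : E3 | ‖z.1‖ < δ * ‖z.2.1‖ ∧ ‖z.2.2 / z.2.1 - π‖ < δ} := by
  have := R.nonemp
  obtain ⟨δ, hδ, h⟩ := near_FD (ℓ := R.lf) hq hI hI'
  refine ⟨δ, hδ, (HP.flow_coprime Φ N I hg).mono ?_⟩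
  rintro z ⟨hz, hz1, hz2⟩
  have h2 : 0 < ‖z.2.1‖ := by
    by_contra h0
    have h1 := norm_nonneg z.1
    have : ‖z.2.1‖ = 0 := le_antisymm (not_lt.1 h0) (norm_nonneg _)
    rw [this] at hz1; linarith
  have h2' : z.2.1 ≠ 0 := norm_pos_iff.1 h2
  have e : z = z.2.1 • ((z.1 / z.2.1, 1, z.2.2 / z.2.1) : E3) := by
    ext <;> simp <;> field_simp
  rw [e]
  refine FD_cone N I _ h2' _ (h _ ?_ ?_)
  · rw [mem_ball_iff_norm, Prod.norm_def, Prod.norm_def]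
    simp only [Prod.fst_sub, Prod.snd_sub, sub_zero, sub_self, norm_zero]
    refine max_lt ?_ (max_lt hδ hz2)
    rw [norm_div, div_lt_iff₀ h2]; exact hz1
  · have hM := Fb_sub_Mc hz
    intro i h0
    apply hM i
    rw [e, map_smul, h0, smul_zero]

lemma A_local (π : ℂ) :
    ∃ δ > 0, HP Φ (om ι) {z : E3 | ‖z.1‖ < δ * ‖z.2.1‖ ∧ ‖z.2.2 / z.2.1 - π‖ < δ} := by
  classical
  set I := (Finset.univ.filter fun i => R.B i + R.C i * π = 0) with hI
  have hjI : R.j ∈ I := by simp [hI, R.hB, R.hC]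
  have key : Nat.gcd I.card (Fintype.card ι) = 1 → ∃ δ > 0, HP Φ (om ι)
      {z : E3 | ‖z.1‖ < δ * ‖z.2.1‖ ∧ ‖z.2.2 / z.2.1 - π‖ < δ} := by
    intro hg
    refine R.A_of Φ (N := ContinuousLinearMap.id ℂ E3 - rk (cf 0 1 0) (0, 1, π)) (I := I) ?_ ?_ ?_ hg
    · simp
    · intro i hi z
      rw [hI, Finset.mem_filter] at hi
      simp
      linear_combination (-z.2.1) * hi.2
    · intro i hi
      right
      rw [hI, Finset.mem_filter] at hi
      simpa using hi
  rcases R.pts π with h | h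
  · have h1 : 0 < I.card := Finset.card_pos.2 ⟨_, hjI⟩
    have h' : I.card ≤ 2 := by convert h
    rcases (by omega : I.card = 1 ∨ I.card = 2) with h2 | h2
    · exact key (by rw [h2]; simp)
    · obtain ⟨l, hl⟩ : ∃ l, I.erase R.j = {l} := Finset.card_eq_one.1 (by
        rw [Finset.card_erase_of_mem hjI, h2])
      have hl1 : l ∈ I.erase R.j := by rw [hl]; simp
      have hlj : l ≠ R.j := (Finset.mem_erase.1 hl1).1
      have hlI : R.B l + R.C l * π = 0 := by
        have := (Finset.mem_erase.1 hl1).2; rw [hI, Finset.mem_filter] at this; exact this.2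
      have hCl : R.C l ≠ 0 := by
        intro hc
        rw [hc] at hlI
        exact R.BC hlj (by linear_combination hlI) hc
      refine R.A_of Φ (N := rk (R.lf R.j) (1, 0, -(R.A l / R.C l))) (I := {R.j}) ?_ ?_ ?_ (by simp)
      · simp [R.hA, R.hB, R.hC]
      · intro i hi z
        rw [Finset.mem_singleton] at hi; subst hi
        simp [R.hA, R.hB, R.hC]
      · intro i hi
        rw [Finset.mem_singleton] at hi
        by_cases hil : i = l
        · left; intro z; subst hil; simp; field_simp; simp
        · right
          have : i ∉ I := fun h => hil (by
            have : i ∈ I.erase R.j := Finset.mem_erase.2 ⟨hi, h⟩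
            rw [hl] at this; simpa using this)
          rw [hI, Finset.mem_filter] at this
          simpa using this
  · exact key (by convert h)

lemma A_infty : ∃ V > 0, ∃ ε > 0, HP Φ (om ι)
    {z : E3 | ‖z.1‖ < ε * ‖z.2.1‖ ∧ V * ‖z.2.1‖ < ‖z.2.2‖} := by
  have := R.nonemp
  have hV : ∀ᶠ V : ℝ in Filter.atTop, ∀ i, R.C i ≠ 0 → 3 * ‖R.A i‖ + ‖R.B i‖ ≤ V * ‖R.C i‖ := by
    rw [Filter.eventually_all]; intro i
    by_cases hi : R.C i = 0
    · exact Filter.Eventually.of_forall fun _ h => absurd hi h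
    have hi' : 0 < ‖R.C i‖ := norm_pos_iff.2 hi
    filter_upwards [Filter.eventually_ge_atTop ((3 * ‖R.A i‖ + ‖R.B i‖) / ‖R.C i‖)] with V hV _
    rwa [div_le_iff₀ hi'] at hV
  obtain ⟨V, hV, hV0⟩ := (hV.and (Filter.eventually_gt_atTop 0)).exists
  have hε : ∀ᶠ ε : ℝ in 𝓝 0, ∀ i, R.B i ≠ 0 → 3 * ε * ‖R.A i‖ < ‖R.B i‖ := by
    rw [Filter.eventually_all]; intro i
    by_cases hi : R.B i = 0
    · exact Filter.Eventually.of_forall fun _ h => absurd hi h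
    have : IsOpen {ε : ℝ | 3 * ε * ‖R.A i‖ < ‖R.B i‖} := isOpen_lt (by fun_prop) (by fun_prop)
    filter_upwards [this.mem_nhds (by simp [hi])] with u hu _ using hu
  obtain ⟨δ, hδ, hu⟩ := Metric.eventually_nhds_iff.1 hε
  obtain ⟨u, hu0, hu1⟩ : ∃ u : ℝ, 0 < u ∧ u < min δ 1 := exists_between (lt_min hδ one_pos)
  have hu' := hu (y := u) (by rw [Real.dist_eq, sub_zero, abs_of_pos hu0]; exact hu1.trans_le (min_le_left _ _))
  have hu2 : u < 1 := hu1.trans_le (min_le_right _ _)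
  refine ⟨V, hV0, u, hu0, (HP.flow_coprime Φ (rk (R.lf R.j) (1, 0, 0)) {R.j} (by simp)).mono ?_⟩
  rintro z ⟨hz, hz1, hz2⟩
  have h20 : 0 < ‖z.2.1‖ := by
    by_contra h0
    have h1 := norm_nonneg z.1
    have : ‖z.2.1‖ = 0 := le_antisymm (not_lt.1 h0) (norm_nonneg _)
    rw [this] at hz1; linarith
  refine ⟨?_, ?_⟩
  · intro i hi
    rw [Finset.mem_singleton] at hi; subst hi
    simp [R.hA, R.hB, R.hC]
  · intro i hi
    rw [Finset.mem_singleton] at hi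
    have e : R.lf i (rk (R.lf R.j) (1, 0, 0) z) = R.A i * z.1 := by
      rw [rk_apply, lf_j]; simp [mul_comm]
    rw [e, lf_apply, norm_mul]
    have hA0 := norm_nonneg (R.A i)
    have hm : ‖R.A i‖ * ‖z.1‖ ≤ ‖R.A i‖ * (u * ‖z.2.1‖) := mul_le_mul_of_nonneg_left hz1.le hA0
    by_cases hC : R.C i = 0
    · have hB : R.B i ≠ 0 := fun h => R.BC hi h hC
      have h3 := hu' i hB
      have h4 : ‖R.B i * z.2.1‖ ≤ ‖R.A i * z.1 + R.B i * z.2.1 + R.C i * z.2.2‖ + ‖R.A i * z.1‖ := by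
        have : R.B i * z.2.1 = (R.A i * z.1 + R.B i * z.2.1 + R.C i * z.2.2) - R.A i * z.1 := by
          rw [hC]; ring
        nth_rewrite 1 [this]
        exact norm_sub_le _ _
      rw [norm_mul, norm_mul] at h4
      nlinarith
    · have hC' : 0 < ‖R.C i‖ := norm_pos_iff.2 hC
      have h3 := hV i hC
      have h4 : ‖R.C i * z.2.2‖ ≤ ‖R.A i * z.1 + R.B i * z.2.1 + R.C i * z.2.2‖ + ‖R.A i * z.1‖ + ‖R.B i * z.2.1‖ := by
        have : R.C i * z.2.2 = (R.A i * z.1 + R.B i * z.2.1 + R.C i * z.2.2) - R.A i * z.1 - R.B i * z.2.1 := by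
          ring
        nth_rewrite 1 [this]
        exact (norm_sub_le _ _).trans (by gcongr; exact norm_sub_le _ _)
      rw [norm_mul, norm_mul, norm_mul] at h4
      have h5 : ‖R.C i‖ * (V * ‖z.2.1‖) < ‖R.C i‖ * ‖z.2.2‖ := mul_lt_mul_of_pos_left hz2 hC'
      have h6 := mul_le_mul_of_nonneg_right h3 h20.le
      have h7 : ‖R.A i‖ * (u * ‖z.2.1‖) ≤ ‖R.A i‖ * ‖z.2.1‖ := by
        apply mul_le_mul_of_nonneg_left _ hA0; nlinarith
      nlinarith

/-- potential near the line at infinity -/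
lemma A_all : ∃ ε > 0, HP Φ (om ι) {z : E3 | ‖z.1‖ < ε * ‖z.2.1‖} := by
  have := R.nonemp
  obtain ⟨V, hV, ε₀, hε₀, h0, hinf⟩ := R.A_infty Φ
  set D := Dz Φ (om ι) h0 with hD
  have hcpt : ∃ ε > 0, ∀ v ∈ Metric.closedBall (0:ℂ) V, ∃ N, IsOpen N ∧ v ∈ N ∧
      HasPot D ({z : E3 | ‖z.1‖ < ε * ‖z.2.1‖} ∩ (fun z : E3 => z.2.2 / z.2.1) ⁻¹' N) := by
    refine (isCompact_closedBall (0:ℂ) V).induction_on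
      (p := fun s => ∃ ε > 0, ∀ v ∈ s, ∃ N, IsOpen N ∧ v ∈ N ∧
        HasPot D ({z : E3 | ‖z.1‖ < ε * ‖z.2.1‖} ∩ (fun z : E3 => z.2.2 / z.2.1) ⁻¹' N)) ?_ ?_ ?_ ?_
    · exact ⟨1, one_pos, fun v hv => absurd hv (by simp)⟩
    · rintro s t hst ⟨ε, hε, h⟩
      exact ⟨ε, hε, fun v hv => h v (hst hv)⟩
    · rintro s t ⟨ε, hε, h⟩ ⟨ε', hε', h'⟩
      refine ⟨min ε ε', lt_min hε hε', fun v hv => ?_⟩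
      have hmono : ∀ (e : ℝ) (_ : min ε ε' ≤ e) (N : Set ℂ),
        HasPot D ({z : E3 | ‖z.1‖ < e * ‖z.2.1‖} ∩ (fun z : E3 => z.2.2 / z.2.1) ⁻¹' N) →
        HasPot D ({z : E3 | ‖z.1‖ < min ε ε' * ‖z.2.1‖} ∩ (fun z : E3 => z.2.2 / z.2.1) ⁻¹' N) := by
        intro e he N hN
        refine hN.mono ?_
        rintro z ⟨_, hz, hz'⟩
        exact ⟨lt_of_lt_of_le hz (mul_le_mul_of_nonneg_right he (norm_nonneg _)), hz'⟩
      rcases hv with hv | hv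
      · obtain ⟨N, o, m, hp⟩ := h v hv
        exact ⟨N, o, m, hmono _ (min_le_left _ _) _ hp⟩
      · obtain ⟨N, o, m, hp⟩ := h' v hv
        exact ⟨N, o, m, hmono _ (min_le_right _ _) _ hp⟩
    · intro π _
      obtain ⟨δ, hδ, _, hp⟩ := R.A_local Φ π
      refine ⟨Metric.ball π δ, mem_nhdsWithin_of_mem_nhds (Metric.ball_mem_nhds _ hδ), δ, hδ,
        fun v hv => ⟨Metric.ball π δ, Metric.isOpen_ball, hv, hp.mono ?_⟩⟩
      rintro z ⟨_, hz, hz'⟩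
      exact ⟨hz, mem_ball_iff_norm.1 hz'⟩
  obtain ⟨ε₁, hε₁, hcpt⟩ := hcpt
  set ε := min ε₀ ε₁ with hε
  have hε0 : 0 < ε := lt_min hε₀ hε₁
  refine ⟨ε, hε0, h0, ?_⟩
  have hW : IsOpen {z : E3 | ‖z.1‖ < ε * ‖z.2.1‖} := isOpen_lt (by fun_prop) (by fun_prop)
  have h21 : ∀ z ∈ {z : E3 | ‖z.1‖ < ε * ‖z.2.1‖}, z.2.1 ≠ 0 := by
    intro z hz h
    simp [h] at hz
    exact absurd hz (not_lt.2 (norm_nonneg _))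
  have := patch (D := D) (p := fun z : E3 => z.2.2 / z.2.1) (I₁ := univ) (I₂ := univ) hW
    (ContinuousOn.div (by fun_prop) (by fun_prop) h21) isOpen_univ isOpen_univ
    ordConnected_univ ordConnected_univ (fun a b c d _ => R.pc_inf hε0) (by
      intro v _ _
      by_cases hv : ‖v‖ ≤ V
      · obtain ⟨N, o, m, hp⟩ := hcpt v (by simpa using hv)
        refine ⟨N, o, m, hp.mono ?_⟩
        rintro z ⟨_, hz, hz'⟩
        exact ⟨lt_of_lt_of_le hz (mul_le_mul_of_nonneg_right (min_le_right _ _) (norm_nonneg _)), hz'⟩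
      · refine ⟨{v | V < ‖v‖}, isOpen_lt continuous_const continuous_norm, not_le.1 hv, hinf.mono ?_⟩
        rintro z ⟨_, hz, hz'⟩
        refine ⟨lt_of_lt_of_le hz (mul_le_mul_of_nonneg_right (min_le_left _ _) (norm_nonneg _)), ?_⟩
        have h3 := norm_pos_iff.2 (h21 z hz)
        simp only [mem_preimage, mem_ofPred_eq, norm_div] at hz'
        rwa [lt_div_iff₀ h3] at hz')
  exact this.mono fun z hz => ⟨hz.2, by simp⟩

end Arr
end MF


open Set Topology

namespace MF

namespace Arr
variable {ι : Type*} [Fintype ι] (R : Arr ι) {A : Type*} [AddCommGroup A]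

/-- cutoff -/
noncomputable def chi (ρ : ℝ) (l : ι) (x y : ℂ) : ℝ := max 0 (1 - ‖y - R.f l x‖ / ρ)

open Classical in
/-- slope of root -/
noncomputable def al (l : ι) : ℂ := if R.C l = 0 then 0 else -R.B l / R.C l

lemma chi_key {ρ : ℝ} (hρ : 0 < ρ) {x y : ℂ} {k : ι}
    (hs : ∀ l l', l ≠ l' → R.C l ≠ 0 → R.C l' ≠ 0 → ρ ≤ ‖R.f l x - R.f l' x‖) (hk : R.C k ≠ 0) :
    ‖(∑ l, (R.chi ρ l x y : ℂ) * R.al l) - R.al k‖ ≤ (∑ l, ‖R.al l‖) * (‖y - R.f k x‖ / ρ) := by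
  classical
  have e : R.al k = ∑ l, if l = k then R.al l else 0 := by simp
  rw [e, ← Finset.sum_sub_distrib, Finset.sum_mul]
  refine (norm_sum_le _ _).trans (Finset.sum_le_sum fun l _ => ?_)
  have ht : 0 ≤ ‖y - R.f k x‖ / ρ := by positivity
  by_cases hlk : l = k
  · subst hlk
    rw [if_pos rfl]
    have : (R.chi ρ l x y : ℂ) * R.al l - R.al l = R.al l * ((R.chi ρ l x y - 1 : ℝ) : ℂ) := by
      push_cast; ring
    rw [this, norm_mul, Complex.norm_real, Real.norm_eq_abs]
    refine mul_le_mul_of_nonneg_left ?_ (norm_nonneg _)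
    rw [abs_le, chi]
    constructor
    · have := le_max_right 0 (1 - ‖y - R.f l x‖ / ρ); linarith
    · have : max 0 (1 - ‖y - R.f l x‖ / ρ) ≤ 1 := max_le zero_le_one (by linarith)
      linarith
  · rw [if_neg hlk, sub_zero, norm_mul, mul_comm]
    by_cases hC : R.C l = 0
    · simp [al, hC]
    refine mul_le_mul_of_nonneg_left ?_ (norm_nonneg _)
    rw [Complex.norm_real, Real.norm_eq_abs, abs_of_nonneg (le_max_left _ _), chi]
    refine max_le ht ?_
    have h1 := hs l k hlk hC hk
    have h2 : ‖R.f l x - R.f k x‖ ≤ ‖y - R.f k x‖ + ‖y - R.f l x‖ := by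
      have : R.f l x - R.f k x = (y - R.f k x) - (y - R.f l x) := by ring
      rw [this]; exact norm_sub_le _ _
    have h3 : 1 ≤ ‖y - R.f k x‖ / ρ + ‖y - R.f l x‖ / ρ := by
      rw [← add_div, le_div_iff₀ hρ]; linarith
    linarith

lemma continuous_f (l : ι) : Continuous (R.f l) := by unfold f; fun_prop

lemma B_nbhd {x0 : ℂ} (hx : x0 ∉ R.Crit) : ∃ ρ > 0, ∃ N : Set ℂ, IsOpen N ∧ x0 ∈ N ∧ ∀ x ∈ N, ∀ x1 ∈ N,
    (∀ l l', l ≠ l' → R.C l ≠ 0 → R.C l' ≠ 0 → ρ ≤ ‖R.f l x - R.f l' x‖) ∧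
    ‖x1 - x‖ * (∑ l, ‖R.al l‖) < ρ ∧ ∀ i, R.C i = 0 → ‖R.B i‖ * ‖x1 - x‖ < ‖R.A i + R.B i * x‖ := by
  obtain ⟨ρ, hρ, hρ0⟩ : ∃ ρ : ℝ, (∀ l l', l ≠ l' → R.C l ≠ 0 → R.C l' ≠ 0 → ρ < ‖R.f l x0 - R.f l' x0‖) ∧ 0 < ρ := by
    have h1 : ∀ᶠ ρ : ℝ in 𝓝[>] 0, ∀ l l', l ≠ l' → R.C l ≠ 0 → R.C l' ≠ 0 → ρ < ‖R.f l x0 - R.f l' x0‖ := by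
      rw [Filter.eventually_all]; intro l
      rw [Filter.eventually_all]; intro l'
      by_cases h : l ≠ l' ∧ R.C l ≠ 0 ∧ R.C l' ≠ 0
      · have : 0 < ‖R.f l x0 - R.f l' x0‖ := by
          rw [norm_pos_iff, sub_ne_zero]
          intro he
          have h1 := R.f_spec h.2.1 x0
          exact R.f_ne hx h.1 h.2.2 (by rw [← he]; exact h1)
        filter_upwards [mem_nhdsWithin_of_mem_nhds (Iio_mem_nhds this)] with ρ hρ _ _ _ using hρ
      · exact Filter.Eventually.of_forall fun ρ h1 h2 h3 => absurd ⟨h1, h2, h3⟩ h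
    exact (h1.and self_mem_nhdsWithin).exists
  refine ⟨ρ, hρ0, ?_⟩
  have hev : ∀ᶠ p : ℂ × ℂ in 𝓝 x0 ×ˢ 𝓝 x0,
    (∀ l l', l ≠ l' → R.C l ≠ 0 → R.C l' ≠ 0 → ρ ≤ ‖R.f l p.1 - R.f l' p.1‖) ∧
    ‖p.2 - p.1‖ * (∑ l, ‖R.al l‖) < ρ ∧ ∀ i, R.C i = 0 → ‖R.B i‖ * ‖p.2 - p.1‖ < ‖R.A i + R.B i * p.1‖ := by
    rw [← nhds_prod_eq]
    refine Filter.Eventually.and ?_ (Filter.Eventually.and ?_ ?_)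
    · rw [Filter.eventually_all]; intro l
      rw [Filter.eventually_all]; intro l'
      by_cases h : l ≠ l' ∧ R.C l ≠ 0 ∧ R.C l' ≠ 0
      · have c1 := R.continuous_f l
        have c2 := R.continuous_f l'
        have : IsOpen {p : ℂ × ℂ | ρ < ‖R.f l p.1 - R.f l' p.1‖} := isOpen_lt (by fun_prop) (by fun_prop)
        filter_upwards [this.mem_nhds (hρ l l' h.1 h.2.1 h.2.2)] with p hp _ _ _ using le_of_lt hp
      · exact Filter.Eventually.of_forall fun ρ h1 h2 h3 => absurd ⟨h1, h2, h3⟩ h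
    · have : IsOpen {p : ℂ × ℂ | ‖p.2 - p.1‖ * (∑ l, ‖R.al l‖) < ρ} := isOpen_lt (by fun_prop) (by fun_prop)
      exact this.mem_nhds (by simpa using hρ0)
    · rw [Filter.eventually_all]; intro i
      by_cases h : R.C i = 0
      · have : IsOpen {p : ℂ × ℂ | ‖R.B i‖ * ‖p.2 - p.1‖ < ‖R.A i + R.B i * p.1‖} :=
          isOpen_lt (by fun_prop) (by fun_prop)
        filter_upwards [this.mem_nhds (by
          simp only [mem_ofPred_eq, sub_self, norm_zero, mul_zero, norm_pos_iff]
          exact fun h0 => hx (Or.inl ⟨i, h, h0⟩))] with p hp _ using hp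
      · exact Filter.Eventually.of_forall fun ρ h1 => absurd h1 h
  obtain ⟨t, ht, h'⟩ := Filter.mem_prod_self_iff.1 hev
  have h := fun x hx y hy => h' (mk_mem_prod (a := x) (b := y) hx hy)
  obtain ⟨N, hN, o, m⟩ := mem_nhds_iff.1 ht
  exact ⟨N, o, m, fun x hx x1 hx1 => h x (hN hx) x1 (hN hx1)⟩

lemma B_deform {x0 : ℂ} (hx : x0 ∉ R.Crit) : ∃ N : Set ℂ, IsOpen N ∧ x0 ∈ N ∧ ∀ x1 ∈ N,
    ∀ D : Coc (Fb R.lf) A, HasPot D {z : E3 | z.1 ≠ 0 ∧ z.2.1 / z.1 = x1} →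
      HasPot D {z : E3 | z.1 ≠ 0 ∧ z.2.1 / z.1 ∈ N} := by
  have := R.nonemp
  obtain ⟨ρ, hρ, N, o, m, h⟩ := R.B_nbhd hx
  refine ⟨N, o, m, fun x1 hx1 D hD => ?_⟩
  refine HasPot.of_nd (S' := {z : E3 | z.1 ≠ 0 ∧ z.2.1 / z.1 = x1})
    (h := fun s z => (z.1, z.2.1 + s * (x1 * z.1 - z.2.1), z.2.2 + s *
      ((∑ l, (R.chi ρ l (z.2.1 / z.1) (z.2.2 / z.1) : ℂ) * R.al l) * (x1 * z.1 - z.2.1)))) ?_ ?_ ?_ ?_ ?_ hD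
  · have c1 : ∀ l, ContinuousOn (fun p : ℝ × E3 => R.chi ρ l (p.2.2.1 / p.2.1) (p.2.2.2 / p.2.1))
        (Icc 0 1 ×ˢ (Fb R.lf ∩ {z : E3 | z.1 ≠ 0 ∧ z.2.1 / z.1 ∈ N})) := by
      intro l
      have hne : ∀ p ∈ (Icc (0:ℝ) 1 ×ˢ (Fb R.lf ∩ {z : E3 | z.1 ≠ 0 ∧ z.2.1 / z.1 ∈ N})), p.2.1 ≠ 0 :=
        fun p hp => hp.2.2.1
      have d1 : ContinuousOn (fun p : ℝ × E3 => p.2.2.1 / p.2.1)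
        (Icc 0 1 ×ˢ (Fb R.lf ∩ {z : E3 | z.1 ≠ 0 ∧ z.2.1 / z.1 ∈ N})) :=
        ContinuousOn.div (by fun_prop) (by fun_prop) hne
      have d2 : ContinuousOn (fun p : ℝ × E3 => p.2.2.2 / p.2.1)
        (Icc 0 1 ×ˢ (Fb R.lf ∩ {z : E3 | z.1 ≠ 0 ∧ z.2.1 / z.1 ∈ N})) :=
        ContinuousOn.div (by fun_prop) (by fun_prop) hne
      have d3 := (R.continuous_f l).comp_continuousOn d1
      unfold chi
      refine continuousOn_const.sup (continuousOn_const.sub ((d2.sub d3).norm.div_const ρ))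
    refine ContinuousOn.prodMk (by fun_prop) (ContinuousOn.prodMk (by fun_prop) ?_)
    refine ContinuousOn.add (by fun_prop) (ContinuousOn.mul (by fun_prop) (ContinuousOn.mul ?_ (by fun_prop)))
    refine continuousOn_finsetSum _ fun l _ => ContinuousOn.mul ?_ continuousOn_const
    exact Complex.continuous_ofReal.comp_continuousOn (c1 l)
  · rintro s hs z ⟨hzF, hz1, hzN⟩ k
    have hM := Fb_sub_Mc hzF
    set x := z.2.1 / z.1 with hxd
    set y := z.2.2 / z.1 with hyd
    have e1 : z.2.1 = x * z.1 := by rw [hxd]; field_simp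
    have e2 : z.2.2 = y * z.1 := by rw [hyd]; field_simp
    obtain ⟨h1, h2, h3⟩ := h x hzN x1 hx1
    set σ := (∑ l, (R.chi ρ l x y : ℂ) * R.al l) with hσ
    have hlf : R.lf k z = z.1 * (R.A k + R.B k * x + R.C k * y) := by
      rw [lf_apply, e1, e2]; ring
    have hd : R.lf k (z.1, z.2.1 + s * (x1 * z.1 - z.2.1), z.2.2 + s * (σ * (x1 * z.1 - z.2.1))) - R.lf k z
        = z.1 * (s * ((x1 - x) * (R.B k + R.C k * σ))) := by
      rw [lf_apply, lf_apply, e1, e2]; ring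
    beta_reduce
    rw [hd, hlf, norm_mul, norm_mul z.1 (_ + _)]
    refine mul_lt_mul_of_pos_left ?_ (norm_pos_iff.2 hz1)
    rw [norm_mul, Complex.norm_real, Real.norm_eq_abs, abs_of_nonneg hs.1]
    refine lt_of_le_of_lt (mul_le_of_le_one_left (norm_nonneg _) hs.2) ?_
    by_cases hC : R.C k = 0
    · rw [hC, zero_mul, zero_mul, add_zero, add_zero, norm_mul, mul_comm]; exact h3 k hC
    · have e3 : R.B k + R.C k * σ = R.C k * (σ - R.al k) := by
        rw [al, if_neg hC]; field_simp; ring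
      have e4 : R.A k + R.B k * x + R.C k * y = R.C k * (y - R.f k x) := by
        linear_combination R.f_spec hC x
      have hy : 0 < ‖y - R.f k x‖ := by
        rw [norm_pos_iff]; intro h0
        apply hM k
        rw [hlf, e4, h0, mul_zero, mul_zero]
      have h5 := R.chi_key hρ h1 (y := y) hC
      rw [← hσ] at h5
      have hC' : 0 < ‖R.C k‖ := norm_pos_iff.2 hC
      rw [e3, e4, norm_mul, norm_mul, norm_mul]
      calc ‖x1 - x‖ * (‖R.C k‖ * ‖σ - R.al k‖)
          ≤ ‖x1 - x‖ * (‖R.C k‖ * ((∑ l, ‖R.al l‖) * (‖y - R.f k x‖ / ρ))) := by gcongr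
        _ = (‖x1 - x‖ * (∑ l, ‖R.al l‖)) * (‖R.C k‖ * ‖y - R.f k x‖ / ρ) := by ring
        _ < ρ * (‖R.C k‖ * ‖y - R.f k x‖ / ρ) := mul_lt_mul_of_pos_right h2 (by positivity)
        _ = ‖R.C k‖ * ‖y - R.f k x‖ := by field_simp
  · intro z _; simp
  · rintro z ⟨_, hz1, _⟩
    refine ⟨hz1, ?_⟩
    simp; field_simp
  · rintro c hc z ⟨hz1, hz2⟩
    refine ⟨by simp [hc, hz1], ?_⟩
    simpa [mul_div_mul_left _ _ hc] using hz2

lemma B_all {D : Coc (Fb R.lf) A} {ε : ℝ} (hε : 0 < ε) (h : HasPot D {z : E3 | ‖z.1‖ < ε * ‖z.2.1‖})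
    {x : ℂ} (hx : x ∉ R.Crit) :
    ∃ N : Set ℂ, IsOpen N ∧ x ∈ N ∧ HasPot D {z : E3 | z.1 ≠ 0 ∧ z.2.1 / z.1 ∈ N} := by
  have hd : ∀ x0 : (R.Critᶜ : Set ℂ), _ := fun x0 => R.B_deform (A := A) x0.2
  choose N0 o0 m0 d0 using hd
  let G : Set (R.Critᶜ : Set ℂ) := {x | ∃ N : Set ℂ, IsOpen N ∧ x.1 ∈ N ∧ HasPot D {z : E3 | z.1 ≠ 0 ∧ z.2.1 / z.1 ∈ N}}
  have step : ∀ x0 : (R.Critᶜ : Set ℂ), ∀ y ∈ N0 x0, (∃ N : Set ℂ, IsOpen N ∧ y ∈ N ∧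
      HasPot D {z : E3 | z.1 ≠ 0 ∧ z.2.1 / z.1 ∈ N}) → HasPot D {z : E3 | z.1 ≠ 0 ∧ z.2.1 / z.1 ∈ N0 x0} := by
    rintro x0 y hy ⟨N, o, m, hN⟩
    refine d0 x0 y hy D (hN.mono ?_)
    rintro z ⟨_, hz1, hz2⟩
    exact ⟨hz1, by rw [hz2]; exact m⟩
  have hG : ∀ x0 ∈ G, ∀ y ∈ N0 x0, ∃ N : Set ℂ, IsOpen N ∧ y ∈ N ∧
      HasPot D {z : E3 | z.1 ≠ 0 ∧ z.2.1 / z.1 ∈ N} :=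
    fun x0 hx0 y hy => ⟨N0 x0, o0 x0, hy, step x0 x0.1 (m0 x0) hx0⟩
  have hpre : IsPreconnected (R.Critᶜ : Set ℂ) :=
    (R.finite_Crit.countable.isPathConnected_compl_of_one_lt_rank (by
      rw [Complex.rank_real_complex]; norm_num)).isConnected.isPreconnected
  obtain ⟨x2, hx2, hx2c⟩ : ∃ x2 : ℂ, 1 / ε < ‖x2‖ ∧ x2 ∉ R.Crit := by
    have hinf : {x : ℂ | 1 / ε < ‖x‖}.Infinite :=
      infinite_of_mem_nhds (((1 / ε + 1 : ℝ)) : ℂ) ((isOpen_lt continuous_const continuous_norm).mem_nhds (by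
        simp only [mem_ofPred_eq]
        rw [Complex.norm_real, Real.norm_eq_abs, abs_of_pos (by positivity)]; linarith))
    exact (hinf.sdiff R.finite_Crit).nonempty
  have hx2G : (⟨x2, hx2c⟩ : (R.Critᶜ : Set ℂ)) ∈ G := by
    refine ⟨{x : ℂ | 1 / ε < ‖x‖}, isOpen_lt continuous_const continuous_norm, hx2, h.mono ?_⟩
    rintro z ⟨_, hz1, hz2⟩
    have h1 := norm_pos_iff.2 hz1
    simp only [mem_ofPred_eq, norm_div] at hz2 ⊢
    rw [div_lt_div_iff₀ hε h1] at hz2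
    linarith
  have := hpre.subset_left_of_subset_union (u := ⋃ x ∈ G, N0 x) (v := ⋃ x ∈ Gᶜ, N0 x)
    (isOpen_biUnion fun x _ => o0 x) (isOpen_biUnion fun x _ => o0 x) (by
      rw [Set.disjoint_left]
      intro y hy hy'
      simp only [mem_iUnion] at hy hy'
      obtain ⟨a, ha, hya⟩ := hy
      obtain ⟨b, hb, hyb⟩ := hy'
      exact hb ⟨N0 b, o0 b, m0 b, step b y hyb (hG a ha y hya)⟩) (by
      intro y hy
      by_cases hyG : (⟨y, hy⟩ : (R.Critᶜ : Set ℂ)) ∈ G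
      · left; simp only [mem_iUnion]; exact ⟨_, hyG, m0 _⟩
      · right; simp only [mem_iUnion]; exact ⟨_, hyG, m0 _⟩)
    ⟨x2, hx2c, by simp only [mem_iUnion]; exact ⟨_, hx2G, m0 _⟩⟩
  have hx' := this hx
  simp only [mem_iUnion] at hx'
  obtain ⟨a, ha, hxa⟩ := hx'
  exact hG a ha x hxa

end Arr
end MF


open Set Topology

namespace MF

section general
variable {X : Type*} [TopologicalSpace X] {A : Type*} [AddCommGroup A] {U : Set X}

lemma cos_pos_a {s : ℝ} (h : s ∈ Icc (0:ℝ) (1/8)) : 0 < Real.cos (2 * Real.pi * s) := by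
  have := Real.pi_pos
  apply Real.cos_pos_of_mem_Ioo; constructor <;> nlinarith [h.1, h.2]

lemma cos_pos_b {s : ℝ} (h : s ∈ Icc (7/8:ℝ) 1) : 0 < Real.cos (2 * Real.pi * s) := by
  have := Real.pi_pos
  have e : Real.cos (2 * Real.pi * s) = Real.cos (2 * Real.pi - 2 * Real.pi * s) := by
    rw [Real.cos_two_pi_sub]
  rw [e]
  apply Real.cos_pos_of_mem_Ioo; constructor <;> nlinarith [h.1, h.2]

lemma sin_cos_mid {s : ℝ} (h : s ∈ Icc (1/8:ℝ) (7/8)) :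
    0 < Real.sin (2 * Real.pi * s) ∨ Real.cos (2 * Real.pi * s) < 0 ∨ Real.sin (2 * Real.pi * s) < 0 := by
  by_contra hc
  push Not at hc
  obtain ⟨h1, h2, h3⟩ := hc
  have h4 : Real.sin (2 * Real.pi * s) = 0 := le_antisymm h1 h3
  have h5 := Real.sin_sq_add_cos_sq (2 * Real.pi * s)
  have h6 : Real.cos (2 * Real.pi * s) = 1 := by rw [h4] at h5; nlinarith
  have := Real.pi_pos
  rw [← Real.cos_sub_two_pi] at h6
  have h7 := (Real.cos_eq_one_iff_of_lt_of_lt (by nlinarith [h.1, h.2]) (by nlinarith [h.1, h.2])).1 h6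
  nlinarith [h.1, h.2]

lemma sin_pos_a : 0 < Real.sin (2 * Real.pi * (1/8)) := by
  have := Real.pi_pos
  apply Real.sin_pos_of_pos_of_lt_pi <;> nlinarith

lemma sin_neg_b : Real.sin (2 * Real.pi * (7/8)) < 0 := by
  have := Real.pi_pos
  rw [← Real.sin_sub_two_pi]
  apply Real.sin_neg_of_neg_of_neg_pi_lt <;> nlinarith

lemma square_glue {D : Coc U A} {W : Set X} (hW : IsOpen W) {p : X → ℂ} (hp : ContinuousOn p W)
    {c0 : ℂ} {r : ℝ} (hno : ∀ z ∈ U ∩ W, p z ≠ c0)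
    (hPC : ∀ a b c d, PC (U ∩ (W ∩ p ⁻¹' rect a b c d)))
    (hloc : ∀ w ∈ rect (c0.re - r) (c0.re + r) (c0.im - r) (c0.im + r), w ≠ c0 →
      ∃ N, IsOpen N ∧ w ∈ N ∧ HasPot D (W ∩ p ⁻¹' N))
    (hloop : ∃ (ρ : ℝ → X) (r' : ℝ), 0 < r' ∧ r' < r ∧ Cv (U ∩ W) ρ ∧
      (∀ s, p (ρ s) = c0 + r' * ea (2 * Real.pi * s)) ∧
      ∀ g, IsPot D (W ∩ p ⁻¹' rect c0.re (c0.re + r) (c0.im - r) (c0.im + r)) g →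
        D.ev ρ = g (ρ 1) - g (ρ 0)) :
    HasPot D (W ∩ p ⁻¹' rect (c0.re - r) (c0.re + r) (c0.im - r) (c0.im + r)) := by
  obtain ⟨ρ, r', hr', hrr, hρ, hpρ, hg⟩ := hloop
  have hr : 0 < r := hr'.trans hrr
  have hopen : ∀ a b c d, IsOpen (W ∩ p ⁻¹' rect a b c d) := fun a b c d =>
    hp.isOpen_inter_preimage hW (isOpen_rect a b c d)
  have hpat : ∀ a b c d, rect a b c d ⊆ rect (c0.re - r) (c0.re + r) (c0.im - r) (c0.im + r) →
      c0 ∉ rect a b c d → HasPot D (W ∩ p ⁻¹' rect a b c d) := by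
    intro a b c d hs hn
    have e : {w : ℂ | w.re ∈ Ioo a b ∧ w.im ∈ Ioo c d} = rect a b c d := by
      ext w; simp only [rect, mem_ofPred_eq, mem_Ioo]; tauto
    have := patch (D := D) hW hp (I₁ := Ioo a b) (I₂ := Ioo c d) isOpen_Ioo isOpen_Ioo ordConnected_Ioo
      ordConnected_Ioo (fun a b c d _ => hPC a b c d) (by
        intro w h1 h2
        have hw : w ∈ rect a b c d := by rw [← e]; exact ⟨h1, h2⟩
        exact hloc w (hs hw) fun h => hn (h ▸ hw))
    rwa [e] at this
  have hU := hpat (c0.re - r) (c0.re + r) c0.im (c0.im + r)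
    (by rintro w ⟨h1, h2, h3, h4⟩; refine ⟨?_, ?_, ?_, ?_⟩ <;> linarith) (by rintro ⟨_, _, h, _⟩; linarith)
  have hL := hpat (c0.re - r) c0.re (c0.im - r) (c0.im + r)
    (by rintro w ⟨h1, h2, h3, h4⟩; refine ⟨?_, ?_, ?_, ?_⟩ <;> linarith) (by rintro ⟨_, h, _, _⟩; linarith)
  have hDn := hpat (c0.re - r) (c0.re + r) (c0.im - r) c0.im
    (by rintro w ⟨h1, h2, h3, h4⟩; refine ⟨?_, ?_, ?_, ?_⟩ <;> linarith) (by rintro ⟨_, _, _, h⟩; linarith)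
  obtain ⟨gR, hR⟩ := hpat c0.re (c0.re + r) (c0.im - r) (c0.im + r)
    (by rintro w ⟨h1, h2, h3, h4⟩; refine ⟨?_, ?_, ?_, ?_⟩ <;> linarith) (by rintro ⟨h, _, _, _⟩; linarith)
  have hUL := HasPot.glue (hopen _ _ _ _) (hopen _ _ _ _) hU hL (by
    have e : U ∩ (W ∩ p ⁻¹' rect (c0.re - r) (c0.re + r) c0.im (c0.im + r)) ∩
      (W ∩ p ⁻¹' rect (c0.re - r) c0.re (c0.im - r) (c0.im + r)) =
      U ∩ (W ∩ p ⁻¹' rect (c0.re - r) c0.re c0.im (c0.im + r)) := by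
      ext z
      simp only [rect, mem_inter_iff, mem_preimage, mem_ofPred_eq]
      constructor
      · rintro ⟨⟨h1, h2, h3, h4, h5, h6⟩, h7, h8, h9, h10, h11⟩
        refine ⟨h1, h2, ?_, ?_, ?_, ?_⟩ <;> linarith
      · rintro ⟨h1, h2, h3, h4, h5, h6⟩
        refine ⟨⟨h1, h2, ?_, ?_, ?_, ?_⟩, h2, ?_, ?_, ?_, ?_⟩ <;> linarith
    rw [e]; exact hPC _ _ _ _)
  have hULD := HasPot.glue ((hopen _ _ _ _).union (hopen _ _ _ _)) (hopen _ _ _ _) hUL hDn (by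
    have e : U ∩ (W ∩ p ⁻¹' rect (c0.re - r) (c0.re + r) c0.im (c0.im + r) ∪
      W ∩ p ⁻¹' rect (c0.re - r) c0.re (c0.im - r) (c0.im + r)) ∩
      (W ∩ p ⁻¹' rect (c0.re - r) (c0.re + r) (c0.im - r) c0.im) =
      U ∩ (W ∩ p ⁻¹' rect (c0.re - r) c0.re (c0.im - r) c0.im) := by
      ext z
      simp only [rect, mem_inter_iff, mem_preimage, mem_ofPred_eq, mem_union]
      constructor
      · rintro ⟨⟨h1, ⟨h2, h3, h4, h5, h6⟩ | ⟨h2, h3, h4, h5, h6⟩⟩, h7, h8, h9, h10, h11⟩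
        · linarith
        · refine ⟨h1, h2, ?_, ?_, ?_, ?_⟩ <;> linarith
      · rintro ⟨h1, h2, h3, h4, h5, h6⟩
        refine ⟨⟨h1, Or.inr ⟨h2, ?_, ?_, ?_, ?_⟩⟩, h2, ?_, ?_, ?_, ?_⟩ <;> linarith
    rw [e]; exact hPC _ _ _ _)
  obtain ⟨gU, hgU⟩ := hULD
  -- the loop
  have hcoord : ∀ s, (p (ρ s)).re = c0.re + r' * Real.cos (2 * Real.pi * s) ∧
      (p (ρ s)).im = c0.im + r' * Real.sin (2 * Real.pi * s) := by
    intro s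
    have h1 : (ea (2 * Real.pi * s)).re = Real.cos (2 * Real.pi * s) := Complex.exp_ofReal_mul_I_re _
    have h2 : (ea (2 * Real.pi * s)).im = Real.sin (2 * Real.pi * s) := Complex.exp_ofReal_mul_I_im _
    rw [hpρ, Complex.add_re, Complex.add_im, Complex.re_ofReal_mul, Complex.im_ofReal_mul, h1, h2]
    exact ⟨rfl, rfl⟩
  have hbd : ∀ s, r' * Real.cos (2 * Real.pi * s) < r ∧ -r < r' * Real.cos (2 * Real.pi * s) ∧
      r' * Real.sin (2 * Real.pi * s) < r ∧ -r < r' * Real.sin (2 * Real.pi * s) := by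
    intro s
    have h1 := Real.cos_le_one (2 * Real.pi * s)
    have h2 := Real.neg_one_le_cos (2 * Real.pi * s)
    have h3 := Real.sin_le_one (2 * Real.pi * s)
    have h4 := Real.neg_one_le_sin (2 * Real.pi * s)
    refine ⟨?_, ?_, ?_, ?_⟩ <;> nlinarith
  have inR : ∀ s, 0 < Real.cos (2 * Real.pi * s) → ρ s ∈ W ∩ p ⁻¹' rect c0.re (c0.re + r) (c0.im - r) (c0.im + r) := by
    intro s hs
    obtain ⟨h1, h2, h3, h4⟩ := hbd s
    have h5 := mul_pos hr' hs
    refine ⟨(hρ.2 s).2, ?_⟩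
    simp only [rect, mem_preimage, mem_ofPred_eq, (hcoord s).1, (hcoord s).2]
    refine ⟨?_, ?_, ?_, ?_⟩ <;> linarith
  have inU : ∀ s, 0 < Real.sin (2 * Real.pi * s) → ρ s ∈ W ∩ p ⁻¹' rect (c0.re - r) (c0.re + r) c0.im (c0.im + r) := by
    intro s hs
    obtain ⟨h1, h2, h3, h4⟩ := hbd s
    have h5 := mul_pos hr' hs
    refine ⟨(hρ.2 s).2, ?_⟩
    simp only [rect, mem_preimage, mem_ofPred_eq, (hcoord s).1, (hcoord s).2]
    refine ⟨?_, ?_, ?_, ?_⟩ <;> linarith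
  have inL : ∀ s, Real.cos (2 * Real.pi * s) < 0 → ρ s ∈ W ∩ p ⁻¹' rect (c0.re - r) c0.re (c0.im - r) (c0.im + r) := by
    intro s hs
    obtain ⟨h1, h2, h3, h4⟩ := hbd s
    have h5 := mul_neg_of_pos_of_neg hr' hs
    refine ⟨(hρ.2 s).2, ?_⟩
    simp only [rect, mem_preimage, mem_ofPred_eq, (hcoord s).1, (hcoord s).2]
    refine ⟨?_, ?_, ?_, ?_⟩ <;> linarith
  have inD : ∀ s, Real.sin (2 * Real.pi * s) < 0 → ρ s ∈ W ∩ p ⁻¹' rect (c0.re - r) (c0.re + r) (c0.im - r) c0.im := by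
    intro s hs
    obtain ⟨h1, h2, h3, h4⟩ := hbd s
    have h5 := mul_neg_of_pos_of_neg hr' hs
    refine ⟨(hρ.2 s).2, ?_⟩
    simp only [rect, mem_preimage, mem_ofPred_eq, (hcoord s).1, (hcoord s).2]
    refine ⟨?_, ?_, ?_, ?_⟩ <;> linarith
  have hρU : Cv U ρ := hρ.mono inter_subset_left
  have key : gU (ρ (1/8)) - gR (ρ (1/8)) = gU (ρ (7/8)) - gR (ρ (7/8)) := by
    have s1 := hR.seg hρU (a := 0) (b := 1/8) (by norm_num) fun t ht => inR t (cos_pos_a ht)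
    have s2 := hgU.seg hρU (a := 1/8) (b := 7/8) (by norm_num) fun t ht => by
      rcases sin_cos_mid ht with h | h | h
      · exact Or.inl (Or.inl (inU t h))
      · exact Or.inl (Or.inr (inL t h))
      · exact Or.inr (inD t h)
    have s3 := hR.seg hρU (a := 7/8) (b := 1) (by norm_num) fun t ht => inR t (cos_pos_b ht)
    have s4 := hg gR hR
    rw [← D.seg_zero_one, ← D.seg_add hρU 0 (1/8) 1, ← D.seg_add hρU (1/8) (7/8) 1, s1, s2, s3] at s4
    have : (gU (ρ (7/8)) - gR (ρ (7/8))) - (gU (ρ (1/8)) - gR (ρ (1/8))) =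
      (gR (ρ (1/8)) - gR (ρ 0) + (gU (ρ (7/8)) - gU (ρ (1/8)) + (gR (ρ 1) - gR (ρ (7/8))))) - (gR (ρ 1) - gR (ρ 0)) := by abel
    rw [s4, sub_self] at this
    exact (sub_eq_zero.1 this).symm
  refine HasPot.mono (S' := _) (glue_const (((hopen _ _ _ _).union (hopen _ _ _ _)).union (hopen _ _ _ _))
    (hopen _ _ _ _) hgU hR ?_) ?_
  · have q1 : ∀ x ∈ U ∩ (W ∩ p ⁻¹' rect c0.re (c0.re + r) c0.im (c0.im + r)),
        gU x - gR x = gU (ρ (1/8)) - gR (ρ (1/8)) := by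
      intro x hx
      refine pot_diff hgU hR ((hPC _ _ _ _ x hx (ρ (1/8)) ?_).mono ?_)
      · have h1 := inR (1/8) (cos_pos_a (by norm_num))
        have h2 := inU (1/8) sin_pos_a
        exact ⟨(hρ.2 _).1, h1.1, h1.2.1, h1.2.2.1, h2.2.2.2.1, h2.2.2.2.2⟩
      · rintro z ⟨h1, h2, h3, h4, h5, h6⟩
        refine ⟨⟨h1, Or.inl (Or.inl ⟨h2, ?_, ?_, ?_, ?_⟩)⟩, h2, ?_, ?_, ?_, ?_⟩ <;> linarith
    have q2 : ∀ x ∈ U ∩ (W ∩ p ⁻¹' rect c0.re (c0.re + r) (c0.im - r) c0.im),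
        gU x - gR x = gU (ρ (7/8)) - gR (ρ (7/8)) := by
      intro x hx
      refine pot_diff hgU hR ((hPC _ _ _ _ x hx (ρ (7/8)) ?_).mono ?_)
      · have h1 := inR (7/8) (cos_pos_b (by norm_num))
        have h2 := inD (7/8) sin_neg_b
        exact ⟨(hρ.2 _).1, h1.1, h1.2.1, h1.2.2.1, h2.2.2.2.1, h2.2.2.2.2⟩
      · rintro z ⟨h1, h2, h3, h4, h5, h6⟩
        refine ⟨⟨h1, Or.inr ⟨h2, ?_, ?_, ?_, ?_⟩⟩, h2, ?_, ?_, ?_, ?_⟩ <;> linarith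
    have q : ∀ x, x ∈ U ∩ (W ∩ p ⁻¹' rect (c0.re - r) (c0.re + r) c0.im (c0.im + r) ∪
      W ∩ p ⁻¹' rect (c0.re - r) c0.re (c0.im - r) (c0.im + r) ∪
      W ∩ p ⁻¹' rect (c0.re - r) (c0.re + r) (c0.im - r) c0.im) ∩
      (W ∩ p ⁻¹' rect c0.re (c0.re + r) (c0.im - r) (c0.im + r)) →
        gU x - gR x = gU (ρ (1/8)) - gR (ρ (1/8)) := by
      rintro x ⟨⟨h1, (⟨_, _, _, h2, h3⟩ | ⟨_, _, h, _, _⟩) | ⟨_, _, _, h2, h3⟩⟩, h4, h5, h6, h7, h8⟩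
      · exact q1 x ⟨h1, h4, h5, h6, h2, h3⟩
      · exact absurd h5 (not_lt.2 h.le)
      · rw [key]; exact q2 x ⟨h1, h4, h5, h6, h2, h3⟩
    intro x hx y hy
    rw [q x hx, q y hy]
  · rintro z ⟨hzU, hzW, h1, h2, h3, h4⟩
    rcases lt_trichotomy (p z).im c0.im with h | h | h
    · exact Or.inl (Or.inr ⟨hzW, h1, h2, h3, h⟩)
    · rcases lt_trichotomy (p z).re c0.re with h' | h' | h'
      · exact Or.inl (Or.inl (Or.inr ⟨hzW, h1, h', h3, h4⟩))
      · exact absurd (Complex.ext h' h) (hno z ⟨hzU, hzW⟩)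
      · exact Or.inr ⟨hzW, h', h2, h3, h4⟩
    · exact Or.inl (Or.inl (Or.inl ⟨hzW, h1, h2, h, h4⟩))

/-- potentials over the plane from local potentials away from finitely many punctures -/
lemma patch_punct {D : Coc U A} {W : Set X} (hW : IsOpen W) {p : X → ℂ} (hp : ContinuousOn p W)
    {K : Set ℂ} (hK : K.Finite) (hno : ∀ z ∈ U ∩ W, p z ∉ K)
    (hPC : ∀ a b c d, PC (U ∩ (W ∩ p ⁻¹' rect a b c d)))
    (hloc : ∀ w ∉ K, ∃ N, IsOpen N ∧ w ∈ N ∧ HasPot D (W ∩ p ⁻¹' N))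
    (hloop : ∀ c0 ∈ K, ∃ r₀ > 0, ∀ r > 0, r < r₀ → ∃ (ρ : ℝ → X) (r' : ℝ), 0 < r' ∧ r' < r ∧ Cv (U ∩ W) ρ ∧
      (∀ s, p (ρ s) = c0 + r' * ea (2 * Real.pi * s)) ∧
      ∀ g, IsPot D (W ∩ p ⁻¹' rect c0.re (c0.re + r) (c0.im - r) (c0.im + r)) g →
        D.ev ρ = g (ρ 1) - g (ρ 0)) : HasPot D W := by
  have := patch (D := D) hW hp (I₁ := univ) (I₂ := univ) isOpen_univ isOpen_univ ordConnected_univ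
    ordConnected_univ (fun a b c d _ => hPC a b c d) (by
      intro w _ _
      by_cases hw : w ∈ K
      · have hf : (K \ {w}).Finite := hK.subset sdiff_subset
        obtain ⟨δ, hδ, hb⟩ := Metric.isOpen_iff.1 hf.isClosed.isOpen_compl w (by simp)
        obtain ⟨r₀, hr₀, hl⟩ := hloop w hw
        obtain ⟨r, hr0, hr1⟩ : ∃ r : ℝ, 0 < r ∧ r < min (δ / 2) r₀ := exists_between (lt_min (by positivity) hr₀)
        have hr2 : r < δ / 2 := hr1.trans_le (min_le_left _ _)
        refine ⟨rect (w.re - r) (w.re + r) (w.im - r) (w.im + r), isOpen_rect _ _ _ _, ?_,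
          square_glue hW hp (fun z hz h => hno z hz (h ▸ hw)) hPC ?_ (hl r hr0 (hr1.trans_le (min_le_right _ _)))⟩
        · refine ⟨?_, ?_, ?_, ?_⟩ <;> linarith
        · rintro v ⟨h1, h2, h3, h4⟩ hv
          refine hloc v fun hvK => hb (a := v) ?_ ⟨hvK, hv⟩
          rw [mem_ball_iff_norm]
          refine (Complex.norm_le_abs_re_add_abs_im _).trans_lt ?_
          have a1 : |(v - w).re| < r := by rw [abs_lt, Complex.sub_re]; constructor <;> linarith
          have a2 : |(v - w).im| < r := by rw [abs_lt, Complex.sub_im]; constructor <;> linarith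
          linarith
      · exact hloc w hw)
  exact this.mono fun z hz => ⟨hz.2, by simp⟩

end general
end MF


open Set Topology

namespace MF

section tel
variable {E : Type*} [NormedAddCommGroup E] [NormedSpace ℂ E] {ι : Type*} [Fintype ι]
  {ℓ : ι → E →L[ℂ] ℂ} {A : Type*} [AddCommGroup A]

lemma telescope [Nonempty ι] (Φ : Coc (Fb ℓ) A) (h0 : om ι ^ (Fintype.card ι) = 1) {S : Set E} (hS : Cone S)
    {g : E → A} (hg : IsPot (Dz Φ (om ι) h0) S g) {c : ℝ → E} (hc : Cv (Fb ℓ ∩ S) c)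
    (h1 : c 1 = om ι • c 0) (e : ℕ) :
    Φ.ev (fun s => om ι ^ e • c s) - Φ.ev c = g (om ι ^ e • c 0) - g (c 0) := by
  induction e with
  | zero => simp
  | succ e ih =>
    have h2 := hg (fun s => om ι ^ e • c s) ⟨hc.1.const_smul _, fun t =>
      ⟨om_smul_Fb e (hc.2 t).1, hS.om_pow e (hc.2 t).2⟩⟩
    rw [Dz_ev, h1] at h2
    have e1 : ∀ z : E, om ι • om ι ^ e • z = om ι ^ (e + 1) • z := fun z => by
      rw [smul_smul, pow_succ']
    have e2 : om ι ^ e • om ι • c 0 = om ι ^ (e + 1) • c 0 := by rw [smul_smul, pow_succ]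
    simp only [e1, e2] at h2
    have : Φ.ev (fun s => om ι ^ (e + 1) • c s) - Φ.ev c =
      (Φ.ev (fun s => om ι ^ (e + 1) • c s) - Φ.ev (fun s => om ι ^ e • c s)) +
      (Φ.ev (fun s => om ι ^ e • c s) - Φ.ev c) := by abel
    rw [this, h2, ih]; abel

end tel

namespace Arr
variable {ι : Type*} [Fintype ι] (R : Arr ι) {A : Type*} [AddCommGroup A]

lemma C_loop (Φ : Coc (Fb R.lf) A) (h0 : om ι ^ (Fintype.card ι) = 1) {c0 : ℂ} :
    ∃ r₀ > 0, ∀ r > 0, r < r₀ → ∃ (ρ : ℝ → E3) (r' : ℝ), 0 < r' ∧ r' < r ∧ Cv (Fb R.lf ∩ R.W1) ρ ∧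
      (∀ s, (ρ s).2.1 / (ρ s).1 = c0 + r' * ea (2 * Real.pi * s)) ∧
      ∀ g, IsPot (Dz Φ (om ι) h0) (R.W1 ∩ (fun z : E3 => z.2.1 / z.1) ⁻¹'
          rect c0.re (c0.re + r) (c0.im - r) (c0.im + r)) g →
        (Dz Φ (om ι) h0).ev ρ = g (ρ 1) - g (ρ 0) := by
  classical
  have := R.nonemp
  have hf : (R.Crit \ {c0}).Finite := R.finite_Crit.subset sdiff_subset
  obtain ⟨r₀, hr₀, hb⟩ := Metric.isOpen_iff.1 hf.isClosed.isOpen_compl c0 (by simp)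
  have hnc : ∀ x : ℂ, 0 < ‖x - c0‖ → ‖x - c0‖ < r₀ → x ∉ R.Crit := by
    intro x h1 h2 hx
    refine hb (a := x) (by rwa [mem_ball_iff_norm]) ⟨hx, ?_⟩
    rw [norm_pos_iff, sub_ne_zero] at h1; simpa using h1
  refine ⟨r₀, hr₀, fun r hr hrr => ?_⟩
  set q : E3 := (1, c0, R.f R.l0 c0) with hq
  set I : Finset ι := Finset.univ.filter fun i => R.lf i q = 0 with hI
  set N : E3 →L[ℂ] E3 := ContinuousLinearMap.id ℂ E3 - rk (cf 1 0 0) q with hN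
  have hNz : ∀ z : E3, N z = z - z.1 • q := by intro z; simp [hN]
  obtain ⟨δ, hδ, hFD⟩ := near_FD (ℓ := R.lf) (N := N) (I := I) (q := q) (by rw [hNz]; simp [hq])
    (by
      intro i hi z
      rw [hI, Finset.mem_filter] at hi
      rw [hNz, map_sub, map_smul, hi.2]; simp)
    (by
      intro i hi
      right
      rw [hI, Finset.mem_filter] at hi
      simpa using hi)
  have hcf := R.continuous_f R.l0
  have hev : ∀ᶠ u : ℝ in 𝓝 (0:ℝ), ‖R.f R.l0 (c0 + u) - R.f R.l0 c0‖ < δ / 2 := by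
    have : IsOpen {u : ℝ | ‖R.f R.l0 (c0 + u) - R.f R.l0 c0‖ < δ / 2} := isOpen_lt (by fun_prop) (by fun_prop)
    exact this.mem_nhds (by simpa using hδ)
  obtain ⟨δ', hδ', hu⟩ := Metric.eventually_nhds_iff.1 hev
  obtain ⟨u, hu0, hu1⟩ : ∃ u : ℝ, 0 < u ∧ u < min (min r δ) δ' := exists_between (by positivity)
  have hur : u < r := hu1.trans_le ((min_le_left _ _).trans (min_le_left _ _))
  have huδ : u < δ := hu1.trans_le ((min_le_left _ _).trans (min_le_right _ _))
  have hu2 := hu (y := u) (by rw [Real.dist_eq, sub_zero, abs_of_pos hu0]; exact hu1.trans_le (min_le_right _ _))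
  have hun : ‖(u : ℂ)‖ = u := by rw [Complex.norm_real, Real.norm_of_nonneg hu0.le]
  set x : ℂ := c0 + u with hx
  have hxc : x ∉ R.Crit := hnc x (by rw [hx, add_sub_cancel_left, hun]; exact hu0) (by rw [hx, add_sub_cancel_left, hun]; linarith)
  obtain ⟨y, hy, hF0, hM0⟩ := R.N0_good hxc (δ := δ / 2) (by positivity)
  obtain ⟨k, hk, hkF⟩ := R.exists_norm hM0
  set P : E3 := k • ((1 : ℂ), x, y) with hP
  have hP1 : P.1 = k := by simp [hP]
  have hP2 : P.2.1 = k * x := by simp [hP]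
  -- points near
  have near : ∀ t : ℝ, P + (ea t - 1) • R.N0 P ∈ Mc R.lf → P + (ea t - 1) • R.N0 P ∈ FD R.lf N I := by
    intro t hM
    have e : P + (ea t - 1) • R.N0 P = k • ((1 : ℂ), x, R.f R.l0 x + ea t * (y - R.f R.l0 x)) := by
      have h1 : R.N0 (1, x, y) = (0, 0, y - R.f R.l0 x) := by
        have := R.f_spec R.hl0 x
        have hl := R.hl0
        rw [N0, rk_apply, lf_apply]
        ext <;> simp
        field_simp
        linear_combination this
      rw [hP, map_smul, h1, smul_comm, ← smul_add]
      congr 1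
      ext <;> simp
      ring
    rw [e] at hM ⊢
    refine FD_cone N I k hk _ (hFD _ ?_ ?_)
    · rw [mem_ball_iff_norm, Prod.norm_def, Prod.norm_def]
      simp only [hq, Prod.fst_sub, Prod.snd_sub, sub_self, norm_zero]
      refine max_lt hδ (max_lt ?_ ?_)
      · rw [hx, add_sub_cancel_left, hun]; exact huδ
      · calc ‖R.f R.l0 x + ea t * (y - R.f R.l0 x) - R.f R.l0 c0‖
            = ‖(R.f R.l0 x - R.f R.l0 c0) + ea t * (y - R.f R.l0 x)‖ := by congr 1; ring
          _ ≤ ‖R.f R.l0 x - R.f R.l0 c0‖ + ‖ea t * (y - R.f R.l0 x)‖ := norm_add_le _ _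
          _ < δ / 2 + δ / 2 := by
            refine add_lt_add hu2 ?_
            rw [norm_mul, ea, Complex.norm_exp_ofReal_mul_I, one_mul]; exact hy
          _ = δ := by ring
    · intro i h; apply hM i; rw [map_smul, h, smul_zero]
  have hPF0 : P ∈ FD R.lf R.N0 {R.l0} := FD_cone _ _ k hk _ hF0
  have hPF : P ∈ FD R.lf N I := by
    have := near 0
    simp only [ea_zero, sub_self, zero_smul, add_zero] at this
    exact this (Fb_sub_Mc hkF)
  -- the loop
  have hflx : ∀ t, (fl R.lf N I t P).1 ≠ 0 ∧ (fl R.lf N I t P).2.1 / (fl R.lf N I t P).1 = c0 + u * ea t := by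
    intro t
    have h1 := R.z1_ne (Fb_sub_Mc (fl_mem ⟨hkF, hPF⟩ t))
    refine ⟨h1, ?_⟩
    rw [div_eq_iff h1]
    simp only [fl, hNz, Prod.smul_fst, Prod.smul_snd, Prod.fst_add, Prod.snd_add, Prod.fst_sub, Prod.snd_sub,
      smul_eq_mul, hP1, hP2, hq, hx]
    ring
  have hcv := (fl_cv (N := N) (I := I) ⟨hkF, hPF⟩).comp (φ := fun s => 2 * Real.pi * s) (by fun_prop)
  refine ⟨fun s => fl R.lf N I (2 * Real.pi * s) P, u, hu0, hur, ⟨hcv.1, fun s => ⟨hcv.2 s, ?_⟩⟩,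
    fun s => (hflx _).2, fun g hg => ?_⟩
  · rw [W1_iff]
    refine ⟨(hflx _).1, ?_⟩
    rw [(hflx _).2]
    have : ‖(u:ℂ) * ea (2 * Real.pi * s)‖ = u := by
      rw [norm_mul, ea, Complex.norm_exp_ofReal_mul_I, mul_one, hun]
    exact hnc _ (by rw [add_sub_cancel_left, this]; exact hu0) (by rw [add_sub_cancel_left, this]; linarith)
  · -- the auxiliary path
    set c : ℝ → E3 := fun s => fl R.lf R.N0 {R.l0} (2 * Real.pi * s) P with hc
    have hccv : Cv (Fb R.lf) c := (fl_cv ⟨hkF, hPF0⟩).comp (φ := fun s => 2 * Real.pi * s) (by fun_prop)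
    have hc0 : c 0 = P := by simp [hc, fl_zero]
    have hc1 : c 1 = om ι • P := by simp [hc, fl_two_pi]
    set S : Set E3 := R.W1 ∩ (fun z : E3 => z.2.1 / z.1) ⁻¹'
          rect c0.re (c0.re + r) (c0.im - r) (c0.im + r) with hS
    have hcone : Cone S := by
      rintro k hk z ⟨hz1, hz2⟩
      refine ⟨R.W1_cone k hk z hz1, ?_⟩
      simp only [mem_preimage] at hz2 ⊢
      simpa [mul_div_mul_left _ _ hk] using hz2
    have hcS : ∀ s, c s ∈ S := by
      intro s
      have h1 := R.z1_ne (Fb_sub_Mc (hccv.2 s))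
      have h2 : (c s).2.1 / (c s).1 = x := by
        rw [div_eq_iff h1]
        have h3 := R.N0_move P (ea (2 * Real.pi * s) - 1)
        simp only [hc, fl, Prod.smul_fst, Prod.smul_snd, h3.1, h3.2, smul_eq_mul, hP1, hP2]
        ring
      refine ⟨R.W1_iff.2 ⟨h1, by rwa [h2]⟩, ?_⟩
      rw [mem_preimage]; beta_reduce; rw [h2, hx]
      simp only [rect, mem_ofPred_eq, Complex.add_re, Complex.add_im, Complex.ofReal_re, Complex.ofReal_im]
      refine ⟨?_, ?_, ?_, ?_⟩ <;> linarith
    have hcFD : ∀ s, c s ∈ FD R.lf N I := by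
      intro s
      have hM := Fb_sub_Mc (hccv.2 s)
      rw [hc] at hM ⊢
      simp only [fl] at hM ⊢
      refine FD_cone N I _ (Complex.exp_ne_zero _) _ (near _ fun i h => hM i ?_)
      rw [map_smul, h, smul_zero]
    have tel := telescope Φ h0 hcone hg (c := c) ⟨hccv.1, fun s => ⟨hccv.2 s, hcS s⟩⟩ (by rw [hc1, hc0]) I.card
    have pot := flow_isPot Φ N I (by rw [← pow_mul, mul_comm, pow_mul, om_pow, one_pow]) c
      ⟨hccv.1, fun s => ⟨hccv.2 s, hcFD s⟩⟩
    rw [Dz_ev, tel] at pot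
    beta_reduce at pot
    rw [hc0, hc1] at pot
    have e1 : ∀ z : E3, z ∈ Fb R.lf ∩ FD R.lf N I → Φ.ev (fun s => fl R.lf N I (2 * Real.pi * cl s) z) =
        Φ.ev (fun s => fl R.lf N I (2 * Real.pi * s) z) := fun z hz =>
      Φ.ev_cl (c := fun s => fl R.lf N I (2 * Real.pi * s) z)
        ((fl_cv hz).comp (φ := fun s => 2 * Real.pi * s) (by fun_prop))
    have hoP : om ι • P ∈ Fb R.lf ∩ FD R.lf N I :=
      ⟨smul_mem_Fb h0 hkF, FD_cone N I _ om_ne _ hPF⟩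
    rw [e1 _ hoP, e1 _ ⟨hkF, hPF⟩] at pot
    rw [Dz_ev]
    simp only [fl_smul om_ne] at pot
    rw [← pot]
    simp [fl_two_pi, fl_zero]

/-- the first round: the monodromy acts trivially up to a potential -/
theorem round1 (Φ : Coc (Fb R.lf) A) : HP Φ (om ι) univ := by
  have := R.nonemp
  have := R.finite_Crit.to_subtype
  obtain ⟨ε, hε, h0, hinf⟩ := R.A_all Φ
  refine ⟨h0, ?_⟩
  have hW := patch_punct (D := Dz Φ (om ι) h0) R.isOpen_W1 R.cont_x R.finite_Crit
    (fun z hz => (R.W1_iff.1 hz.2).2) (fun a b c d => R.pc_fin) (by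
      intro w hw
      obtain ⟨N, o, m, h⟩ := R.B_all hε hinf hw
      exact ⟨N, o, m, h.mono fun z hz => ⟨hz.2.1.1, hz.2.2⟩⟩) (fun c0 _ => R.C_loop Φ h0)
  obtain ⟨x, hx⟩ : ∃ x : ℂ, x ∉ R.Crit := by
    have := (infinite_univ (α := ℂ)).sdiff R.finite_Crit
    obtain ⟨x, _, hx⟩ := this.nonempty
    exact ⟨x, hx⟩
  refine HasPot.extend_Fb (κ := R.Crit) (fun c => cf (-c.1) 1 0) ⟨(1, x, 0), fun c h => hx ?_⟩ (hW.mono ?_)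
  · simp at h
    rw [show x = c.1 by linear_combination h]; exact c.2
  · rintro z ⟨hz, hz'⟩
    refine ⟨R.z1_ne (Fb_sub_Mc hz), fun c hc h => hz' ⟨c, hc⟩ ?_⟩
    simp; linear_combination h

end Arr
end MF


open Set Topology

namespace MF

set_option linter.unusedSectionVars false

/-! ### integer winding cocycles -/

lemma wn_ex {γ : ℝ → ℂ} (hc : Continuous γ) (h0 : ∀ t, γ t ≠ 0) : ∃ k : ℤ, ∃ L : ℝ → ℂ, Continuous L ∧
    (∀ t, Complex.exp (L t) = γ t) ∧
    L 1 - L 0 = Complex.log (γ 1) - Complex.log (γ 0) + k * (2 * Real.pi * Complex.I) := by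
  obtain ⟨L, hL, he⟩ := exists_log hc h0
  have : Complex.exp (L 1 - L 0 - (Complex.log (γ 1) - Complex.log (γ 0))) = 1 := by
    rw [Complex.exp_sub, Complex.exp_sub, Complex.exp_sub, he, he, Complex.exp_log (h0 _), Complex.exp_log (h0 _)]
    exact div_self (div_ne_zero (h0 _) (h0 _))
  obtain ⟨k, hk⟩ := Complex.exp_eq_one_iff.1 this
  exact ⟨k, L, hL, he, by linear_combination hk⟩

open Classical in
/-- integer winding defect of a curve of nonzero complex numbers -/
noncomputable def wn (γ : ℝ → ℂ) : ℤ :=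
  if h : ∃ k : ℤ, ∃ L : ℝ → ℂ, Continuous L ∧ (∀ t, Complex.exp (L t) = γ t) ∧
    L 1 - L 0 = Complex.log (γ 1) - Complex.log (γ 0) + k * (2 * Real.pi * Complex.I) then h.choose else 0

lemma wn_spec {γ : ℝ → ℂ} {L : ℝ → ℂ} (hL : Continuous L) (he : ∀ t, Complex.exp (L t) = γ t) :
    L 1 - L 0 = Complex.log (γ 1) - Complex.log (γ 0) + wn γ * (2 * Real.pi * Complex.I) := by
  have hγ : γ = fun t => Complex.exp (L t) := by ext t; rw [he]
  have h := wn_ex (γ := γ) (by rw [hγ]; fun_prop) (fun t => by rw [← he]; exact Complex.exp_ne_zero _)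
  rw [wn, dif_pos h]
  obtain ⟨L', hL', he', h'⟩ := h.choose_spec
  rw [← h']
  have := log_unique hL hL' (fun t => by rw [he, he']) 1 0
  linear_combination this

lemma wn_eq {γ : ℝ → ℂ} {L : ℝ → ℂ} (hL : Continuous L) (he : ∀ t, Complex.exp (L t) = γ t) {k : ℤ}
    (h : L 1 - L 0 = Complex.log (γ 1) - Complex.log (γ 0) + k * (2 * Real.pi * Complex.I)) : wn γ = k := by
  have h' := wn_spec hL he
  rw [h] at h'
  have := mul_right_cancel₀ Complex.two_pi_I_ne_zero (add_left_cancel h')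
  exact_mod_cast this.symm

/-- winding cocycle -/
noncomputable def wC : Coc {w : ℂ | w ≠ 0} ℤ where
  ev := wn
  ax F hF h0 := by
    obtain ⟨L, hL, he⟩ := exists_log hF h0
    have : ∀ p, ∃ k : ℤ, L p = Complex.log (F p) + k * (2 * Real.pi * Complex.I) := by
      intro p
      have : Complex.exp (L p - Complex.log (F p)) = 1 := by
        rw [Complex.exp_sub, he, Complex.exp_log (h0 _), div_self (h0 _)]
      obtain ⟨k, hk⟩ := Complex.exp_eq_one_iff.1 this
      exact ⟨k, by linear_combination hk⟩
    choose g hg using this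
    refine ⟨g, fun γ hγ => wn_eq (L := fun t => L (γ t)) (hL.comp hγ) (fun t => he _) ?_⟩
    rw [hg (γ 1), hg (γ 0)]; push_cast; ring

variable {E : Type*} [NormedAddCommGroup E] [NormedSpace ℂ E] {ι : Type*} [Fintype ι]
  {A : Type*} [AddCommGroup A] {ℓ : ι → E →L[ℂ] ℂ}

/-- winding around the i-th hyperplane -/
noncomputable def wl (ℓ : ι → E →L[ℂ] ℂ) (i : ι) : Coc (Mc ℓ) ℤ :=
  wC.pull (ℓ i) (by fun_prop) fun _ hz => hz i

lemma wl_ev (i : ι) (γ : ℝ → E) : (wl ℓ i).ev γ = wn (fun t => ℓ i (γ t)) := rfl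

/-! ### meridians -/

/-- meridian data -/
def Cf (ℓ : ι → E →L[ℂ] ℂ) (i : ι) (p d : E) : Prop :=
  ℓ i p = 0 ∧ ℓ i d ≠ 0 ∧ ∀ l, l ≠ i → ‖ℓ l d‖ < ‖ℓ l p‖

/-- meridian loop -/
noncomputable def mer (p d : E) (s : ℝ) : E := p + ea (2 * Real.pi * s) • d

lemma norm_ea (t : ℝ) : ‖ea t‖ = 1 := Complex.norm_exp_ofReal_mul_I t

lemma ea_ne (t : ℝ) : ea t ≠ 0 := Complex.exp_ne_zero _

lemma Cf.mem {i : ι} {p d : E} (h : Cf ℓ i p d) (s : ℝ) : mer p d s ∈ Mc ℓ := by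
  intro l
  simp only [mer, map_add, map_smul, smul_eq_mul]
  by_cases hl : l = i
  · subst hl
    rw [h.1, zero_add]; exact mul_ne_zero (ea_ne _) h.2.1
  · intro h0
    have := h.2.2 l hl
    have e : ℓ l p = -(ea (2 * Real.pi * s) * ℓ l d) := by linear_combination h0
    rw [e, norm_neg, norm_mul, norm_ea, one_mul] at this
    exact lt_irrefl _ this


lemma mer_cont (p d : E) : Continuous (mer p d) := by unfold mer; fun_prop

lemma mer_one (p d : E) : mer p d 1 = mer p d 0 := by
  simp [mer, ea_zero, ea_two_pi]

lemma Cf.wl {i : ι} {p d : E} (h : Cf ℓ i p d) [DecidableEq ι] (l : ι) :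
    (wl ℓ l).ev (mer p d) = if l = i then 1 else 0 := by
  rw [wl_ev]
  split_ifs with hl
  · subst hl
    refine wn_eq (L := fun s => Complex.log (ℓ l d) + (2 * Real.pi * Complex.I) * s) (by fun_prop) ?_ ?_
    · intro t
      simp only [mer, map_add, map_smul, smul_eq_mul, h.1, zero_add]
      rw [Complex.exp_add, Complex.exp_log h.2.1, mul_comm, ea]
      congr 2; push_cast; ring
    · rw [mer_one]; simp
  · have hp : ℓ l p ≠ 0 := by
      have := h.2.2 l hl
      intro h0; rw [h0, norm_zero] at this; exact absurd this (not_lt.2 (norm_nonneg _))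
    have hsl : ∀ t, 1 + ea (2 * Real.pi * t) * (ℓ l d / ℓ l p) ∈ Complex.slitPlane := by
      intro t
      have := mem_slit_of_close (a := ℓ l p) (b := ℓ l p + ea (2 * Real.pi * t) * ℓ l d) (by
        rw [add_sub_cancel_left, norm_mul, norm_ea, one_mul]; exact h.2.2 l hl)
      convert this using 1
      field_simp
    refine wn_eq (L := fun s => Complex.log (ℓ l p) + Complex.log (1 + ea (2 * Real.pi * s) * (ℓ l d / ℓ l p))) ?_ ?_ ?_
    · apply continuous_const.add
      apply Continuous.clog (by fun_prop) hsl
    · intro t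
      simp only [mer, map_add, map_smul, smul_eq_mul]
      rw [Complex.exp_add, Complex.exp_log hp, Complex.exp_log (Complex.slitPlane_ne_zero (hsl t))]
      field_simp
    · rw [mer_one]; simp [ea_zero, ea_two_pi]

lemma mer_path (Ψ : Coc (Mc ℓ) A) {i : ι} {P D : ℝ → E} (hP : Continuous P) (hD : Continuous D)
    (h : ∀ t, Cf ℓ i (P t) (D t)) : Ψ.ev (mer (P 0) (D 0)) = Ψ.ev (mer (P 1) (D 1)) := by
  have := Ψ.sq (H := fun s t => mer (P t) (D t) s) (by unfold mer; fun_prop) (fun s t => (h t).mem s)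
  simp only [mer_one] at this
  rw [add_comm] at this
  exact add_left_cancel this

lemma mer_shrink (Ψ : Coc (Mc ℓ) A) {i : ι} {p d : E} (h : Cf ℓ i p d) {ε : ℝ} (h0 : 0 < ε) (h1 : ε ≤ 1) :
    Ψ.ev (mer p d) = Ψ.ev (mer p ((ε : ℂ) • d)) := by
  have := mer_path Ψ (i := i) (P := fun _ => p) (D := fun t => ((1 + cl t * (ε - 1) : ℝ) : ℂ) • d)
    (by fun_prop) (by fun_prop) (fun t => by
      have ht := cl_mem t
      have hpos : 0 < 1 + cl t * (ε - 1) := by nlinarith [ht.1, ht.2]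
      have hle : 1 + cl t * (ε - 1) ≤ 1 := by nlinarith [ht.1, ht.2]
      refine ⟨h.1, ?_, fun l hl => ?_⟩
      · rw [map_smul, smul_eq_mul]; exact mul_ne_zero (by exact_mod_cast hpos.ne') h.2.1
      · rw [map_smul, smul_eq_mul, norm_mul, Complex.norm_real, Real.norm_of_nonneg hpos.le]
        refine lt_of_le_of_lt ?_ (h.2.2 l hl)
        exact mul_le_of_le_one_left (norm_nonneg _) hle)
  simpa using this

lemma mer_const (Ψ : Coc (Mc ℓ) A) {i : ι} {p d p' d' : E} (h : Cf ℓ i p d) (h' : Cf ℓ i p' d') :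
    Ψ.ev (mer p d) = Ψ.ev (mer p' d') := by
  have hpos : ∀ {p d}, Cf ℓ i p d → ∀ l, l ≠ i → ℓ l p ≠ 0 := by
    intro p d h l hl h0
    have := h.2.2 l hl
    rw [h0, norm_zero] at this; exact absurd this (not_lt.2 (norm_nonneg _))
  -- path of d
  obtain ⟨D, hD, D0, D1⟩ := joined_curve (pc_convex_minus (K := (univ : Set E)) isOpen_univ (by simp)
    (fun _ : Unit => fun z => ℓ i z) (by simp) d ⟨mem_univ _, fun _ => h.2.1⟩ d' ⟨mem_univ _, fun _ => h'.2.1⟩)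
  -- path of p
  obtain ⟨P, hP, P0, P1⟩ := joined_curve (pc_convex_minus (E := LinearMap.ker (ℓ i).toLinearMap) (K := univ)
    isOpen_univ (by simp) (fun l : {l // l ≠ i} => fun z => ℓ l z) (by simp) ⟨p, h.1⟩
    ⟨mem_univ _, fun l => hpos h l l.2⟩ ⟨p', h'.1⟩ ⟨mem_univ _, fun l => hpos h' l l.2⟩)
  have hPc := hP.1
  have hDc := hD.1
  have ev : ∀ᶠ ε : ℝ in 𝓝 (0:ℝ), ∀ t ∈ Icc (0:ℝ) 1, ∀ l : {l // l ≠ i}, ‖ℓ l ((ε : ℂ) • D t)‖ < ‖ℓ l (P t)‖ := by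
    apply isCompact_Icc.eventually_forall_of_forall_eventually
    intro t ht
    rw [Filter.eventually_all]
    intro l
    have : IsOpen {q : ℝ × ℝ | ‖ℓ l ((q.1 : ℂ) • D q.2)‖ < ‖ℓ l (P q.2)‖} :=
      isOpen_lt (by fun_prop) (by fun_prop)
    refine this.mem_nhds ?_
    simpa using (hP.2 t).2 l
  obtain ⟨δ, hδ, hb⟩ := Metric.eventually_nhds_iff.1 ev
  obtain ⟨ε, hε0, hε1⟩ : ∃ ε : ℝ, 0 < ε ∧ ε < min δ 1 := exists_between (by positivity)
  have hε := hb (y := ε) (by rw [Real.dist_eq, sub_zero, abs_of_pos hε0]; exact hε1.trans_le (min_le_left _ _))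
  have hle : ε ≤ 1 := (hε1.trans_le (min_le_right _ _)).le
  rw [mer_shrink Ψ h hε0 hle, mer_shrink Ψ h' hε0 hle]
  have := mer_path Ψ (i := i) (P := fun t => (P (cl t) : E)) (D := fun t => (ε : ℂ) • D (cl t)) (by fun_prop)
    (by fun_prop) (fun t => ⟨(P (cl t)).2, by
      rw [map_smul, smul_eq_mul]
      exact mul_ne_zero (by exact_mod_cast hε0.ne') ((hD.2 _).2 ()), fun l hl => hε _ (cl_mem t) ⟨l, hl⟩⟩)
  simpa [P0, P1, D0, D1] using this

end MF


open Set Topology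

namespace MF

set_option linter.unusedSectionVars false

variable {E : Type*} [NormedAddCommGroup E] [NormedSpace ℂ E] {ι : Type*} [Fintype ι]
  {A : Type*} [AddCommGroup A] {ℓ : ι → E →L[ℂ] ℂ}

lemma isOpen_Mc : IsOpen (Mc ℓ) := by
  have : Mc ℓ = ⋂ i, {z | ℓ i z ≠ 0} := by ext z; simp [Mc]
  rw [this]
  exact isOpen_iInter_of_finite fun i => isOpen_ne_fun (by fun_prop) continuous_const

lemma HasPot.local_open {U : Set E} (hU : IsOpen U) (D : Coc U A) {P : E} (hP : P ∈ U) :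
    ∃ O, IsOpen O ∧ P ∈ O ∧ HasPot D O := by
  obtain ⟨r, hr, hb⟩ := Metric.isOpen_iff.1 hU P hP
  have hPb := Metric.mem_ball_self (x := P) hr
  refine ⟨Metric.ball P r, Metric.isOpen_ball, hPb,
    HasPot.of_contract (k := fun s z => z + (s : ℂ) • (P - z)) (P := P) ?_ ?_ ?_ ?_⟩
  · have h2 : Continuous fun p : ℝ × E => p.2 + (p.1 : ℂ) • (P - p.2) := by fun_prop
    exact h2.continuousOn
  · intro s hs z hz; exact hb (ball_line hz.2 hPb hs)
  · intro z hz; simp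
  · intro z hz; simp

lemma HasPot.extend_open {U : Set E} (hU : IsOpen U) {D : Coc U A} {κ : Type*} [Finite κ] (φ : κ → E →L[ℂ] ℂ)
    (hne : ∃ d, ∀ k, φ k d ≠ 0) (h : HasPot D {z | ∀ k, φ k z ≠ 0}) : HasPot D univ := by
  apply HasPot.extend h (fun P hP => HasPot.local_open hU D hP)
  · intro P hP O hO hPO
    obtain ⟨r, hr, hm⟩ := Metric.isOpen_iff.1 (hU.inter hO) P ⟨hP, hPO⟩
    refine ⟨Metric.ball P r, Metric.isOpen_ball, Metric.mem_ball_self hr, fun x hx y hy => ?_⟩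
    refine (pc_convex_minus (K := Metric.ball P r) Metric.isOpen_ball
      (fun x hx y hy t ht => ball_line hx hy ht) (fun k z => φ k z)
      (fun k x y τ => by simp) x ⟨hx.1.2, hx.2⟩ y ⟨hy.1.2, hy.2⟩).mono ?_
    rintro z ⟨h1, h2⟩
    exact ⟨hm h1, h2⟩
  · intro P hP O hO hPO
    obtain ⟨r, hr, hm⟩ := Metric.isOpen_iff.1 (hU.inter hO) P ⟨hP, hPO⟩
    obtain ⟨d, hd⟩ := hne
    have hcon : Continuous fun t : ℝ => P + (t : ℂ) • d := by fun_prop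
    obtain ⟨ε, hε, hb⟩ := Metric.isOpen_iff.1 ((Metric.isOpen_ball (x := P) (ε := r)).preimage hcon) 0
      (by simpa using hr)
    let bad : κ → ℝ := fun k => (-(φ k P) / φ k d).re
    obtain ⟨t, ht, hbad⟩ : ∃ t ∈ Ioo (0:ℝ) ε, t ∉ range bad :=
      ((Ioo_infinite hε).sdiff (finite_range bad)).nonempty
    have hball : ∀ s ∈ Icc (0:ℝ) 1, P + ((s * t : ℝ) : ℂ) • d ∈ Metric.ball P r := by
      intro s hs
      apply hb
      rw [Metric.mem_ball, Real.dist_eq, sub_zero, abs_of_nonneg (mul_nonneg hs.1 ht.1.le)]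
      nlinarith [ht.1, ht.2, hs.1, hs.2]
    refine ⟨P + (t : ℂ) • d, fun k hk => ?_,
      joined_of_curve (fun s => P + ((s * t : ℝ) : ℂ) • d) (by fun_prop) (by simp) (by simp)
        fun s hs => hm (hball s hs)⟩
    apply hbad
    refine ⟨k, ?_⟩
    simp only [bad]
    have : -(φ k P) / φ k d = t := by
      rw [div_eq_iff (hd k)]
      simp at hk; linear_combination -hk
    rw [this]; simp

/-- parameters on the line through `b` and `z` avoiding the arrangement -/
def Lz (ℓ : ι → E →L[ℂ] ℂ) (b z : E) : Set ℂ := {τ | b + τ • (z - b) ∈ Mc ℓ}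

lemma continuous_lz (b z : E) : Continuous fun τ : ℂ => b + τ • (z - b) := by fun_prop

lemma finite_Lz {b z : E} (hb : b ∈ Mc ℓ) : (Lz ℓ b z)ᶜ.Finite := by
  refine (finite_range fun i => -(ℓ i b) / ℓ i (z - b)).subset fun τ hτ => ?_
  simp only [Lz, Mc, mem_compl_iff, mem_ofPred_eq, not_forall, not_not] at hτ
  obtain ⟨i, hi⟩ := hτ
  refine ⟨i, ?_⟩
  rw [map_add, map_smul, smul_eq_mul] at hi
  have hne : ℓ i (z - b) ≠ 0 := by
    intro h0
    rw [h0, mul_zero, add_zero] at hi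
    exact hb i hi
  beta_reduce
  rw [div_eq_iff hne]; linear_combination -hi

lemma line_pot (Ψ : Coc (Mc ℓ) A) (hΨ : ∀ i p d, Cf ℓ i p d → Ψ.ev (mer p d) = 0) {b z : E}
    (hb : b ∈ Mc ℓ)
    (hz : ∀ i i' : ι, i ≠ i' → ∀ τ : ℂ, ℓ i (b + τ • (z - b)) = 0 → ℓ i' (b + τ • (z - b)) ≠ 0) :
    HasPot (Ψ.pull (V := Lz ℓ b z) (fun τ : ℂ => b + τ • (z - b)) (continuous_lz b z).continuousOn
      fun _ h => h) univ := by
  have oL : IsOpen (Lz ℓ b z) := isOpen_Mc.preimage (continuous_lz b z)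
  refine patch_punct isOpen_univ (p := fun τ : ℂ => τ) continuousOn_id (finite_Lz (ℓ := ℓ) (z := z) hb)
    (fun τ hτ h => h hτ.1) ?_ ?_ ?_
  · intro x y u v
    have := pc_convex_minus (K := rect x y u v) (isOpen_rect x y u v) (by
      intro p hp q hq t ht
      obtain ⟨p1, p2, p3, p4⟩ := hp
      obtain ⟨q1, q2, q3, q4⟩ := hq
      have hre : (p + (t : ℂ) • (q - p)).re = p.re + t * (q.re - p.re) := by simp
      have him : (p + (t : ℂ) • (q - p)).im = p.im + t * (q.im - p.im) := by simp
      have key : ∀ {a b c : ℝ}, a < b → a < c → a < b + t * (c - b) := by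
        intro a b c h1 h2
        rcases eq_or_lt_of_le ht.2 with h | h
        · rw [h]; linarith
        · nlinarith [ht.1, ht.2]
      have key' : ∀ {a b c : ℝ}, b < a → c < a → b + t * (c - b) < a := by
        intro a b c h1 h2
        rcases eq_or_lt_of_le ht.2 with h | h
        · rw [h]; linarith
        · nlinarith [ht.1, ht.2]
      refine ⟨?_, ?_, ?_, ?_⟩
      · rw [hre]; exact key p1 q1
      · rw [hre]; exact key' p2 q2
      · rw [him]; exact key p3 q3
      · rw [him]; exact key' p4 q4) (fun i (τ : ℂ) => ℓ i (b + τ • (z - b))) (by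
        intro i x y τ; simp; ring)
    intro p hp q hq
    refine (this p ⟨hp.2.2, hp.1⟩ q ⟨hq.2.2, hq.1⟩).mono ?_
    rintro τ ⟨h1, h2⟩
    exact ⟨h2, mem_univ _, h1⟩
  · intro w hw
    rw [mem_compl_iff, not_not] at hw
    obtain ⟨O, h1, h2, h3⟩ := HasPot.local_open oL (Ψ.pull (V := Lz ℓ b z) (fun τ : ℂ => b + τ • (z - b))
      (continuous_lz b z).continuousOn fun _ h => h) hw
    exact ⟨O, h1, h2, h3.mono fun x hx => hx.2.2⟩
  · intro c0 hc0
    simp only [Lz, Mc, mem_compl_iff, mem_ofPred_eq, not_forall, not_not] at hc0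
    obtain ⟨i, hi⟩ := hc0
    have hne : ℓ i (z - b) ≠ 0 := by
      intro h0
      rw [map_add, map_smul, h0, smul_zero, add_zero] at hi
      exact hb i hi
    have ev : ∀ᶠ ε : ℝ in 𝓝 (0:ℝ), ∀ l : {l // l ≠ i}, ‖ℓ l ((ε : ℂ) • (z - b))‖ < ‖ℓ l (b + c0 • (z - b))‖ := by
      rw [Filter.eventually_all]
      intro l
      have : IsOpen {ε : ℝ | ‖ℓ l ((ε : ℂ) • (z - b))‖ < ‖ℓ l (b + c0 • (z - b))‖} :=
        isOpen_lt (by fun_prop) (by fun_prop)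
      refine this.mem_nhds ?_
      simpa using hz i l (Ne.symm l.2) c0 hi
    obtain ⟨δ, hδ, hb'⟩ := Metric.eventually_nhds_iff.1 ev
    refine ⟨δ, hδ, fun r hr hrδ => ?_⟩
    have hr2 : 0 < r / 2 := by positivity
    have hcf : Cf ℓ i (b + c0 • (z - b)) (((r / 2 : ℝ) : ℂ) • (z - b)) := by
      refine ⟨hi, ?_, fun l hl => hb' (y := r / 2) ?_ ⟨l, hl⟩⟩
      · rw [map_smul, smul_eq_mul]; exact mul_ne_zero (by exact_mod_cast hr2.ne') hne
      · rw [Real.dist_eq, sub_zero, abs_of_pos hr2]; linarith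
    have e : ∀ s, b + (c0 + ((r / 2 : ℝ) : ℂ) * ea (2 * Real.pi * s)) • (z - b) =
        mer (b + c0 • (z - b)) (((r / 2 : ℝ) : ℂ) • (z - b)) s := by
      intro s; rw [mer]; module
    refine ⟨fun s => c0 + ((r / 2 : ℝ) : ℂ) * ea (2 * Real.pi * s), r / 2, hr2, by linarith,
      ⟨by fun_prop, fun s => ⟨?_, mem_univ _⟩⟩, fun s => rfl, fun g _ => ?_⟩
    · change _ ∈ Mc ℓ
      rw [e]; exact hcf.mem s
    · have h1 := hΨ _ _ _ hcf
      change Ψ.ev (fun s => b + (c0 + ((r / 2 : ℝ) : ℂ) * ea (2 * Real.pi * s)) • (z - b)) = _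
      simp_rw [e]
      rw [show (fun s => mer (b + c0 • (z - b)) (((r / 2 : ℝ) : ℂ) • (z - b)) s) = mer (b + c0 • (z - b)) (((r / 2 : ℝ) : ℂ) • (z - b)) from rfl, h1]
      simp [ea_zero, ea_two_pi]

/-- vanishing on meridians implies exactness -/
lemma Mc_pot (hnp : ∀ i i' : ι, i ≠ i' → ∀ c : ℂ, ℓ i ≠ c • ℓ i') {b : E} (hb : b ∈ Mc ℓ)
    (Ψ : Coc (Mc ℓ) A) (hΨ : ∀ i p d, Cf ℓ i p d → Ψ.ev (mer p d) = 0) : HasPot Ψ univ := by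
  let φ : {q : ι × ι // q.1 ≠ q.2} → E →L[ℂ] ℂ := fun q => (ℓ q.1.1 b) • ℓ q.1.2 - (ℓ q.1.2 b) • ℓ q.1.1
  refine HasPot.extend_open isOpen_Mc φ ?_ ?_
  · refine Module.Dual.exists_forall_ne_zero_of_forall_exists (fun q => (φ q).toLinearMap) fun q => ?_
    by_contra! h
    have h0 : φ q = 0 := by ext x; exact h x
    have := sub_eq_zero.1 h0
    apply hnp q.1.2 q.1.1 (Ne.symm q.2) ((ℓ q.1.1 b)⁻¹ * ℓ q.1.2 b)
    rw [mul_smul, ← this, smul_smul, inv_mul_cancel₀ (hb _), one_smul]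
  · set S : Set E := {z | ∀ k, φ k z ≠ 0} with hS
    have hl : ∀ z ∈ S, HasPot (Ψ.pull (V := Lz ℓ b z) (fun τ : ℂ => b + τ • (z - b)) (continuous_lz b z).continuousOn
        fun _ h => h) univ := by
      intro z hz
      refine line_pot Ψ hΨ hb fun i i' hii τ h1 h2 => hz ⟨(i, i'), hii⟩ ?_
      simp only [map_add, map_smul, map_sub, smul_eq_mul] at h1 h2
      have hτ : τ ≠ 0 := by
        rintro rfl
        simp at h1; exact hb i h1
      have : τ * φ ⟨(i, i'), hii⟩ z = 0 := by
        simp only [φ, sub_apply, smul_apply, smul_eq_mul]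
        linear_combination (ℓ i b) * h2 - (ℓ i' b) * h1
      exact (mul_eq_zero.1 this).resolve_left hτ
    have hσ : ∀ z ∈ Mc ℓ, ∃ σ : ℝ → ℂ, Cv (Lz ℓ b z) σ ∧ σ 0 = 0 ∧ σ 1 = 1 := by
      intro z hz
      have := pc_convex_minus (E := ℂ) (K := univ) isOpen_univ (by simp) (fun i (τ : ℂ) => ℓ i (b + τ • (z - b))) (by
        intro i x y τ; simp; ring) 0 ⟨mem_univ _, fun i => by simpa using hb i⟩ 1 ⟨mem_univ _, fun i => by simpa using hz i⟩
      obtain ⟨σ, h1, h2, h3⟩ := joined_curve this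
      exact ⟨σ, h1.mono fun τ hτ => hτ.2, h2, h3⟩
    choose! σ hσc hσ0 hσ1 using hσ
    refine ⟨fun z => Ψ.ev (fun s => b + σ z s • (z - b)), pot_of_local _ ?_⟩
    rintro z ⟨hz, hzS⟩
    have hc := (hσc z hz).1
    have ev : ∀ᶠ y in 𝓝 z, ∀ t ∈ Icc (0:ℝ) 1, b + σ z t • (y - b) ∈ Mc ℓ := by
      apply isCompact_Icc.eventually_forall_of_forall_eventually
      intro t ht
      have : IsOpen {q : E × ℝ | b + σ z q.2 • (q.1 - b) ∈ Mc ℓ} := isOpen_Mc.preimage (by fun_prop)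
      exact this.mem_nhds ((hσc z hz).2 t)
    obtain ⟨O, hO, oO, zO⟩ := eventually_nhds_iff.1 ev
    refine ⟨O, oO, zO, fun γ hγ => ?_⟩
    have hγc := hγ.1
    have hsq := Ψ.sq (H := fun s t => b + σ z (cl s) • (γ t - b)) (by fun_prop)
      (fun s t => hO _ (hγ.2 t).2.2 _ (cl_mem s))
    simp only [cl_zero, cl_one, hσ0 z hz, hσ1 z hz, zero_smul, add_zero, one_smul, add_sub_cancel] at hsq
    rw [Ψ.ev_const hb, zero_add] at hsq
    have same : ∀ y ∈ Mc ℓ ∩ (S ∩ O), Ψ.ev (fun s => b + σ z (cl s) • (y - b)) = Ψ.ev (fun s => b + σ y s • (y - b)) := by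
      intro y hy
      obtain ⟨g, hg⟩ := hl y hy.2.1
      have h1 := hg (fun s => σ z (cl s)) ⟨by fun_prop, fun s => ⟨hO _ hy.2.2 _ (cl_mem s), mem_univ _⟩⟩
      have h2 := hg (σ y) ⟨(hσc y hy.1).1, fun s => ⟨(hσc y hy.1).2 s, mem_univ _⟩⟩
      simp only [cl_zero, cl_one, hσ0 z hz, hσ1 z hz, hσ0 y hy.1, hσ1 y hy.1] at h1 h2
      exact h1.trans h2.symm
    beta_reduce
    rw [← same _ (hγ.2 1), ← same _ (hγ.2 0), ← hsq]
    abel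

end MF


open Set Topology

namespace MF

set_option linter.unusedSectionVars false

/-- solving a cohomological equation on the orbits of a periodic map -/
lemma orbit_solve {X A : Type*} [AddCommGroup A] (T : X → X) (g : X → A) {n : ℕ} (hn : 0 < n)
    (hT : ∀ x, T^[n] x = x)
    (h : ∀ x k, T^[k] x = x → ∑ i ∈ Finset.range k, g (T^[i] x) = 0) :
    ∃ f : X → A, ∀ x, f (T x) - f x = g x := by
  have hTm : ∀ m x, T^[m * n] x = x := by
    intro m
    induction m with
    | zero => intro x; simp
    | succ m ih => intro x; rw [Nat.succ_mul, Function.iterate_add_apply, hT, ih]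
  let r : Setoid X :=
    { r := fun x y => ∃ k, T^[k] x = y
      iseqv :=
        { refl := fun x => ⟨0, rfl⟩
          symm := by
            rintro x y ⟨k, rfl⟩
            refine ⟨(n - 1) * k, ?_⟩
            rw [← Function.iterate_add_apply]
            have : (n - 1) * k + k = k * n := by
              obtain ⟨m, rfl⟩ := Nat.exists_eq_succ_of_ne_zero hn.ne'
              simp; ring
            rw [this, hTm]
          trans := by
            rintro x y z ⟨k, rfl⟩ ⟨k', rfl⟩
            exact ⟨k' + k, by rw [Function.iterate_add_apply]⟩ } }
  let rep : X → X := fun x => (Quotient.mk r x).out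
  have hrep : ∀ x, ∃ k, T^[k] (rep x) = x := fun x => Quotient.mk_out (s := r) x
  have hrepT : ∀ x, rep (T x) = rep x := by
    intro x
    have : Quotient.mk r (T x) = Quotient.mk r x := (Quotient.sound (s := r) ⟨1, rfl⟩).symm
    simp only [rep, this]
  choose k hk using hrep
  have hS : ∀ x a d, T^[a] x = T^[a + d] x →
      ∑ i ∈ Finset.range a, g (T^[i] x) = ∑ i ∈ Finset.range (a + d), g (T^[i] x) := by
    intro x a d he
    rw [Finset.sum_range_add]
    have := h (T^[a] x) d (by rw [← Function.iterate_add_apply, add_comm, ← he])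
    simp_rw [← Function.iterate_add_apply] at this
    simp_rw [add_comm a]
    rw [this, add_zero]
  have hS' : ∀ x a b, T^[a] x = T^[b] x →
      ∑ i ∈ Finset.range a, g (T^[i] x) = ∑ i ∈ Finset.range b, g (T^[i] x) := by
    intro x a b he
    rcases le_total a b with hab | hab
    · obtain ⟨d, rfl⟩ := Nat.exists_eq_add_of_le hab
      exact hS x a d he
    · obtain ⟨d, rfl⟩ := Nat.exists_eq_add_of_le hab
      exact (hS x b d he.symm).symm
  refine ⟨fun x => ∑ i ∈ Finset.range (k x), g (T^[i] (rep x)), fun x => ?_⟩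
  have h1 := hS' (rep x) (k (T x)) (k x + 1) (by
    rw [Function.iterate_succ_apply', hk x]
    have := hk (T x)
    rw [hrepT] at this; exact this)
  beta_reduce
  rw [hrepT, h1, Finset.sum_range_succ, hk x]; abel

variable {E : Type*} [NormedAddCommGroup E] [NormedSpace ℂ E] {ι : Type*} [Fintype ι]
  {A : Type*} [AddCommGroup A] {ℓ : ι → E →L[ℂ] ℂ}

lemma om_dvd [Nonempty ι] {k : ℕ} (h : om ι ^ k = 1) : Fintype.card ι ∣ k := by
  have hp := (Complex.isPrimitiveRoot_exp (Fintype.card ι) Fintype.card_ne_zero).inv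
  have : (Complex.exp (2 * Real.pi * Complex.I / (Fintype.card ι : ℂ)))⁻¹ = om ι := by
    rw [om, ← Complex.exp_neg, neg_div]
  rw [this] at hp
  exact hp.dvd_of_pow_eq_one _ h

lemma ne_zero_of_Fb [Nonempty ι] {z : E} (hz : z ∈ Fb ℓ) : z ≠ 0 := by
  rintro rfl
  obtain ⟨i⟩ := ‹Nonempty ι›
  exact Fb_sub_Mc hz i (by simp)

/-- changing a cocycle by a coboundary -/
def Coc.addPot {X : Type*} [TopologicalSpace X] {U : Set X} (D : Coc U A) (f : X → A) : Coc U A where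
  ev γ := D.ev γ - (f (γ 1) - f (γ 0))
  ax F hF hU := by
    obtain ⟨g, hg⟩ := D.ax F hF hU
    refine ⟨fun p => g p - f (F p), fun γ hγ => ?_⟩
    rw [hg γ hγ]; beta_reduce; abel

lemma om_iter (k : ℕ) (z : E) : (fun z : E => om ι • z)^[k] z = om ι ^ k • z := by
  induction k with
  | zero => simp
  | succ k ih => rw [Function.iterate_succ_apply', ih, smul_smul, pow_succ']

/-- invariant representative -/
lemma exists_inv [Nonempty ι] (hA : ∀ a : A, ∃ a' : A, Fintype.card ι • a' = a) (Φ : Coc (Fb ℓ) A)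
    (hΦ : HP Φ (om ι) univ) : ∃ f : E → A, ∀ γ, Cv (Fb ℓ) γ →
      (Φ.addPot f).ev (fun t => om ι • γ t) = (Φ.addPot f).ev γ := by
  classical
  obtain ⟨h1, g, hg⟩ := hΦ
  choose dv hdv using hA
  set n := Fintype.card ι with hn
  have hn0 : 0 < n := Fintype.card_pos
  have hg' : ∀ γ, Cv (Fb ℓ) γ → Φ.ev (fun t => om ι • γ t) - Φ.ev γ = g (γ 1) - g (γ 0) := by
    intro γ hγ
    exact hg γ (hγ.mono fun x hx => ⟨hx, mem_univ _⟩)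
  let c : E → A := fun x => ∑ i ∈ Finset.range n, g (om ι ^ i • x)
  have hcv : ∀ γ (k : ℕ), Cv (Fb ℓ) γ → Cv (Fb ℓ) (fun t => om ι ^ k • γ t) := by
    intro γ k hγ
    have := hγ.1
    exact ⟨by fun_prop, fun t => om_smul_Fb k (hγ.2 t)⟩
  have hck : ∀ γ (k : ℕ), Cv (Fb ℓ) γ → Φ.ev (fun t => om ι ^ k • γ t) - Φ.ev γ =
      ∑ i ∈ Finset.range k, (g (om ι ^ i • γ 1) - g (om ι ^ i • γ 0)) := by
    intro γ k hγ
    induction k with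
    | zero => simp
    | succ k ih =>
      rw [Finset.sum_range_succ, ← ih, ← hg' _ (hcv γ k hγ)]
      simp only [smul_smul, ← pow_succ']
      abel
  have hc : ∀ γ, Cv (Fb ℓ) γ → c (γ 1) = c (γ 0) := by
    intro γ hγ
    have := hck γ n hγ
    rw [om_pow] at this
    simp only [one_smul, sub_self, Finset.sum_sub_distrib] at this
    exact (sub_eq_zero.1 this.symm)
  have hcT : ∀ x, c (om ι • x) = c x := by
    intro x
    simp only [c, smul_smul, ← pow_succ]
    rw [← sub_eq_zero, ← Finset.sum_sub_distrib, Finset.sum_range_sub (fun i => g (om ι ^ i • x)), hn, om_pow, pow_zero, sub_self]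
  have hcTk : ∀ k x, c (om ι ^ k • x) = c x := by
    intro k
    induction k with
    | zero => intro x; simp
    | succ k ih => intro x; rw [pow_succ, mul_smul, ih, hcT]
  let g' : E → A := fun x => if x ∈ Fb ℓ then g x - dv (c x) else 0
  have hper : ∀ x ∈ Fb ℓ, ∑ i ∈ Finset.range n, g' (om ι ^ i • x) = 0 := by
    intro x hx
    have : ∀ i, g' (om ι ^ i • x) = g (om ι ^ i • x) - dv (c x) := by
      intro i
      simp only [g', om_smul_Fb i hx, if_true, hcTk]
    simp only [this, Finset.sum_sub_distrib, Finset.sum_const, Finset.card_range, hdv]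
    exact sub_self _
  obtain ⟨f, hf⟩ := orbit_solve (fun z : E => om ι • z) g' hn0 (fun x => by rw [om_iter, hn, om_pow, one_smul]) (by
    intro x k hk
    rw [om_iter] at hk
    simp only [om_iter]
    by_cases hx : x ∈ Fb ℓ
    · have hk1 : om ι ^ k = 1 := by
        have : (om ι ^ k - 1) • x = 0 := by rw [sub_smul, hk, one_smul, sub_self]
        rcases smul_eq_zero.1 this with h | h
        · exact sub_eq_zero.1 h
        · exact absurd h (ne_zero_of_Fb hx)
      obtain ⟨m, rfl⟩ := om_dvd hk1
      clear hk hk1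
      induction m with
      | zero => simp
      | succ m ih =>
        rw [Nat.mul_succ, Finset.sum_range_add, ih, zero_add, ← hper x hx]
        apply Finset.sum_congr rfl
        intro i _
        rw [pow_add, pow_mul, om_pow, one_pow, one_mul]
    · apply Finset.sum_eq_zero
      intro i _
      refine if_neg fun h => hx ?_
      have h2 := om_smul_Fb (ι := ι) (i * (n - 1)) h
      rw [smul_smul, ← pow_add] at h2
      have : i * (n - 1) + i = n * i := by
        obtain ⟨m, hm⟩ := Nat.exists_eq_succ_of_ne_zero hn0.ne'
        rw [hm]; simp; ring
      rwa [this, pow_mul, hn, om_pow, one_pow, one_smul] at h2)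
  refine ⟨f, fun γ hγ => ?_⟩
  have e := hg' γ hγ
  have f1 := hf (γ 1)
  have f0 := hf (γ 0)
  simp only [g', hγ.2 1, hγ.2 0, if_true, hc γ hγ] at f1 f0
  change Φ.ev _ - (f (om ι • γ 1) - f (om ι • γ 0)) = Φ.ev γ - (f (γ 1) - f (γ 0))
  rw [sub_eq_iff_eq_add] at e f1 f0
  rw [e, f1, f0]; abel

/-- extending an invariant cocycle from the fibre to the complement -/
lemma exists_ext [Nonempty ι] (Φ : Coc (Fb ℓ) A) (hΦ : ∀ γ, Cv (Fb ℓ) γ →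
      Φ.ev (fun t => om ι • γ t) = Φ.ev γ) : ∃ Ψ : Coc (Mc ℓ) A, ∀ γ, Cv (Fb ℓ) γ → Ψ.ev γ = Φ.ev γ := by
  classical
  have hk : ∀ (k : ℕ) γ, Cv (Fb ℓ) γ → Φ.ev (fun t => om ι ^ k • γ t) = Φ.ev γ := by
    intro k γ hγ
    induction k with
    | zero => simp
    | succ k ih =>
      have hc := hγ.1
      rw [← ih, ← hΦ _ ⟨by fun_prop, fun t => om_smul_Fb k (hγ.2 t)⟩]
      simp only [smul_smul, ← pow_succ']
  have hcv : ∀ {γ : ℝ → E} {L : ℝ → ℂ}, Continuous γ → Continuous L → (∀ t, Complex.exp (L t) = ∏ i, ℓ i (γ t)) →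
      Cv (Fb ℓ) (fun t => Complex.exp (-L t / (Fintype.card ι : ℂ)) • γ t) := by
    intro γ L hγ hL he
    exact ⟨by fun_prop, fun t => normalize_mem (he t).symm⟩
  have hind : ∀ {γ : ℝ → E} {L L' : ℝ → ℂ}, Continuous γ → Continuous L → Continuous L' →
      (∀ t, Complex.exp (L t) = ∏ i, ℓ i (γ t)) → (∀ t, Complex.exp (L' t) = ∏ i, ℓ i (γ t)) →
      Φ.ev (fun t => Complex.exp (-L t / (Fintype.card ι : ℂ)) • γ t) =
      Φ.ev (fun t => Complex.exp (-L' t / (Fintype.card ι : ℂ)) • γ t) := by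
    intro γ L L' hγ hL hL' he he'
    have hu := log_unique hL hL' (fun t => by rw [he, he'])
    have hroot : Complex.exp (-(L 0 - L' 0) / (Fintype.card ι : ℂ)) ^ (Fintype.card ι) = 1 := by
      rw [exp_div_card, neg_sub, Complex.exp_sub, he, he', div_self]
      rw [← he]; exact Complex.exp_ne_zero _
    obtain ⟨k, hk'⟩ := root_eq_om_pow hroot
    rw [← hk k _ (hcv hγ hL' he'), ← hk']
    congr 1
    ext t
    rw [smul_smul, ← Complex.exp_add]
    congr 2
    rw [← hu t 0]; ring
  refine ⟨{ ev := fun γ => if h : ∃ L : ℝ → ℂ, Continuous L ∧ ∀ t, Complex.exp (L t) = ∏ i, ℓ i (γ t) then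
              Φ.ev (fun t => Complex.exp (-h.choose t / (Fintype.card ι : ℂ)) • γ t) else 0
            ax := ?_ }, ?_⟩
  · intro F hF hM
    obtain ⟨L, hL, he⟩ := exists_log (f := fun p => ∏ i, ℓ i (F p)) (by fun_prop)
      (fun p => Finset.prod_ne_zero_iff.2 fun i _ => hM p i)
    obtain ⟨g, hg⟩ := Φ.ax (fun p => Complex.exp (-L p / (Fintype.card ι : ℂ)) • F p) (by fun_prop)
      (fun p => normalize_mem (he p).symm)
    refine ⟨g, fun γ hγ => ?_⟩
    have h : ∃ L : ℝ → ℂ, Continuous L ∧ ∀ t, Complex.exp (L t) = ∏ i, ℓ i (F (γ t)) :=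
      ⟨fun t => L (γ t), by fun_prop, fun t => he _⟩
    rw [dif_pos h, ← hg γ hγ]
    exact hind (L' := fun t => L (γ t)) (hF.comp hγ) h.choose_spec.1 (by fun_prop) h.choose_spec.2 fun t => he _
  · intro γ hγ
    have h : ∃ L : ℝ → ℂ, Continuous L ∧ ∀ t, Complex.exp (L t) = ∏ i, ℓ i (γ t) :=
      ⟨fun t => 0, by fun_prop, fun t => by rw [mem_Fb.1 (hγ.2 t), Complex.exp_zero]⟩
    change dite _ _ _ = _
    rw [dif_pos h, hind (L' := fun _ => 0) hγ.1 h.choose_spec.1 (by fun_prop) h.choose_spec.2 (fun t => by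
      rw [mem_Fb.1 (hγ.2 t), Complex.exp_zero])]
    simp

/-- linear combination of winding cocycles -/
noncomputable def wsum (ℓ : ι → E →L[ℂ] ℂ) (a : ι → A) : Coc (Mc ℓ) A where
  ev γ := ∑ i, (wl ℓ i).ev γ • a i
  ax F hF hU := by
    choose g hg using fun i => (wl ℓ i).ax F hF hU
    refine ⟨fun p => ∑ i, g i p • a i, fun γ hγ => ?_⟩
    simp only [fun i => hg i γ hγ, sub_smul, Finset.sum_sub_distrib]

/-- Round 2 -/
theorem round2 [Nonempty ι] (hA : ∀ a : A, ∃ a' : A, Fintype.card ι • a' = a) (Φ : Coc (Fb ℓ) A)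
    (hΦ : HP Φ (om ι) univ) (hnp : ∀ i i' : ι, i ≠ i' → ∀ c : ℂ, ℓ i ≠ c • ℓ i')
    {γ : ℝ → E} (hγ : Cv (Fb ℓ) γ) (h01 : γ 0 = γ 1) (hw : ∀ i, (wl ℓ i).ev γ = 0) : Φ.ev γ = 0 := by
  classical
  obtain ⟨f, hf⟩ := exists_inv hA Φ hΦ
  obtain ⟨Ψ, hΨ⟩ := exists_ext _ hf
  let a : ι → A := fun i => if h : ∃ q : E × E, Cf ℓ i q.1 q.2 then Ψ.ev (mer h.choose.1 h.choose.2) else 0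
  have ha : ∀ i p d, Cf ℓ i p d → Ψ.ev (mer p d) = a i := by
    intro i p d h
    have hex : ∃ q : E × E, Cf ℓ i q.1 q.2 := ⟨(p, d), h⟩
    simp only [a, dif_pos hex]
    exact mer_const Ψ h hex.choose_spec
  obtain ⟨g, hg⟩ := Mc_pot hnp (Fb_sub_Mc (hγ.2 0)) (Ψ.sub (wsum ℓ a)) (by
    intro i p d h
    change Ψ.ev _ - ∑ l, (wl ℓ l).ev (mer p d) • a l = 0
    rw [ha i p d h]
    simp [h.wl])
  have h1 := hg γ (hγ.mono fun x hx => ⟨Fb_sub_Mc hx, mem_univ _⟩)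
  rw [h01, sub_self] at h1
  change Ψ.ev γ - ∑ l, (wl ℓ l).ev γ • a l = 0 at h1
  simp only [hw, zero_smul, Finset.sum_const_zero, sub_zero] at h1
  rw [hΨ γ hγ] at h1
  change Φ.ev γ - (f (γ 1) - f (γ 0)) = 0 at h1
  rw [h01, sub_self, sub_zero] at h1
  exact h1

end MF


open Set Topology

namespace MF

set_option linter.unusedSectionVars false

section pi1

variable {X : Type*} [TopologicalSpace X] {U : Set X} {A : Type*} [AddCommGroup A]

/-- extension of a path of the subtype to a curve -/
noncomputable def pcv {x y : U} (p : Path x y) (t : ℝ) : X := (p.extend t : X)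

lemma pcv_cv {x y : U} (p : Path x y) : Cv U (pcv p) :=
  ⟨continuous_subtype_val.comp p.continuous_extend, fun t => (p.extend t).2⟩

lemma pcv_zero {x y : U} (p : Path x y) : pcv p 0 = x := by simp [pcv]
lemma pcv_one {x y : U} (p : Path x y) : pcv p 1 = y := by simp [pcv]

lemma pcv_homotopic (D : Coc U A) {x y : U} {p q : Path x y} (h : p.Homotopic q) :
    D.ev (pcv p) = D.ev (pcv q) := by
  obtain ⟨F⟩ := h
  have := D.sq (H := fun s t => (F (projIcc 0 1 zero_le_one s, projIcc 0 1 zero_le_one t) : X))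
    (by
      apply continuous_subtype_val.comp
      apply F.continuous.comp
      exact (continuous_projIcc.comp continuous_fst).prodMk (continuous_projIcc.comp continuous_snd)) (fun s t => (F _).2)
  simp only [projIcc_left, projIcc_right] at this
  have e0 : ∀ s, (F (s, ⟨0, by simp⟩) : X) = x := fun s => by
    have := F.source s
    exact congrArg Subtype.val this
  have e1 : ∀ s, (F (s, ⟨1, by simp⟩) : X) = y := fun s => by
    have := F.target s
    exact congrArg Subtype.val this
  have e2 : ∀ t, (F (⟨0, by simp⟩, t) : X) = p t := fun t => by
    have := F.apply_zero t
    exact congrArg Subtype.val this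
  have e3 : ∀ t, (F (⟨1, by simp⟩, t) : X) = q t := fun t => by
    have := F.apply_one t
    exact congrArg Subtype.val this
  simp only [e0, e1, e2, e3] at this
  rw [D.ev_const x.2, D.ev_const y.2, zero_add, add_zero] at this
  exact this.symm

lemma pcv_trans (D : Coc U A) {x y z : U} (p : Path x y) (q : Path y z) :
    D.ev (pcv (p.trans q)) = D.ev (pcv p) + D.ev (pcv q) := by
  have hc := pcv_cv (p.trans q)
  rw [← D.seg_zero_one, ← D.seg_add hc 0 (1 / 2) 1]
  congr 1
  · refine D.ev_congr (hc.comp (φ := fun t => 0 + t * (1 / 2 - 0)) (by fun_prop)) (pcv_cv p) fun t ht => ?_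
    have h1 : (0 + t * (1 / 2 - 0) : ℝ) ∈ Icc (0:ℝ) 1 := ⟨by linarith [ht.1], by linarith [ht.2]⟩
    simp only [pcv]
    rw [Path.extend_apply _ h1, Path.extend_apply _ ht, Path.trans_apply, dif_pos (by simp only; linarith [ht.2])]
    congr 3
    simp; ring
  · refine D.ev_congr (hc.comp (φ := fun t => 1 / 2 + t * (1 - 1 / 2)) (by fun_prop)) (pcv_cv q) fun t ht => ?_
    have h1 : (1 / 2 + t * (1 - 1 / 2) : ℝ) ∈ Icc (0:ℝ) 1 := ⟨by linarith [ht.1], by linarith [ht.2]⟩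
    simp only [pcv]
    rw [Path.extend_apply _ h1, Path.extend_apply _ ht, Path.trans_apply]
    split_ifs with h
    · have h0 : t = 0 := by simp only at h; linarith [ht.1]
      subst h0
      have e : (⟨0, ht⟩ : unitInterval) = 0 := rfl
      rw [e, q.source]
      have e' : ∀ hh, (⟨2 * (1 / 2 + 0 * (1 - 1 / 2) : ℝ), hh⟩ : unitInterval) = 1 := by
        intro hh; apply Subtype.ext; simp
      rw [e', p.target]
    · congr 3
      simp; ring

/-- homomorphism induced by a cocycle -/
noncomputable def homOf (D : Coc U A) (z : U) : FundamentalGroup U z →* Multiplicative A where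
  toFun c := Multiplicative.ofAdd (Quotient.lift (s := Path.Homotopic.setoid z z) (fun p : Path z z => D.ev (pcv p))
    (fun _ _ h => pcv_homotopic D h) c)
  map_one' := by
    change Multiplicative.ofAdd (D.ev (pcv (Path.refl z))) = 1
    have : pcv (Path.refl z) = fun _ => (z : X) := by ext t; simp [pcv]
    rw [this, D.ev_const z.2]; rfl
  map_mul' c d := by
    induction c using Quotient.inductionOn with | _ p
    induction d using Quotient.inductionOn with | _ q
    change Multiplicative.ofAdd (D.ev (pcv (q.trans p))) = Multiplicative.ofAdd (D.ev (pcv p)) * Multiplicative.ofAdd (D.ev (pcv q))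
    rw [pcv_trans, add_comm, ofAdd_add]

lemma homOf_mk (D : Coc U A) (z : U) (p : Path z z) :
    homOf D z (Path.Homotopic.Quotient.mk p) = Multiplicative.ofAdd (D.ev (pcv p)) := rfl

/-- closing up a path class -/
noncomputable def th {z : U} (q : ∀ x : U, Path.Homotopic.Quotient z x) {x y : U} (c : Path.Homotopic.Quotient x y) :
    FundamentalGroup U z := ((q x).trans c).trans (q y).symm

lemma th_trans {z : U} (q : ∀ x : U, Path.Homotopic.Quotient z x) {x y w : U} (c : Path.Homotopic.Quotient x y)
    (d : Path.Homotopic.Quotient y w) : th q (c.trans d) = th q d * th q c := by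
  rw [FundamentalGroup.mul_def]
  simp only [th]
  rw [Path.Homotopic.Quotient.trans_assoc, Path.Homotopic.Quotient.trans_assoc, Path.Homotopic.Quotient.trans_assoc,
    Path.Homotopic.Quotient.trans_assoc, Path.Homotopic.Quotient.trans_assoc]
  congr 2
  rw [← Path.Homotopic.Quotient.trans_assoc, ← Path.Homotopic.Quotient.trans_assoc,
    Path.Homotopic.Quotient.symm_trans, Path.Homotopic.Quotient.refl_trans]

lemma exists_ofChar {z : U} (hU : ∀ x : U, Nonempty (Path z x)) (χ : FundamentalGroup U z →* Multiplicative A) :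
    ∃ D : Coc U A, ∀ p : Path z z, D.ev (pcv p) = Multiplicative.toAdd (χ (Path.Homotopic.Quotient.mk p)) := by
  classical
  let q : ∀ x : U, Path.Homotopic.Quotient z x := fun x => Path.Homotopic.Quotient.mk (hU x).some
  let ev : (ℝ → X) → A := fun γ => if h : ∃ (w : Σ x : U, Σ y : U, Path x y), ∀ t : unitInterval, (w.2.2 t : X) = γ t then
    Multiplicative.toAdd (χ (th q (Path.Homotopic.Quotient.mk h.choose.2.2))) else 0
  have spec : ∀ (γ : ℝ → X) (x y : U) (p : Path x y), (∀ t : unitInterval, (p t : X) = γ t) →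
      ev γ = Multiplicative.toAdd (χ (th q (Path.Homotopic.Quotient.mk p))) := by
    intro γ x y p hp
    have h : ∃ (w : Σ x : U, Σ y : U, Path x y), ∀ t : unitInterval, (w.2.2 t : X) = γ t := ⟨⟨x, y, p⟩, hp⟩
    have gen : ∀ (w : Σ x : U, Σ y : U, Path x y), (∀ t : unitInterval, (w.2.2 t : X) = γ t) →
        th q (Path.Homotopic.Quotient.mk w.2.2) = th q (Path.Homotopic.Quotient.mk p) := by
      rintro ⟨x', y', p'⟩ hp'
      have hpp : ∀ t, p' t = p t := fun t => Subtype.ext ((hp' t).trans (hp t).symm)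
      have hx : x' = x := by rw [← p'.source, ← p.source, hpp]
      have hy : y' = y := by rw [← p'.target, ← p.target, hpp]
      subst hx hy
      have : p' = p := by ext t; exact congrArg Subtype.val (hpp t)
      rw [this]
    simp only [ev, dif_pos h]
    rw [gen _ h.choose_spec]
  refine ⟨⟨ev, ?_⟩, ?_⟩
  · intro F hF hFU
    let F' : C(ℝ × ℝ, U) := ⟨fun p => ⟨F p, hFU p⟩, by fun_prop⟩
    let ln : ∀ p : ℝ × ℝ, Path (0 : ℝ × ℝ) p := fun p => PathConnectedSpace.somePath _ _
    refine ⟨fun p => Multiplicative.toAdd (χ (th q (Path.Homotopic.Quotient.mk ((ln p).map F'.continuous)))), fun γ hγ => ?_⟩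
    let γp : Path (γ 0) (γ 1) := ⟨⟨fun t => γ t, by fun_prop⟩, by simp, by simp⟩
    rw [spec (fun t => F (γ t)) _ _ (γp.map F'.continuous) (fun t => rfl)]
    have hh : Path.Homotopic.Quotient.mk (ln (γ 1)) = Path.Homotopic.Quotient.mk ((ln (γ 0)).trans γp) :=
      Path.Homotopic.Quotient.eq.2 (SimplyConnectedSpace.paths_homotopic _ _)
    have hm : Path.Homotopic.Quotient.mk ((ln (γ 1)).map F'.continuous) =
        (Path.Homotopic.Quotient.mk ((ln (γ 0)).map F'.continuous)).trans (Path.Homotopic.Quotient.mk (γp.map F'.continuous)) := by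
      rw [← Path.Homotopic.Quotient.mk_trans, ← Path.map_trans]
      exact congrArg (fun c => Path.Homotopic.Quotient.map c F') hh
    beta_reduce
    rw [hm, th_trans, map_mul, toAdd_mul]
    abel
  · intro p
    change ev _ = _
    rw [spec _ z z p (fun t => by simp [pcv])]
    congr 1
    let Q : FundamentalGroup U z := q z
    let P : FundamentalGroup U z := Path.Homotopic.Quotient.mk p
    have : th q (Path.Homotopic.Quotient.mk p) = Q⁻¹ * (P * Q) := rfl
    rw [this, map_mul, map_mul, map_inv]
    exact inv_mul_cancel_comm_assoc _ _

end pi1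

end MF


open Set Topology

namespace MF

set_option linter.unusedSectionVars false

section P13
variable {E : Type*} [NormedAddCommGroup E] [NormedSpace ℂ E] {ι : Type*} [Fintype ι]
  {A : Type*} [AddCommGroup A] {ℓ : ι → E →L[ℂ] ℂ}

lemma exists_Cf (hnp : ∀ i i' : ι, i ≠ i' → ∀ c : ℂ, ℓ i ≠ c • ℓ i') {z : E} (hz : z ∈ Mc ℓ) (i : ι) :
    ∃ p d, Cf ℓ i p d := by
  obtain ⟨p, hp, hne⟩ := Module.Dual.exists_forall_mem_ne_zero_of_forall_exists
    (LinearMap.ker (ℓ i : E →ₗ[ℂ] ℂ)) (fun l : {l // l ≠ i} => (ℓ l : E →ₗ[ℂ] ℂ)) (by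
      rintro ⟨l, hl⟩
      by_contra! hcon
      apply hnp l i hl (ℓ l z / ℓ i z)
      ext x
      have hi := hz i
      have h1 := hcon (x - (ℓ i x / ℓ i z) • z) (by
        simp only [LinearMap.mem_ker, ContinuousLinearMap.coe_coe, map_sub, map_smul, smul_eq_mul]
        field_simp; ring)
      simp only [ContinuousLinearMap.coe_coe, map_sub, map_smul, smul_eq_mul] at h1
      simp only [smul_apply, smul_eq_mul]
      field_simp at h1 ⊢
      linear_combination h1)
  have hp : ℓ i p = 0 := hp
  have hev : ∀ᶠ ε : ℝ in 𝓝[>] 0, ∀ l : ι, l ≠ i → ‖ℓ l ((ε : ℂ) • z)‖ < ‖ℓ l p‖ := by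
    rw [Filter.eventually_all]
    intro l
    by_cases hl : l = i
    · filter_upwards with ε h using absurd hl h
    · have hc : Continuous fun ε : ℝ => ‖ℓ l ((ε : ℂ) • z)‖ := by fun_prop
      have h0 : ‖ℓ l (((0 : ℝ) : ℂ) • z)‖ < ‖ℓ l p‖ := by simpa using hne ⟨l, hl⟩
      have := (hc.tendsto 0).eventually (gt_mem_nhds h0)
      filter_upwards [nhdsWithin_le_nhds this] with ε h _ using h
  obtain ⟨ε, h, hε⟩ := (hev.and self_mem_nhdsWithin).exists
  refine ⟨p, (ε : ℂ) • z, hp, ?_, h⟩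
  have : (ε : ℂ) ≠ 0 := by exact_mod_cast (ne_of_gt hε)
  simpa [this] using hz i

lemma pc_Mc : PC (Mc ℓ) := by
  have := pc_convex_minus (K := (univ : Set E)) isOpen_univ (fun _ _ _ _ _ _ => mem_univ _) (fun i x => ℓ i x)
    (by intro i x y τ; simp)
  simpa [Mc] using this

lemma realize (hnp : ∀ i i' : ι, i ≠ i' → ∀ c : ℂ, ℓ i ≠ c • ℓ i') {z : E} (hz : z ∈ Mc ℓ) (v : ι → ℤ) :
    ∃ γ, Cv (Mc ℓ) γ ∧ γ 0 = z ∧ γ 1 = z ∧ ∀ i, (wl ℓ i).ev γ = v i := by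
  classical
  let S : AddSubgroup (ι → ℤ) :=
    { carrier := {v | ∃ γ, Cv (Mc ℓ) γ ∧ γ 0 = z ∧ γ 1 = z ∧ ∀ i, (wl ℓ i).ev γ = v i}
      add_mem' := by
        rintro v w ⟨γ, hγ, h0, h1, hv⟩ ⟨δ, hδ, k0, k1, hw⟩
        obtain ⟨d, hd, d0, d1, hD⟩ := concat hγ hδ (by rw [h1, k0])
        refine ⟨d, hd, by rw [d0, h0], by rw [d1, k1], fun i => ?_⟩
        rw [hD (wl ℓ i) le_rfl, hv, hw]; rfl
      zero_mem' := ⟨fun _ => z, ⟨continuous_const, fun _ => hz⟩, rfl, rfl, fun i => (wl ℓ i).ev_const hz⟩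
      neg_mem' := by
        rintro v ⟨γ, hγ, h0, h1, hv⟩
        refine ⟨fun t => γ (1 - t), hγ.comp (φ := fun t => 1 - t) (by fun_prop), by simpa using h1, by simpa using h0, fun i => ?_⟩
        rw [(wl ℓ i).ev_rev hγ, hv]; rfl }
  have hs : ∀ i, Pi.single i (1 : ℤ) ∈ S := by
    intro i
    obtain ⟨p, d, hpd⟩ := exists_Cf hnp hz i
    obtain ⟨c, hc, c0, c1⟩ := joined_curve (pc_Mc (ℓ := ℓ) z hz (mer p d 0) (hpd.mem 0))
    obtain ⟨e, he, e0, e1, hE⟩ := concat hc ⟨mer_cont p d, hpd.mem⟩ c1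
    obtain ⟨f, hf, f0, f1, hF⟩ := concat he (hc.comp (φ := fun t => 1 - t) (by fun_prop)) (by
      rw [e1, mer_one, sub_zero, c1])
    refine ⟨f, hf, by rw [f0, e0, c0], by rw [f1, sub_self, c0], fun l => ?_⟩
    rw [hF (wl ℓ l) le_rfl, hE (wl ℓ l) le_rfl, (wl ℓ l).ev_rev hc, hpd.wl l, Pi.single_apply]
    ring
  have hv : v ∈ S := by
    have : v = ∑ i, v i • Pi.single i (1 : ℤ) := by
      ext l; simp [Finset.sum_apply, Pi.single_apply]
    rw [this]
    exact S.sum_mem fun i _ => S.zsmul_mem (hs i) _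
  exact hv

lemma norm_loop [Nonempty ι] {γ : ℝ → E} (hγ : Cv (Mc ℓ) γ) (h0 : γ 0 ∈ Fb ℓ) (h1 : γ 1 = γ 0) :
    ∃ δ, Cv (Fb ℓ) δ ∧ δ 0 = γ 0 ∧
      δ 1 = Complex.exp (-((∑ i, (wl ℓ i).ev γ : ℤ) * (2 * Real.pi * Complex.I)) / (Fintype.card ι : ℂ)) • γ 0 ∧
      ((∑ i, (wl ℓ i).ev γ) = 0 → ∀ i, (wl ℓ i).ev δ = (wl ℓ i).ev γ) := by
  have hγc := hγ.1
  have hL : ∀ i, ∃ L : ℝ → ℂ, Continuous L ∧ ∀ t, Complex.exp (L t) = ℓ i (γ t) := fun i =>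
    exists_log (by fun_prop) fun t => hγ.2 t i
  choose L hLc hLe using hL
  have hw : ∀ i, L i 1 - L i 0 = (wl ℓ i).ev γ * (2 * Real.pi * Complex.I) := by
    intro i
    rw [wn_spec (hLc i) (hLe i), wl_ev, h1]; ring
  have hp0 : Complex.exp (∑ i, L i 0) = 1 := by
    rw [Complex.exp_sum]; simp only [hLe]; exact h0
  let M : ℝ → ℂ := fun t => ∑ i, L i t - ∑ i, L i 0
  have hMc : Continuous M := by fun_prop
  have hM0 : M 0 = 0 := sub_self _
  have hM1 : M 1 = (∑ i, (wl ℓ i).ev γ : ℤ) * (2 * Real.pi * Complex.I) := by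
    simp only [M]
    rw [← Finset.sum_sub_distrib, Finset.sum_congr rfl fun i _ => hw i, ← Finset.sum_mul]; push_cast; rfl
  refine ⟨fun t => Complex.exp (-(M t) / (Fintype.card ι : ℂ)) • γ t, ⟨by fun_prop, fun t => normalize_mem ?_⟩, ?_, ?_, ?_⟩
  · simp only [M]
    rw [Complex.exp_sub, hp0, div_one, Complex.exp_sum]
    simp only [hLe]
  · simp [hM0]
  · beta_reduce; rw [hM1, h1]
  · intro hs i
    have hM1' : M 1 = 0 := by rw [hM1, hs]; simp
    rw [wl_ev, wl_ev]
    refine wn_eq (L := fun t => -(M t) / (Fintype.card ι : ℂ) + L i t) (by have := hLc i; fun_prop) ?_ ?_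
    · intro t
      rw [Complex.exp_add, hLe, map_smul, smul_eq_mul]
    · have := wn_spec (hLc i) (hLe i)
      simp only [hM0, hM1', neg_zero, zero_div, zero_add, Complex.exp_zero, one_smul]
      exact this

lemma wl_sum_zero {γ : ℝ → E} (hγ : Cv (Fb ℓ) γ) (h1 : γ 1 = γ 0) : ∑ i, (wl ℓ i).ev γ = 0 := by
  have hγc := hγ.1
  have hL : ∀ i, ∃ L : ℝ → ℂ, Continuous L ∧ ∀ t, Complex.exp (L t) = ℓ i (γ t) := fun i =>
    exists_log (by fun_prop) fun t => Fb_sub_Mc (hγ.2 t) i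
  choose L hLc hLe using hL
  have hw : ∀ i, L i 1 - L i 0 = (wl ℓ i).ev γ * (2 * Real.pi * Complex.I) := by
    intro i
    rw [wn_spec (hLc i) (hLe i), wl_ev, h1]; ring
  have := log_unique (L := fun t => ∑ i, L i t) (L' := fun _ => 0) (by fun_prop) (by fun_prop) (fun t => by
    rw [Complex.exp_sum, Complex.exp_zero]; simp only [hLe]; exact hγ.2 t) 1 0
  simp only [sub_zero] at this
  have h2 : (((∑ i, (wl ℓ i).ev γ : ℤ)) : ℂ) * (2 * Real.pi * Complex.I) = 0 := by
    push_cast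
    rw [Finset.sum_mul, ← Finset.sum_congr rfl fun i _ => hw i, Finset.sum_sub_distrib, this, sub_self]
  exact_mod_cast (mul_eq_zero.1 h2).resolve_right Complex.two_pi_I_ne_zero

lemma pc_Fb_all [Nonempty ι] (hnp : ∀ i i' : ι, i ≠ i' → ∀ c : ℂ, ℓ i ≠ c • ℓ i') {z : E} (hz : z ∈ Fb ℓ) :
    PC (Fb ℓ) := by
  classical
  have : PC (Fb ℓ ∩ univ) := by
    apply pc_Fb (fun _ _ _ _ => mem_univ _) (by rw [inter_univ]; exact pc_Mc)
    refine ⟨z, ⟨hz, mem_univ _⟩, ?_⟩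
    obtain ⟨i⟩ := ‹Nonempty ι›
    obtain ⟨γ, hγ, h0, h1, hw⟩ := realize hnp (Fb_sub_Mc hz) (Pi.single i (1 : ℤ))
    haveI : Nonempty ι := ⟨i⟩
    obtain ⟨δ, hδ, d0, d1, -⟩ := norm_loop hγ (h0 ▸ hz) (h1.trans h0.symm)
    refine joined_of_curve δ hδ.1.continuousOn (d0.trans h0) ?_ fun t _ => ⟨hδ.2 t, mem_univ _⟩
    rw [d1, h0, om]
    simp [hw]
  rwa [inter_univ] at this

/-- vector of windings, on the fibre -/
noncomputable def wv (ℓ : ι → E →L[ℂ] ℂ) : Coc (Fb ℓ) (ι → ℤ) where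
  ev γ i := (wl ℓ i).ev γ
  ax F hF h := by
    have := fun i => (wl ℓ i).ax F hF (fun p => Fb_sub_Mc (h p))
    choose g hg using this
    exact ⟨fun p i => g i p, fun γ hγ => funext fun i => hg i γ hγ⟩

end P13

end MF


open Set Topology

namespace MF

set_option linter.unusedSectionVars false

section P14
variable {E : Type*} [NormedAddCommGroup E] [NormedSpace ℂ E]

lemma circle_div {n : ℕ} (hn : n ≠ 0) (a : AddCircle (1 : ℚ)) : ∃ a' : AddCircle (1 : ℚ), n • a' = a := by
  induction a using QuotientAddGroup.induction_on with | _ q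
  refine ⟨((q / n : ℚ) : AddCircle (1 : ℚ)), ?_⟩
  have hn' : (n : ℚ) ≠ 0 := by exact_mod_cast hn
  change ((n • (q / n) : ℚ) : AddCircle (1 : ℚ)) = _
  congr 1
  rw [nsmul_eq_mul]; field_simp

theorem main_gen {m : ℕ} (ℓ : Fin (m + 1) → E →L[ℂ] ℂ)
    (hnp : ∀ i i', i ≠ i' → ∀ c : ℂ, ℓ i ≠ c • ℓ i')
    (H : ∀ Φ : Coc (Fb ℓ) (AddCircle (1 : ℚ)), HP Φ (om (Fin (m + 1))) univ) (z : Fb ℓ) :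
    Nonempty (Additive (Abelianization (FundamentalGroup (Fb ℓ) z)) ≃+ (Fin m → ℤ)) := by
  have hpc : ∀ x : Fb ℓ, Nonempty (Path z x) := by
    intro x
    exact ⟨((pc_Fb_all hnp z.2) z z.2 x x.2).joined_subtype.somePath⟩
  let W : Additive (Abelianization (FundamentalGroup (Fb ℓ) z)) →+ (Fin (m + 1) → ℤ) :=
    MonoidHom.toAdditiveLeft (Abelianization.lift (homOf (wv ℓ) z))
  let of : Path z z → Additive (Abelianization (FundamentalGroup (Fb ℓ) z)) := fun p =>
    Additive.ofMul (Abelianization.of (Path.Homotopic.Quotient.mk p : FundamentalGroup (Fb ℓ) z))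
  have hof : ∀ x, ∃ p, of p = x := by
    intro x
    obtain ⟨g, hg⟩ := QuotientGroup.mk_surjective (Additive.toMul x)
    induction g using Quotient.inductionOn with | _ p
    exact ⟨p, hg⟩
  have hW : ∀ p i, W (of p) i = (wl ℓ i).ev (pcv p) := fun p i => rfl
  have hsum : ∀ x, ∑ i, W x i = 0 := by
    intro x
    obtain ⟨p, rfl⟩ := hof x
    simp only [hW]
    exact wl_sum_zero (pcv_cv p) (by rw [pcv_zero, pcv_one])
  have hinj : ∀ x, W x = 0 → x = 0 := by
    intro x hx
    apply CharacterModule.eq_zero_of_character_apply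
    intro c
    obtain ⟨p, rfl⟩ := hof x
    let χ : FundamentalGroup (Fb ℓ) z →* Multiplicative (AddCircle (1 : ℚ)) :=
      (AddMonoidHom.toMultiplicativeRight (c : Additive (Abelianization (FundamentalGroup (Fb ℓ) z)) →+ AddCircle (1 : ℚ))).comp
        Abelianization.of
    obtain ⟨D, hD⟩ := exists_ofChar hpc χ
    have h1 : c (of p) = D.ev (pcv p) := (hD p).symm
    rw [h1]
    exact round2 (circle_div Fintype.card_ne_zero) D (H D) hnp (pcv_cv p) (by rw [pcv_zero, pcv_one])
      (fun i => by rw [← hW, hx]; rfl)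
  let T : (Fin (m + 1) → ℤ) →+ (Fin m → ℤ) :=
    { toFun := fun v k => v k.succ
      map_zero' := rfl
      map_add' := fun _ _ => rfl }
  refine ⟨AddEquiv.ofBijective (T.comp W) ⟨(injective_iff_map_eq_zero _).2 fun x hx => hinj x ?_, fun u => ?_⟩⟩
  · have hk : ∀ k : Fin m, W x k.succ = 0 := fun k => congrFun hx k
    have h0 := hsum x
    rw [Fin.sum_univ_succ, Finset.sum_eq_zero fun k _ => hk k, add_zero] at h0
    ext i
    refine Fin.cases h0 (fun k => hk k) i
  · obtain ⟨γ, hγ, h0, h1, hw⟩ := realize hnp (Fb_sub_Mc z.2) (Fin.cons (-∑ k, u k) u : Fin (m + 1) → ℤ)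
    have hs : ∑ i, (wl ℓ i).ev γ = 0 := by
      simp only [hw, Fin.sum_univ_succ, Fin.cons_zero, Fin.cons_succ]; ring
    obtain ⟨δ, hδ, d0, d1, hd⟩ := norm_loop hγ (h0 ▸ z.2) (h1.trans h0.symm)
    rw [hs] at d1
    have hδc := hδ.1
    let p : Path z z := ⟨⟨fun t => ⟨δ t, hδ.2 t⟩, by fun_prop⟩, Subtype.ext (by simp [d0, h0]), Subtype.ext (by simp [d1, h0])⟩
    refine ⟨of p, funext fun k => ?_⟩
    change W (of p) k.succ = u k
    rw [hW, (wl ℓ k.succ).ev_congr ((pcv_cv p).mono Fb_sub_Mc) (hδ.mono Fb_sub_Mc), hd hs, hw, Fin.cons_succ]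
    intro t ht
    simp only [pcv]
    rw [Path.extend_apply _ ht]
    rfl

end P14

end MF


open Set Topology

namespace MF

set_option linter.unusedSectionVars false

section P15
variable {E : Type*} [NormedAddCommGroup E] [NormedSpace ℂ E] {ι : Type*} [Fintype ι]
  {A : Type*} [AddCommGroup A]

lemma transfer {ℓ : ι → E →L[ℂ] ℂ} (R : Arr ι) (g : E3 ≃L[ℂ] E) (hg : ∀ i z, R.lf i z = ℓ i (g z))
    (Φ : Coc (Fb ℓ) A) : HP Φ (om ι) univ := by
  have hm : MapsTo g (Fb R.lf) (Fb ℓ) := by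
    intro z hz
    rw [mem_Fb] at hz ⊢
    simpa only [hg] using hz
  obtain ⟨h1, q, hq⟩ := R.round1 (Φ.pull g (by fun_prop) hm)
  refine ⟨h1, fun z => q (g.symm z), fun γ hγ => ?_⟩
  have hγc := hγ.1
  have := hq (fun t => g.symm (γ t)) ⟨by fun_prop, fun t => ⟨?_, mem_univ _⟩⟩
  · rw [Dz_ev] at this ⊢
    simpa only [Coc.pull, map_smul, ContinuousLinearEquiv.apply_symm_apply] using this
  · rw [mem_Fb]
    simp only [hg, ContinuousLinearEquiv.apply_symm_apply]
    exact (hγ.2 t).1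

end P15

/-- the linear forms, as continuous linear maps -/
noncomputable def lfm {n : ℕ} (a : Fin n → Fin 3 → ℝ) (i : Fin n) : (Fin 3 → ℂ) →L[ℂ] ℂ :=
  ∑ k, (a i k : ℂ) • ContinuousLinearMap.proj (R := ℂ) (φ := fun _ : Fin 3 => ℂ) k

lemma lfm_apply {n : ℕ} (a : Fin n → Fin 3 → ℝ) (i : Fin n) (z : Fin 3 → ℂ) :
    lfm a i z = ∑ k, (a i k : ℂ) * z k := by
  simp [lfm, Fin.sum_univ_three]

lemma lfm_np {n : ℕ} {a : Fin n → Fin 3 → ℝ} (ha : ∀ i, a i ≠ 0)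
    (hind : ∀ i j : Fin n, i ≠ j → LinearIndependent ℝ ![a i, a j]) (i i' : Fin n) (hii : i ≠ i') (c : ℂ) :
    lfm a i ≠ c • lfm a i' := by
  intro h
  have hk : ∀ k, (a i k : ℂ) = c * a i' k := by
    intro k
    have := congrArg (fun f => f (Pi.single k (1 : ℂ))) h
    simpa [lfm_apply, Pi.single_apply] using this
  obtain ⟨k0, hk0⟩ := Function.ne_iff.1 (ha i')
  have hk0 : a i' k0 ≠ 0 := hk0
  have hc : c = ((a i k0 / a i' k0 : ℝ) : ℂ) := by
    have h0 : (a i' k0 : ℂ) ≠ 0 := by exact_mod_cast hk0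
    push_cast
    rw [hk k0]; field_simp
  have := (LinearIndependent.pair_iff.1 (hind i i' hii)) 1 (-(a i k0 / a i' k0)) (by
    ext k
    have h2 := hk k
    rw [hc] at h2
    have h3 : a i k = a i k0 / a i' k0 * a i' k := by exact_mod_cast h2
    simp only [one_smul, Pi.add_apply, Pi.smul_apply, smul_eq_mul, Pi.zero_apply]
    rw [h3]; ring)
  exact one_ne_zero this.1

lemma exists_arr {n : ℕ} (ℓ : Fin n → (Fin 3 → ℂ) →L[ℂ] ℂ) (hnp : ∀ i i', i ≠ i' → ∀ c : ℂ, ℓ i ≠ c • ℓ i')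
    {z : Fin 3 → ℂ} (hz : z ∈ Fb ℓ)
    (j : Fin n) (v₀ : Fin 3 → ℂ) (hv₀ : v₀ ≠ 0) (hv₀j : ℓ j v₀ = 0)
    (honly : ∀ w : Fin 3 → ℂ, w ≠ 0 → ℓ j w = 0 → 2 < Nat.card {i : Fin n // ℓ i w = 0} →
      Nat.gcd (Nat.card {i : Fin n // ℓ i w = 0}) n ≠ 1 → ∃ c : ℂ, w = c • v₀)
    (u : Fin 3 → ℂ) (huj : ℓ j u = 0) (hu2 : 2 ≤ Nat.card {i : Fin n // ℓ i u = 0})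
    (hu : ∀ c : ℂ, u ≠ c • v₀) :
    ∃ (R : Arr (Fin n)) (g : E3 ≃L[ℂ] (Fin 3 → ℂ)), ∀ i z, R.lf i z = ℓ i (g z) := by
  classical
  have hzj : ℓ j z ≠ 0 := Fb_sub_Mc hz j
  let e : Fin 3 → ℂ := (ℓ j z)⁻¹ • z
  have he : ℓ j e = 1 := by simp [e, hzj]
  let g0 : E3 →ₗ[ℂ] (Fin 3 → ℂ) :=
    { toFun := fun x => x.1 • e + x.2.1 • u + x.2.2 • v₀
      map_add' := fun x y => by
        simp only [Prod.fst_add, Prod.snd_add, add_smul]; abel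
      map_smul' := fun c x => by
        simp only [Prod.smul_fst, Prod.smul_snd, smul_eq_mul, mul_smul, smul_add, RingHom.id_apply] }
  have hg0 : Function.Injective g0 := by
    rw [injective_iff_map_eq_zero]
    rintro ⟨x, y, w⟩ hx
    have hx : x • e + y • u + w • v₀ = 0 := hx
    have hx0 : x = 0 := by
      have := congrArg (ℓ j) hx
      simpa [he, huj, hv₀j] using this
    subst hx0
    rw [zero_smul, zero_add] at hx
    have hy0 : y = 0 := by
      by_contra hy
      apply hu (-(y⁻¹ * w))
      have : y⁻¹ • (y • u + w • v₀) = 0 := by rw [hx, smul_zero]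
      rw [smul_add, smul_smul, inv_mul_cancel₀ hy, one_smul, smul_smul] at this
      rw [neg_smul]; exact eq_neg_of_add_eq_zero_left this
    subst hy0
    rw [zero_smul, zero_add, smul_eq_zero] at hx
    rw [hx.resolve_right hv₀]; rfl
  let g : E3 ≃L[ℂ] (Fin 3 → ℂ) := (LinearMap.linearEquivOfInjective g0 hg0 (by simp [E3])).toContinuousLinearEquiv
  have hg : ∀ x, g x = x.1 • e + x.2.1 • u + x.2.2 • v₀ := fun x => rfl
  have hval : ∀ i x, ℓ i (g x) = ℓ i e * x.1 + ℓ i u * x.2.1 + ℓ i v₀ * x.2.2 := by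
    intro i x; rw [hg]; simp only [map_add, map_smul, smul_eq_mul]; ring
  have hnp' : ∀ i i', i ≠ i' → ∀ c, ℓ i e = c * ℓ i' e → ℓ i u = c * ℓ i' u → ℓ i v₀ = c * ℓ i' v₀ → False := by
    intro i i' hii c h1 h2 h3
    apply hnp i i' hii c
    ext1 x
    obtain ⟨y, rfl⟩ := g.surjective x
    rw [smul_apply, smul_eq_mul, hval, hval, h1, h2, h3]; ring
  obtain ⟨l, hlj, hlu⟩ : ∃ l, l ≠ j ∧ ℓ l u = 0 := by
    rw [Nat.card_eq_fintype_card] at hu2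
    obtain ⟨⟨l, hl⟩, hne⟩ := Fintype.exists_ne_of_one_lt_card hu2 ⟨j, huj⟩
    exact ⟨l, fun h => hne (Subtype.ext h), hl⟩
  have hlv : ℓ l v₀ ≠ 0 := by
    intro h
    exact hnp' l j hlj (ℓ l e) (by rw [he, mul_one]) (by rw [huj, hlu, mul_zero]) (by rw [hv₀j, h, mul_zero])
  refine ⟨{ A := fun i => ℓ i e, B := fun i => ℓ i u, C := fun i => ℓ i v₀, j := j, l0 := l, hA := he, hB := huj,
            hC := hv₀j, hl0 := hlv, np := hnp', pts := ?_ }, g, ?_⟩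
  · intro π
    have hcard : Nat.card {i : Fin n // ℓ i (u + π • v₀) = 0} =
        (Finset.univ.filter fun i => ℓ i u + ℓ i v₀ * π = 0).card := by
      rw [Nat.card_eq_fintype_card, Fintype.card_subtype]
      congr 1
      ext i
      simp only [map_add, map_smul, smul_eq_mul, mul_comm π]
    rw [Fintype.card_fin]
    by_contra! hcon
    have hn : ∀ c : ℂ, u + π • v₀ ≠ c • v₀ := by
      intro c hc
      apply hu (c - π)
      rw [sub_smul, ← hc]; abel
    obtain ⟨c, hc⟩ := honly (u + π • v₀) (by simpa using hn 0) (by simp [huj, hv₀j])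
      (by rw [hcard]; convert hcon.1) (by rw [hcard]; convert hcon.2)
    exact hn c hc
  · intro i x
    rw [hval, Arr.lf_apply]

end MF
theorem milnor_fiber_homology_free_of_one_bad_point
    (n : ℕ) (hn : 1 ≤ n)
    (a : Fin n → Fin 3 → ℝ)
    (ha : ∀ i, a i ≠ 0)
    (hind : ∀ i j : Fin n, i ≠ j → LinearIndependent ℝ ![a i, a j])
    (ℓ : Fin n → (Fin 3 → ℂ) → ℂ)
    (hℓ : ∀ i z, ℓ i z = ∑ k, (a i k : ℂ) * z k)
    (m : (Fin 3 → ℂ) → ℕ)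
    (hm : ∀ v, m v = Nat.card {i : Fin n // ℓ i v = 0})
    (F : Set (Fin 3 → ℂ)) (hF : F = {z | ∏ i, ℓ i z = 1})
    (z₀ : F)
    (j : Fin n) (v₀ : Fin 3 → ℂ) (hv₀ : v₀ ≠ 0) (hv₀j : ℓ j v₀ = 0)
    (honly : ∀ w : Fin 3 → ℂ, w ≠ 0 → ℓ j w = 0 → 2 < m w → Nat.gcd (m w) n ≠ 1 →
      ∃ c : ℂ, w = c • v₀)
    (hother : ∃ u : Fin 3 → ℂ, u ≠ 0 ∧ ℓ j u = 0 ∧ 2 ≤ m u ∧ ∀ c : ℂ, u ≠ c • v₀) :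
    Nonempty (Additive (Abelianization (FundamentalGroup F z₀)) ≃+ (Fin (n - 1) → ℤ)) := by
  obtain ⟨N, rfl⟩ : ∃ N, n = N + 1 := ⟨n - 1, by omega⟩
  have hle : ℓ = fun i z => MF.lfm a i z := by
    funext i z; rw [hℓ, MF.lfm_apply]
  subst hle
  obtain rfl : m = fun v => Nat.card {i : Fin (N + 1) // MF.lfm a i v = 0} := funext hm
  have hF' : F = MF.Fb (MF.lfm a) := hF
  subst hF'
  obtain ⟨u, -, huj, hu2, hu⟩ := hother
  obtain ⟨R, g, hg⟩ := MF.exists_arr (MF.lfm a) (MF.lfm_np ha hind) z₀.2 j v₀ hv₀ hv₀j honly u huj hu2 hu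
  exact MF.main_gen (MF.lfm a) (MF.lfm_np ha hind) (fun Φ => MF.transfer R g hg Φ) z₀
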